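/- Suppose p > 3. Let g be a non-classical finite-dimensional restricted simple Lie algebra over k (i.e. g is a restricted simple Lie algebra of Cartan type or a Melikian algebra) and let V be a restricted g-module with dim_k V < p^{μ(g)} − 1. Then V is a trivial g-module. -/

import Mathlib

/-!
Preliminary definitions: restricted Lie algebras (following Strade–Farnsteiner),
tori, the invariants `μ` and `rk`.
-/

open scoped TensorProduct

section Defs

variable (p : ℕ) (k : Type*) [Field k] {L : Type*} [LieRing L] [LieAlgebra k L]

/-- Jacobson's formula for a `p`-operation `op` on a Lie algebra `L`:
`(x+y)^{[p]} = x^{[p]} + y^{[p]} + ∑_{i=1}^{p-1} sᵢ(x,y)`, where the `sᵢ(x,y)` are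
determined by `∑ i·sᵢ(x,y)·tⁱ⁻¹ = ad(t•x + y)^{p-1}(x)` in `L ⊗ k[t]`. -/
def JacobsonFormula (op : L → L) : Prop :=
  ∀ x y : L, ∃ s : ℕ → L,
    ((LieAlgebra.ad (Polynomial k) (Polynomial k ⊗[k] L)
        (Polynomial.X ⊗ₜ[k] x + (1 : Polynomial k) ⊗ₜ[k] y)) ^ (p - 1))
        ((1 : Polynomial k) ⊗ₜ[k] x)
      = ∑ i ∈ Finset.range (p - 1), (Polynomial.X ^ i : Polynomial k) ⊗ₜ[k] (((i + 1) • s (i + 1) : L)) ∧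
    op (x + y) = op x + op y + ∑ i ∈ Finset.range (p - 1), s (i + 1)

/-- `op` is a `p`-map (restricted structure) on the Lie algebra `L`. -/
structure IsPMap (op : L → L) : Prop where
  ad_op : ∀ x : L, LieAlgebra.ad k L (op x) = (LieAlgebra.ad k L x) ^ p
  op_smul : ∀ (c : k) (x : L), op (c • x) = c ^ p • op x
  jacobson : JacobsonFormula p k op

variable {p}

/-- An element of a restricted Lie algebra is semisimple if it lies in the span of its
iterated `p`-th powers. -/
def IsSemisimpleElt (op : L → L) (x : L) : Prop :=
  x ∈ Submodule.span k {y : L | ∃ m : ℕ, 1 ≤ m ∧ y = op^[m] x}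

/-- An element is `p`-nilpotent if some iterate of the `p`-map kills it. -/
def IsPNilpotentElt (op : L → L) (x : L) : Prop :=
  ∃ m : ℕ, op^[m] x = 0

/-- A torus of a restricted Lie algebra: a `p`-subalgebra consisting of semisimple
elements. -/
def IsTorus (op : L → L) (t : LieSubalgebra k L) : Prop :=
  (∀ x ∈ t, op x ∈ t) ∧ ∀ x ∈ t, IsSemisimpleElt k op x

/-- `μ(L)`: the maximal dimension of a torus of the restricted Lie algebra `(L, op)`. -/
noncomputable def mu (op : L → L) : ℕ :=
  sSup {d : ℕ | ∃ t : LieSubalgebra k L, IsTorus k op t ∧ Module.finrank k t = d}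

/-- The restriction of the `p`-map to a `p`-subalgebra. -/
def subOp (op : L → L) (K : LieSubalgebra k L) (h : ∀ x ∈ K, op x ∈ K) : K → K :=
  fun x => ⟨op x, h x x.2⟩

end Defs

/-- The rank of a (restricted) Lie algebra: the minimal dimension of a Cartan
subalgebra. By Premet's theorem this agrees with `dim C_L(t)` for any torus of maximal
dimension. -/
noncomputable def lieRank (k L : Type*) [Field k] [LieRing L] [LieAlgebra k L] : ℕ :=
  sInf {d : ℕ | ∃ H : LieSubalgebra k L, H.IsCartanSubalgebra ∧ Module.finrank k H = d}

/-- The canonical projection onto the quotient by a Lie ideal, as a morphism of Lie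
algebras. -/
def quotMk {k L : Type*} [Field k] [LieRing L] [LieAlgebra k L] (I : LieIdeal k L) :
    L →ₗ⁅k⁆ L ⧸ I :=
  { I.toSubmodule.mkQ with map_lie' := rfl }

section Modules

variable (p : ℕ) (k : Type*) [Field k] {L : Type*} [LieRing L] [LieAlgebra k L]

/-- A restricted module over the restricted Lie algebra `(L, op)`: the `p`-map acts as the
`p`-th power of the action. -/
def IsRestrictedModule (op : L → L) (V : Type*) [AddCommGroup V] [Module k V]
    [LieRingModule L V] [LieModule k L V] : Prop :=
  ∀ (x : L) (v : V), ⁅op x, v⁆ = ((LieModule.toEnd k L V x) ^ p) v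

/-- The weight space of a linear character `χ` of a subalgebra `t` on a module `V`. -/
def charWeightSpace (t : LieSubalgebra k L) (χ : t →ₗ[k] k) (V : Type*) [AddCommGroup V]
    [Module k V] [LieRingModule L V] [LieModule k L V] : Submodule k V where
  carrier := {v | ∀ x : t, ⁅(x : L), v⁆ = χ x • v}
  add_mem' := by
    intro a b ha hb x
    rw [lie_add, ha x, hb x, smul_add]
  zero_mem' := by
    intro x
    rw [lie_zero, smul_zero]
  smul_mem' := by
    intro c a ha x
    rw [lie_smul, ha x, smul_comm]

end Modules

/-!
The truncated polynomial ring `A(n) = k[X₁,…,Xₙ]/(X₁^p,…,Xₙ^p)`, its partial derivatives,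
the Jacobson–Witt algebra `W(n) = Der(A(n))`, and related Lie algebras of Cartan type.
-/

set_option synthInstance.maxHeartbeats 1000000
set_option maxHeartbeats 1600000

section Trunc

variable (p : ℕ) (k : Type*) [Field k] (n : ℕ)

/-- The defining ideal `(X₁^p, …, Xₙ^p)`. -/
noncomputable abbrev truncIdeal : Ideal (MvPolynomial (Fin n) k) :=
  Ideal.span {f | ∃ i : Fin n, f = MvPolynomial.X i ^ p}

/-- The truncated polynomial ring `A(n) := k[X₁,…,Xₙ]/(X₁^p,…,Xₙ^p)`. -/
noncomputable abbrev TruncPoly := MvPolynomial (Fin n) k ⧸ truncIdeal p k n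

variable [CharP k p]

theorem pderiv_mem_truncIdeal (i : Fin n) {f : MvPolynomial (Fin n) k}
    (hf : f ∈ truncIdeal p k n) : MvPolynomial.pderiv i f ∈ truncIdeal p k n := by
  induction hf using Submodule.span_induction with
  | mem x hx =>
    obtain ⟨j, rfl⟩ := hx
    have h0 : (p : MvPolynomial (Fin n) k) = 0 := CharP.cast_eq_zero _ p
    rw [Derivation.leibniz_pow]
    rw [nsmul_eq_mul, h0, zero_mul]
    exact Ideal.zero_mem _
  | zero => simp only [map_zero]; exact Ideal.zero_mem _
  | add x y _ _ hx hy => rw [map_add]; exact Ideal.add_mem _ hx hy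
  | smul a x hxmem hx =>
    rw [smul_eq_mul, Derivation.leibniz, smul_eq_mul, smul_eq_mul]
    exact Ideal.add_mem _ (Ideal.mul_mem_left _ _ hx) (Ideal.mul_mem_right _ _ hxmem)

/-- The partial derivative `∂/∂Xᵢ` on the truncated polynomial ring, as a derivation. -/
noncomputable def truncPD (i : Fin n) :
    Derivation k (TruncPoly p k n) (TruncPoly p k n) where
  toFun := fun a => Quotient.liftOn' a
    (fun f => Ideal.Quotient.mk (truncIdeal p k n) (MvPolynomial.pderiv i f))
    (by
      intro f g hfg
      rw [Submodule.quotientRel_def] at hfg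
      rw [Ideal.Quotient.eq]
      rw [← map_sub]
      exact pderiv_mem_truncIdeal p k n i hfg)
  map_add' := by
    rintro ⟨f⟩ ⟨g⟩
    show Ideal.Quotient.mk _ (MvPolynomial.pderiv i (f + g)) =
      Ideal.Quotient.mk _ (MvPolynomial.pderiv i f) +
        Ideal.Quotient.mk _ (MvPolynomial.pderiv i g)
    rw [map_add, map_add]
  map_smul' := by
    rintro c ⟨f⟩
    show Ideal.Quotient.mkₐ k (truncIdeal p k n) (MvPolynomial.pderiv i (c • f)) =
      c • Ideal.Quotient.mkₐ k (truncIdeal p k n) (MvPolynomial.pderiv i f)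
    rw [Derivation.map_smul, map_smul]
  map_one_eq_zero' := by
    show Ideal.Quotient.mk (truncIdeal p k n) (MvPolynomial.pderiv i 1) = 0
    simp only [Derivation.map_one_eq_zero, map_zero]
  leibniz' := by
    rintro ⟨f⟩ ⟨g⟩
    show Ideal.Quotient.mk (truncIdeal p k n) (MvPolynomial.pderiv i (f * g)) =
      (Ideal.Quotient.mk (truncIdeal p k n) f) *
          (Ideal.Quotient.mk (truncIdeal p k n) (MvPolynomial.pderiv i g)) +
        (Ideal.Quotient.mk (truncIdeal p k n) g) *
          (Ideal.Quotient.mk (truncIdeal p k n) (MvPolynomial.pderiv i f))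
    rw [Derivation.leibniz, smul_eq_mul, smul_eq_mul, map_add, map_mul, map_mul]

/-- The image of the variable `Xᵢ` in the truncated polynomial ring. -/
noncomputable def truncX (i : Fin n) : TruncPoly p k n :=
  Ideal.Quotient.mk (truncIdeal p k n) (MvPolynomial.X i)

end Trunc

section CartanAlgebras

variable (p : ℕ) (k : Type*) [Field k] [CharP k p]

/-- The restricted Jacobson–Witt algebra `W(n) := Der(A(n))`. -/
noncomputable abbrev WittAlg (n : ℕ) :=
  Derivation k (TruncPoly p k n) (TruncPoly p k n)

/-- The divergence of a derivation `D = ∑ fᵢ ∂ᵢ`, namely `∑ ∂ᵢ(fᵢ) = ∑ ∂ᵢ(D(xᵢ))`. -/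
noncomputable def divergence (n : ℕ) (D : WittAlg p k n) : TruncPoly p k n :=
  ∑ i : Fin n, truncPD p k n i (D (truncX p k n i))

/-- The linear embedding of `W(n)` into the associative algebra of `k`-linear
endomorphisms of `A(n)`; the `p`-map of `W(n)` is `D ↦ D^p` under this embedding. -/
noncomputable def derToEnd (n : ℕ) :
    WittAlg p k n →ₗ[k] Module.End k (TruncPoly p k n) where
  toFun D := D.toLinearMap
  map_add' := fun _ _ => rfl
  map_smul' := fun _ _ => rfl

/-- The Hamiltonian map `D_H : A(2r) → W(2r)`,
`f ↦ ∑ᵢ (∂ᵢ(f) ∂_{i+r} − ∂_{i+r}(f) ∂ᵢ)`. -/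
noncomputable def DH (r : ℕ) (f : TruncPoly p k (2 * r)) : WittAlg p k (2 * r) :=
  ∑ i : Fin r,
    (truncPD p k (2 * r) ⟨i.1, by have := i.isLt; omega⟩ f •
        truncPD p k (2 * r) ⟨i.1 + r, by have := i.isLt; omega⟩
      - truncPD p k (2 * r) ⟨i.1 + r, by have := i.isLt; omega⟩ f •
        truncPD p k (2 * r) ⟨i.1, by have := i.isLt; omega⟩)

/-- The contact map `D_K : A(2r+1) → W(2r+1)` (Strade–Farnsteiner, §4.5). -/
noncomputable def DK (r : ℕ) (f : TruncPoly p k (2 * r + 1)) : WittAlg p k (2 * r + 1) :=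
  (∑ i : Fin r,
    ((truncX p k (2 * r + 1) ⟨i.1, by have := i.isLt; omega⟩ *
        truncPD p k (2 * r + 1) (Fin.last (2 * r)) f
      - truncPD p k (2 * r + 1) ⟨i.1 + r, by have := i.isLt; omega⟩ f) •
        truncPD p k (2 * r + 1) ⟨i.1, by have := i.isLt; omega⟩
    + (truncX p k (2 * r + 1) ⟨i.1 + r, by have := i.isLt; omega⟩ *
        truncPD p k (2 * r + 1) (Fin.last (2 * r)) f
      + truncPD p k (2 * r + 1) ⟨i.1, by have := i.isLt; omega⟩ f) •
        truncPD p k (2 * r + 1) ⟨i.1 + r, by have := i.isLt; omega⟩))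
  + ((2 : TruncPoly p k (2 * r + 1)) * f
      - ∑ i : Fin (2 * r), truncX p k (2 * r + 1) ⟨i.1, by have := i.isLt; omega⟩ *
          truncPD p k (2 * r + 1) ⟨i.1, by have := i.isLt; omega⟩ f) •
      truncPD p k (2 * r + 1) (Fin.last (2 * r))

/-- The derived subalgebra `[K, K]` of a Lie subalgebra. -/
noncomputable def derivedSub {L : Type*} [LieRing L] [LieAlgebra k L]
    (K : LieSubalgebra k L) : LieSubalgebra k L :=
  LieSubalgebra.lieSpan k L {z | ∃ x ∈ K, ∃ y ∈ K, z = ⁅x, y⁆}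

/-- `K''(2r+1) = {D ∈ W(n) | D(ω_K) ∈ A(n)·ω_K}`, realized as the image of `D_K`. -/
noncomputable def contactAmbient (r : ℕ) : LieSubalgebra k (WittAlg p k (2 * r + 1)) :=
  LieSubalgebra.lieSpan k _ (Set.range (DK p k r))

/-- The restricted contact algebra `K(2r+1) := [K''(2r+1), K''(2r+1)]`. -/
noncomputable def contactAlg (r : ℕ) : LieSubalgebra k (WittAlg p k (2 * r + 1)) :=
  derivedSub k (contactAmbient p k r)

/-- `H'(2r) := D_H(A(2r))`, the image of the Hamiltonian map. -/
noncomputable def hamiltonianAmbient (r : ℕ) : LieSubalgebra k (WittAlg p k (2 * r)) :=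
  LieSubalgebra.lieSpan k _ (Set.range (DH p k r))

/-- The restricted Hamiltonian algebra `H(2r) := H'(2r)^{(1)}`. -/
noncomputable def hamiltonianAlg (r : ℕ) : LieSubalgebra k (WittAlg p k (2 * r)) :=
  derivedSub k (hamiltonianAmbient p k r)

/-- `S̃(n) := {D ∈ W(n) | div(D) = 0}`. -/
noncomputable def specialAmbient (n : ℕ) : LieSubalgebra k (WittAlg p k n) :=
  LieSubalgebra.lieSpan k _ {D | divergence p k n D = 0}

/-- The restricted special algebra `S(n) := S̃(n)^{(1)}`. -/
noncomputable def specialAlg (n : ℕ) : LieSubalgebra k (WittAlg p k n) :=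
  derivedSub k (specialAmbient p k n)

/-- A torus of a `p`-subalgebra `K` of the Jacobson–Witt algebra `W(n)` (whose `p`-map is
`D ↦ D^p`, the `p`-th power in `End_k(A(n))`): a subalgebra of `K` closed under the
`p`-power map and consisting of semisimple elements. -/
def IsTorusIn (n : ℕ) (K : LieSubalgebra k (WittAlg p k n))
    (T : Submodule k (WittAlg p k n)) : Prop :=
  (∀ x ∈ T, x ∈ K) ∧
  (∀ x ∈ T, ∀ y ∈ T, ⁅x, y⁆ ∈ T) ∧
  (∀ x ∈ T, ∃ y ∈ T, derToEnd p k n y = (derToEnd p k n x) ^ p) ∧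
  (∀ x ∈ T, derToEnd p k n x ∈ Submodule.span k
    {z : Module.End k (TruncPoly p k n) | ∃ m : ℕ, 1 ≤ m ∧ z = (derToEnd p k n x) ^ (p ^ m)})

/-- `μ(K)`: the maximal dimension of a torus of `K ⊆ W(n)`. -/
noncomputable def muIn (n : ℕ) (K : LieSubalgebra k (WittAlg p k n)) : ℕ :=
  sSup {d : ℕ | ∃ T : Submodule k (WittAlg p k n),
    IsTorusIn p k n K T ∧ Module.finrank k T = d}

end CartanAlgebras

/-- The rank of a Lie subalgebra `K`: the minimal dimension of a Cartan subalgebra of the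
Lie algebra `K`. -/
noncomputable def lieRankOf (k : Type*) [Field k] {L : Type*} [LieRing L] [LieAlgebra k L]
    (K : LieSubalgebra k L) : ℕ :=
  sInf {d : ℕ | ∃ H : LieSubalgebra k K, H.IsCartanSubalgebra ∧ Module.finrank k H = d}
section Melikian

variable (p : ℕ) (k : Type*) [Field k] [CharP k p]

/-- The underlying vector space `W(2) ⊕ A(2) ⊕ W̃(2)` of the Melikian algebra. -/
noncomputable abbrev MelikianCarrier :=
  (WittAlg p k 2) × (TruncPoly p k 2) × (WittAlg p k 2)

/-- The bracket of the restricted Melikian algebra `M(1,1)` (char 5), given on the three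
summands `W(2) ⊕ A(2) ⊕ W̃(2)` by `[D, Ẽ] = [D,E]~ + 2 div(D) Ẽ`,
`[D, f] = D(f) − 2 div(D) f`, `[f, Ẽ] = fE`,
`[f, g] = 2(g ∂₂(f) − f ∂₂(g)) ∂̃₁ + 2(f ∂₁(g) − g ∂₁(f)) ∂̃₂` and
`[f₁∂̃₁ + f₂∂̃₂, g₁∂̃₁ + g₂∂̃₂] = f₁ g₂ − f₂ g₁`. -/
noncomputable def melikianBracket (x y : MelikianCarrier p k) : MelikianCarrier p k :=
  (⁅x.1, y.1⁆ + x.2.1 • y.2.2 - y.2.1 • x.2.2,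
   x.1 (y.2.1) - y.1 (x.2.1)
     - (2 : TruncPoly p k 2) * divergence p k 2 x.1 * y.2.1
     + (2 : TruncPoly p k 2) * divergence p k 2 y.1 * x.2.1
     + (x.2.2 (truncX p k 2 0) * y.2.2 (truncX p k 2 1)
        - x.2.2 (truncX p k 2 1) * y.2.2 (truncX p k 2 0)),
   ⁅x.1, y.2.2⁆ + ((2 : TruncPoly p k 2) * divergence p k 2 x.1) • y.2.2
     - ⁅y.1, x.2.2⁆ - ((2 : TruncPoly p k 2) * divergence p k 2 y.1) • x.2.2
     + ((2 : TruncPoly p k 2) * (y.2.1 * truncPD p k 2 1 x.2.1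
         - x.2.1 * truncPD p k 2 1 y.2.1)) • truncPD p k 2 0
     + ((2 : TruncPoly p k 2) * (x.2.1 * truncPD p k 2 0 y.2.1
         - y.2.1 * truncPD p k 2 0 x.2.1)) • truncPD p k 2 1)

/-- `L` is (isomorphic to) the restricted Melikian algebra `M(1,1)`; this occurs only in
characteristic `5`. -/
def IsMelikian (L : Type*) [LieRing L] [LieAlgebra k L] : Prop :=
  p = 5 ∧ ∃ e : L ≃ₗ[k] MelikianCarrier p k,
    ∀ x y : L, e ⁅x, y⁆ = melikianBracket p k (e x) (e y)

end Melikian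

section Classification

variable (p : ℕ) (k : Type*) [Field k] [CharP k p]

/-- `L` is one of the restricted simple Lie algebras of Cartan type:
`W(n)` (n ≥ 1), `S(n)` (n ≥ 3), `H(2r)` (r ≥ 1) or `K(2r+1)` (r ≥ 1). -/
def IsCartanTypeSimple (L : Type*) [LieRing L] [LieAlgebra k L] : Prop :=
  (∃ n : ℕ, 1 ≤ n ∧ Nonempty (L ≃ₗ⁅k⁆ WittAlg p k n)) ∨
  (∃ n : ℕ, 3 ≤ n ∧ Nonempty (L ≃ₗ⁅k⁆ specialAlg p k n)) ∨
  (∃ r : ℕ, 1 ≤ r ∧ Nonempty (L ≃ₗ⁅k⁆ hamiltonianAlg p k r)) ∨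
  (∃ r : ℕ, 1 ≤ r ∧ Nonempty (L ≃ₗ⁅k⁆ contactAlg p k r))

/-- By the classification of restricted simple Lie algebras in characteristic `p > 3`, a
*non-classical* restricted simple Lie algebra is of Cartan type or Melikian. -/
def IsNonClassicalRestrictedSimple (L : Type*) [LieRing L] [LieAlgebra k L] : Prop :=
  IsCartanTypeSimple p k L ∨ IsMelikian p k L

end Classification

set_option synthInstance.maxHeartbeats 1000000
set_option maxHeartbeats 1600000
set_option linter.unusedSectionVars false
set_option linter.unusedVariables false
set_option linter.unusedSimpArgs false


section PencilPart
open Polynomial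

theorem eis_irred {k : Type*} [Field k] (c : k) (hc : c ≠ 0) (Q : ℕ) (hQ : 0 < Q) :
    Irreducible ((X ^ Q - C (algebraMap k[X] (RatFunc k) (C c * X)) : (RatFunc k)[X])) := by
  have hm : (X ^ Q - C (C c * X) : k[X][X]).Monic := monic_X_pow_sub_C _ hQ.ne'
  have hprime : (Ideal.span {(X : k[X])}).IsPrime := by
    rw [Ideal.span_singleton_prime X_ne_zero]; exact prime_X
  have hd : (X ^ Q - C (C c * X) : k[X][X]).natDegree = Q := natDegree_X_pow_sub_C
  have he : (X ^ Q - C (C c * X) : k[X][X]).IsEisensteinAt (Ideal.span {(X : k[X])}) := by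
    refine ⟨?_, ?_, ?_⟩
    · rw [hm.leadingCoeff]
      rw [Ideal.mem_span_singleton]
      exact fun h => not_isUnit_X (isUnit_of_dvd_one h)
    · intro i hi
      rw [hd] at hi
      rw [coeff_sub, coeff_X_pow, if_neg hi.ne, coeff_C, zero_sub, Ideal.mem_span_singleton]
      split_ifs
      · exact (dvd_mul_left _ _).neg_right
      · simp
    · rw [coeff_sub, coeff_X_pow, if_neg hQ.ne, coeff_C_zero, zero_sub, Ideal.span_singleton_pow,
        Ideal.mem_span_singleton]
      intro h
      rw [dvd_neg, X_pow_dvd_iff] at h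
      have := h 1 (by norm_num)
      simp at this
      exact hc this
  have hi := he.irreducible hprime hm.isPrimitive (by rw [hd]; exact hQ)
  have := (hm.irreducible_iff_irreducible_map_fraction_map (K := RatFunc k)).1 hi
  simpa using this

theorem matrix_pencil {k : Type*} [Field k] [Infinite k] {n : ℕ}
    (A B : Matrix (Fin n) (Fin n) k) (c : k) (hc : c ≠ 0) (Q M : ℕ)
    (h : ∀ l : k, ((A + l • B) ^ (Q + 1) - (c * l) • (A + l • B)) ^ M = 0) (hn : n < Q) :
    IsNilpotent (A + B) := by
  set Y : Matrix (Fin n) (Fin n) k[X] := A.map C + (X : k[X]) • B.map C with hY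
  have hev : ∀ l : k, (evalRingHom l).mapMatrix Y = A + l • B := by
    intro l; ext i j; simp [hY]; ring
  have h1 : (Y ^ (Q + 1) - (C c * X) • Y) ^ M = 0 := by
    ext i j : 1
    apply Polynomial.funext
    intro l
    have := congrFun (congrFun (h l) i) j
    rw [← hev l] at this
    have e2 : (c * l) • (evalRingHom l).mapMatrix Y = (evalRingHom l).mapMatrix ((C c * X) • Y) := by
      ext i j; simp
    rw [e2, ← map_pow, ← map_sub, ← map_pow] at this
    simpa using this
  set K := RatFunc k
  set φ := (algebraMap k[X] K).mapMatrix (m := Fin n)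
  set Z := φ Y with hZ
  have h2 : (Z ^ (Q + 1) - (algebraMap k[X] K (C c * X)) • Z) ^ M = 0 := by
    have e2 : (algebraMap k[X] K (C c * X)) • Z = φ ((C c * X) • Y) := by
      ext i j; simp [φ, hZ]
    rw [e2, hZ, ← map_pow, ← map_sub, ← map_pow, h1, map_zero]
  set P : K[X] := X ^ Q - C (algebraMap k[X] K (C c * X)) with hP
  have hirr : Irreducible P := eis_irred c hc Q (by omega)
  have hdvd : minpoly K Z ∣ (X * P) ^ M := by
    apply minpoly.dvd
    rw [map_pow, ← h2]
    congr 1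
    rw [hP]
    rw [map_mul, map_sub, aeval_X, map_pow, aeval_X, aeval_C,
      mul_sub, ← pow_succ', Algebra.algebraMap_eq_smul_one, mul_smul_comm, mul_one]
  have hint : IsIntegral K Z := Matrix.isIntegral Z
  have hdeg : (minpoly K Z).natDegree ≤ n := by
    have := natDegree_le_of_dvd (Matrix.minpoly_dvd_charpoly Z) (Matrix.charpoly_monic Z).ne_zero
    rw [Matrix.charpoly_natDegree_eq_dim] at this
    simpa using this
  have hcop : IsCoprime (minpoly K Z) (P ^ M) := by
    apply IsCoprime.pow_right
    rw [isCoprime_comm]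
    rw [hirr.coprime_iff_not_dvd]
    intro hd
    have := natDegree_le_of_dvd hd (minpoly.ne_zero hint)
    rw [hP, natDegree_X_pow_sub_C] at this
    omega
  have hdvd2 : minpoly K Z ∣ X ^ M := by
    rw [mul_pow] at hdvd
    exact hcop.dvd_of_dvd_mul_right hdvd
  have hZ0 : Z ^ M = 0 := by
    have := (minpoly.dvd_iff).1 hdvd2
    simpa using this
  have hY0 : Y ^ M = 0 := by
    have hinj : Function.Injective φ := by
      intro a b hab
      ext i j : 1
      have := congrFun (congrFun hab i) j
      exact IsFractionRing.injective k[X] K (by simpa [φ] using this)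
    apply hinj
    rw [map_pow, map_zero, ← hZ, hZ0]
  refine ⟨M, ?_⟩
  have := hev 1
  rw [one_smul] at this
  rw [← this, ← map_pow, hY0, map_zero]

end PencilPart

section GenLie
variable {p : ℕ} {k : Type*} [Field k] {L : Type*} [LieRing L] [LieAlgebra k L] {op : L → L}

theorem ad_iter (hop : IsPMap p k op) (j : ℕ) (x : L) :
    LieAlgebra.ad k L (op^[j] x) = (LieAlgebra.ad k L x) ^ (p ^ j) := by
  induction j with
  | zero => simp
  | succ j ih => rw [Function.iterate_succ_apply', hop.ad_op, ih, ← pow_mul, pow_succ]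

theorem ad_inj_of_simple (hs : LieAlgebra.IsSimple k L) {x : L}
    (hx : ∀ y : L, ⁅x, y⁆ = 0) : x = 0 := by
  have := hs
  have h2 : LieAlgebra.center k L = ⊥ := LieAlgebra.center_eq_bot k L
  have : x ∈ LieAlgebra.center k L := by
    intro y
    rw [← lie_skew, hx, neg_zero]
  rw [h2] at this
  simpa using this

theorem ad_inj_of_simple' (hs : LieAlgebra.IsSimple k L) {x : L}
    (hx : LieAlgebra.ad k L x = 0) : x = 0 :=
  ad_inj_of_simple hs fun y => by rw [← LieAlgebra.ad_apply k, hx]; rfl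

theorem rep_iter {V : Type*} [AddCommGroup V] [Module k V] [LieRingModule L V] [LieModule k L V]
    (hV : IsRestrictedModule p k op V) (j : ℕ) (x : L) :
    LieModule.toEnd k L V (op^[j] x) = (LieModule.toEnd k L V x) ^ (p ^ j) := by
  induction j with
  | zero => simp
  | succ j ih =>
    rw [Function.iterate_succ_apply', pow_succ, pow_mul, ← ih]
    ext v
    exact hV _ v

theorem rep_inj (hs : LieAlgebra.IsSimple k L)
    {V : Type*} [AddCommGroup V] [Module k V] [LieRingModule L V] [LieModule k L V]
    (hnt : ¬ LieModule.IsTrivial L V) {x : L} (hx : LieModule.toEnd k L V x = 0) : x = 0 := by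
  have hx : x ∈ LieModule.ker k L V := by rw [LieModule.mem_ker]; intro v; exact congrArg (fun f => f v) hx
  rcases hs.eq_bot_or_eq_top (LieModule.ker k L V) with h | h
  · rw [h] at hx; simpa using hx
  · exfalso
    apply hnt
    refine ⟨fun x v => ?_⟩
    have : x ∈ LieModule.ker k L V := by rw [h]; trivial
    rw [LieModule.mem_ker] at this
    exact this v

theorem pencil_bound (hp : p.Prime) [IsAlgClosed k] (hs : LieAlgebra.IsSimple k L)
    (hop : IsPMap p k op)
    {V : Type*} [AddCommGroup V] [Module k V] [LieRingModule L V] [LieModule k L V]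
    [FiniteDimensional k V] (hV : IsRestrictedModule p k op V)
    (hnt : ¬ LieModule.IsTrivial L V) (m N : ℕ) (a b : L) (c : k) (hc : c ≠ 0)
    (h : ∀ l : k, ((LieAlgebra.ad k L (a + l • b)) ^ (p ^ m)
      - (c * l) • LieAlgebra.ad k L (a + l • b)) ^ (p ^ N) = 0)
    (hn : ¬ IsNilpotent (LieAlgebra.ad k L (a + b))) : p ^ m - 1 ≤ Module.finrank k V := by
  by_contra hlt
  push Not at hlt
  set ρ := LieModule.toEnd k L V
  have h1 : ∀ l : k, ((ρ (a + l • b)) ^ (p ^ m) - (c * l) • ρ (a + l • b)) ^ (p ^ N) = 0 := by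
    intro l
    set y := a + l • b
    have hE : op^[N] (op^[m] y - (c * l) • y) = 0 := by
      apply ad_inj_of_simple' (k := k) hs
      rw [ad_iter hop, map_sub, ad_iter hop, map_smul, h l]
    rw [← rep_iter hV, ← map_smul, ← map_sub, ← rep_iter hV, hE, map_zero]
  have hp2 := hp.two_le
  set e := LinearMap.toMatrixAlgEquiv (Module.finBasis k V)
  have hnil : IsNilpotent (e (ρ a) + e (ρ b)) := by
    apply matrix_pencil (e (ρ a)) (e (ρ b)) c hc (p ^ m - 1) (p ^ N) _ hlt
    intro l
    have := congrArg e (h1 l)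
    have hpm : p ^ m - 1 + 1 = p ^ m := Nat.sub_add_cancel (Nat.one_le_pow _ _ (by omega))
    rw [hpm]
    simpa using this
  rw [← map_add, ← map_add] at hnil
  have hnil2 : IsNilpotent (ρ (a + b)) := by
    obtain ⟨M, hM⟩ := hnil
    refine ⟨M, e.injective ?_⟩
    rw [map_pow, hM, map_zero]
  apply hn
  obtain ⟨M, hM⟩ := hnil2
  refine ⟨p ^ M, ?_⟩
  rw [← ad_iter hop]
  have : op^[M] (a + b) = 0 := by
    apply rep_inj hs hnt
    have e3 := rep_iter hV M (a + b)
    rw [e3]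
    exact pow_eq_zero_of_le (Nat.lt_pow_self (by omega)).le hM
  rw [this, map_zero]

end GenLie

section Diag
variable {p : ℕ} {k : Type*} [Field k] {M : Type*} [AddCommGroup M] [Module k M]

/-- `f` lies in the span of its iterated `p`-powers. -/
def PSS (p : ℕ) (f : Module.End k M) : Prop :=
  f ∈ Submodule.span k {g : Module.End k M | ∃ m : ℕ, 1 ≤ m ∧ g = f ^ (p ^ m)}

theorem PSS.isSemisimple [CharP k p] {f : Module.End k M} (h : PSS p f) : f.IsSemisimple := by
  set S : Set (Polynomial k) := {g | ∃ m : ℕ, 1 ≤ m ∧ g = Polynomial.X ^ (p ^ m)}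
  have h1 : {g : Module.End k M | ∃ m : ℕ, 1 ≤ m ∧ g = f ^ (p ^ m)}
      = (Polynomial.aeval f).toLinearMap '' S := by
    ext g; constructor
    · rintro ⟨m, hm, rfl⟩; exact ⟨_, ⟨m, hm, rfl⟩, by simp⟩
    · rintro ⟨_, ⟨m, hm, rfl⟩, rfl⟩; exact ⟨m, hm, by simp⟩
  unfold PSS at h
  rw [h1, ← Submodule.map_span] at h
  obtain ⟨Q, hQ, hf⟩ := h
  have hd : Polynomial.derivative Q = 0 := by
    have : Submodule.span k S ≤ LinearMap.ker (Polynomial.derivative (R := k)) := by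
      rw [Submodule.span_le]
      rintro _ ⟨m, hm, rfl⟩
      simp only [SetLike.mem_coe, LinearMap.mem_ker, Polynomial.derivative_X_pow]
      obtain ⟨m, rfl⟩ := Nat.exists_eq_add_of_le hm
      simp [pow_add]
    exact this hQ
  have hsep : (Polynomial.X - Q).Separable := by
    rw [Polynomial.Separable]
    simp only [Polynomial.derivative_sub, Polynomial.derivative_X, hd, sub_zero]
    exact isCoprime_one_right
  apply Module.End.isSemisimple_of_squarefree_aeval_eq_zero hsep.squarefree
  simp only [map_sub, Polynomial.aeval_X]
  rw [sub_eq_zero]; exact hf.symm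

theorem PSS.ker_sq (hp : 2 ≤ p) {f : Module.End k M} (h : PSS p f) {v : M} (hv : f (f v) = 0) :
    f v = 0 := by
  have : Submodule.span k {g : Module.End k M | ∃ m : ℕ, 1 ≤ m ∧ g = f ^ (p ^ m)}
      ≤ LinearMap.ker (LinearMap.applyₗ (R := k) (M₂ := M) v) := by
    rw [Submodule.span_le]
    rintro _ ⟨m, hm, rfl⟩
    have h2 : 2 ≤ p ^ m := hp.trans (Nat.le_self_pow (by omega) p)
    obtain ⟨j, hj⟩ := Nat.exists_eq_add_of_le h2
    simp only [SetLike.mem_coe, LinearMap.mem_ker, LinearMap.applyₗ_apply_apply]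
    rw [hj, add_comm, pow_add, pow_two]
    simp [hv]
  exact this h

variable {T : Type*} [AddCommGroup T] [Module k T]

/-- joint weight vectors -/
def IsWt (f : T →ₗ[k] Module.End k M) (v : M) : Prop :=
  ∃ χ : T →ₗ[k] k, ∀ t, f t v = χ t • v

theorem joint_diag [IsAlgClosed k] [FiniteDimensional k M] (f : T →ₗ[k] Module.End k M)
    (hc : ∀ s t, Commute (f s) (f t)) (hs : ∀ t, (f t).IsSemisimple)
    (N : Submodule k M) (hN : ∀ t, ∀ v ∈ N, f t v ∈ N) :
    Submodule.span k {v | v ∈ N ∧ IsWt f v} = N := by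
  apply le_antisymm
  · rw [Submodule.span_le]; exact fun v hv => hv.1
  set g : T → Module.End k N := fun t => (f t).restrict (hN t)
  have hg : ∀ t, (g t).IsSemisimple := fun t => (hs t).restrict (hN t)
  have h := Module.End.iSup_iInf_maxGenEigenspace_eq_top_of_iSup_maxGenEigenspace_eq_top_of_commute
    g (fun s t _ => by
      apply LinearMap.ext
      intro v
      apply Subtype.ext
      exact congrArg (fun F => F (v : M)) (hc s t).eq)
    (fun t => Module.End.iSup_maxGenEigenspace_eq_top _)
  have key : ∀ χ : T → k, (⨅ t, (g t).maxGenEigenspace (χ t)) ≤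
      (Submodule.span k {v | v ∈ N ∧ IsWt f v}).comap N.subtype := by
    intro χ v hv
    rw [Submodule.mem_comap]
    have hv2 : ∀ t, f t v = χ t • (v : M) := by
      intro t
      have := (Submodule.mem_iInf _).1 hv t
      rw [(Module.End.isFinitelySemisimple_iff_isSemisimple.mpr
        (hg t)).maxGenEigenspace_eq_eigenspace, Module.End.mem_eigenspace_iff] at this
      exact congrArg Subtype.val this
    by_cases h0 : (v : M) = 0
    · have : N.subtype v = 0 := h0
      rw [this]; exact Submodule.zero_mem _
    apply Submodule.subset_span
    refine ⟨v.2, ⟨{ toFun := χ, map_add' := ?_, map_smul' := ?_ }, hv2⟩⟩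
    · intro s t
      apply smul_left_injective k h0
      simp only [add_smul]
      rw [← hv2, ← hv2, ← hv2, map_add]; rfl
    · intro c t
      apply smul_left_injective k h0
      simp only [RingHom.id_apply, smul_eq_mul, mul_smul]
      rw [← hv2, ← hv2, map_smul]; rfl
  have h2 := (iSup_le key)
  rw [h] at h2
  intro v hv
  exact h2 (x := ⟨v, hv⟩) trivial

theorem joint_diag_top [IsAlgClosed k] [FiniteDimensional k M] (f : T →ₗ[k] Module.End k M)
    (hc : ∀ s t, Commute (f s) (f t)) (hs : ∀ t, (f t).IsSemisimple) :
    Submodule.span k {v | IsWt f v} = ⊤ := by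
  have := joint_diag f hc hs ⊤ (fun _ _ _ => trivial)
  simpa using this

/-- choose weight vectors adapted to a surjection -/
theorem exists_basis_of_span {N : Type*} [AddCommGroup N] [Module k N] [FiniteDimensional k N]
    (J : M →ₗ[k] N) (hJ : Function.Surjective J) {S : Set M} (hS : Submodule.span k S = ⊤)
    {ι : Type*} [Fintype ι] (hd : Module.finrank k N = Fintype.card ι) :
    ∃ y : ι → M, (∀ i, y i ∈ S) ∧ ∃ b : Module.Basis ι k N, ∀ i, b i = J (y i) := by
  have h1 : ⊤ ≤ Submodule.span k (J '' S) := by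
    rw [← Submodule.map_span, hS, Submodule.map_top, LinearMap.range_eq_top.2 hJ]
  set b := Module.Basis.ofSpan h1
  have : Fintype ((linearIndepOn_empty k id).extend (Set.empty_subset (J '' S))) :=
    FiniteDimensional.fintypeBasisIndex b
  have hcard : Fintype.card ((linearIndepOn_empty k id).extend (Set.empty_subset (J '' S)))
    = Fintype.card ι := by rw [← Module.finrank_eq_card_basis b, hd]
  set b' := b.reindex (Fintype.equivOfCardEq hcard)
  have hb : ∀ i, ∃ y ∈ S, J y = b' i := by
    intro i
    have : b' i ∈ J '' S := by
      apply Module.Basis.ofSpan_subset h1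
      rw [Module.Basis.reindex_apply]; exact Set.mem_range_self _
    exact this
  choose y hy hy2 using hb
  exact ⟨y, hy, b', fun i => (hy2 i).symm⟩

theorem finrank_le_of_sep {ι : Type*} [Fintype ι] (χ : ι → T →ₗ[k] k)
    (h : ∀ t, (∀ i, χ i t = 0) → t = 0) : Module.finrank k T ≤ Fintype.card ι := by
  have hinj : Function.Injective (LinearMap.pi χ) := by
    rw [injective_iff_map_eq_zero]
    intro t ht
    exact h t fun i => congrFun ht i
  have := LinearMap.finrank_le_finrank_of_injective hinj
  simpa using this

end Diag

section Torus
variable {p : ℕ} {k : Type*} [Field k] {L : Type*} [LieRing L] [LieAlgebra k L]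
  {op : L → L}

theorem pss_of_hom {M : Type*} [AddCommGroup M] [Module k M] (f : L →ₗ[k] Module.End k M)
    (hf : ∀ x, f (op x) = f x ^ p) {x : L} (hx : IsSemisimpleElt k op x) : PSS p (f x) := by
  have h := Submodule.mem_map_of_mem (f := f) hx
  rw [Submodule.map_span] at h
  unfold PSS
  convert h using 2
  have hi : ∀ m, f (op^[m] x) = f x ^ (p ^ m) := by
    intro m
    induction m with
    | zero => simp
    | succ m ih => rw [Function.iterate_succ_apply', hf, ih, ← pow_mul, pow_succ]
  ext g; constructor
  · rintro ⟨m, hm, rfl⟩; exact ⟨_, ⟨m, hm, rfl⟩, hi m⟩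
  · rintro ⟨_, ⟨m, hm, rfl⟩, rfl⟩; exact ⟨m, hm, hi m⟩

theorem pss_ad (hop : IsPMap p k op) {x : L} (hx : IsSemisimpleElt k op x) :
    PSS p (LieAlgebra.ad k L x) :=
  pss_of_hom (LieAlgebra.ad k L : L →ₗ[k] Module.End k L) (fun x => hop.ad_op x) hx

theorem torus_abelian [CharP k p] (hp : 2 ≤ p) [IsAlgClosed k] [FiniteDimensional k L] (hop : IsPMap p k op)
    {t : LieSubalgebra k L} (ht : IsTorus k op t) {x y : L} (hx : x ∈ t) (hy : y ∈ t) :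
    ⁅x, y⁆ = 0 := by
  set f : k →ₗ[k] Module.End k L := LinearMap.toSpanSingleton k _ (LieAlgebra.ad k L x)
  have hdiag := joint_diag f (fun s t => by
      simp only [f, LinearMap.toSpanSingleton_apply]
      exact ((Commute.refl _).smul_left _).smul_right _)
    (fun s => by
      simp only [f, LinearMap.toSpanSingleton_apply]
      rw [← map_smul]
      exact (pss_ad hop (ht.2 _ (t.smul_mem s hx))).isSemisimple)
    t.toSubmodule (fun s v hv => by
      simp only [f, LinearMap.toSpanSingleton_apply, LinearMap.smul_apply, LieAlgebra.ad_apply]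
      exact t.smul_mem _ (t.lie_mem hx hv))
  have : t.toSubmodule ≤ LinearMap.ker (LieAlgebra.ad k L x) := by
    rw [← hdiag, Submodule.span_le]
    rintro v ⟨hv, χ, hχ⟩
    have h1 := hχ 1
    simp only [f, LinearMap.toSpanSingleton_apply, one_smul, LieAlgebra.ad_apply] at h1
    have h2 : LieAlgebra.ad k L v (LieAlgebra.ad k L v x) = 0 := by
      simp only [LieAlgebra.ad_apply]
      rw [← lie_skew v x, h1]; simp
    have h3 := (pss_ad hop (ht.2 _ hv)).ker_sq hp h2
    rw [LieAlgebra.ad_apply, ← lie_skew, neg_eq_zero] at h3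
    exact h3
  exact this hy

/-- bounding `mu` -/
theorem mu_le {m : ℕ} (h : ∀ t : LieSubalgebra k L, IsTorus k op t → Module.finrank k t ≤ m)
    : mu k op ≤ m := by
  unfold mu
  apply csSup_le'
  rintro d ⟨t, ht, rfl⟩
  exact h t ht

end Torus

section Short
variable {p : ℕ} {k : Type*} [Field k] {n : ℕ}
noncomputable instance sc1 : CommRing (TruncPoly p k n) := Ideal.Quotient.commRing _
noncomputable instance sc2 : CommSemiring (TruncPoly p k n) := inferInstance
noncomputable instance sc3 : AddCommGroup (TruncPoly p k n) := inferInstance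
noncomputable instance sc4 : AddCommMonoid (TruncPoly p k n) := inferInstance
noncomputable instance sc5 : Mul (TruncPoly p k n) := inferInstance
noncomputable instance sc6 : Add (TruncPoly p k n) := inferInstance
noncomputable instance sc7 : Algebra k (TruncPoly p k n) := inferInstance
noncomputable instance sc8 : Module k (TruncPoly p k n) := inferInstance
noncomputable instance sc9 : Module (TruncPoly p k n) (TruncPoly p k n) := inferInstance
noncomputable instance sc10 : FunLike (WittAlg p k n) (TruncPoly p k n) (TruncPoly p k n) := inferInstance
noncomputable instance sc11 : Semiring (TruncPoly p k n) := inferInstance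
noncomputable instance sc12 : Ring (TruncPoly p k n) := inferInstance
noncomputable instance sc13 : Sub (TruncPoly p k n) := inferInstance
noncomputable instance sc14 : SMul k (TruncPoly p k n) := inferInstance
noncomputable instance sc15 : AddCommGroup (WittAlg p k n) := inferInstance
noncomputable instance sc16 : AddCommMonoid (WittAlg p k n) := inferInstance
noncomputable instance sc17 : Module k (WittAlg p k n) := inferInstance
noncomputable instance sc18 : LieRing (WittAlg p k n) := inferInstance
noncomputable instance sc19 : LieAlgebra k (WittAlg p k n) := inferInstance
end Short

section TP
variable {p : ℕ} {k : Type*} [Field k] {n : ℕ}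

theorem coeff_truncIdeal {a : Fin n →₀ ℕ} (ha : ∀ i, a i < p) {f : MvPolynomial (Fin n) k}
    (hf : f ∈ truncIdeal p k n) : f.coeff a = 0 := by
  induction hf using Submodule.span_induction generalizing a with
  | mem x hx =>
    obtain ⟨i, rfl⟩ := hx
    rw [MvPolynomial.coeff_X_pow, if_neg]
    rintro rfl
    have := ha i
    simp at this
  | zero => simp
  | add x y _ _ hx hy => rw [MvPolynomial.coeff_add, hx ha, hy ha, add_zero]
  | smul c x _ hx =>
    rw [smul_eq_mul, MvPolynomial.coeff_mul]
    apply Finset.sum_eq_zero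
    intro y hy
    rw [Finset.HasAntidiagonal.mem_antidiagonal] at hy
    rw [hx, mul_zero]
    intro i
    have := ha i
    rw [← hy, Finsupp.add_apply] at this
    omega

/-- coefficient functional -/
noncomputable def cf (a : Fin n →₀ ℕ) (ha : ∀ i, a i < p) : TruncPoly p k n →ₗ[k] k :=
  Submodule.liftQ ((truncIdeal p k n).restrictScalars k) (MvPolynomial.lcoeff k a)
    (fun _ hf => coeff_truncIdeal ha hf)

theorem cf_mk (a : Fin n →₀ ℕ) (ha : ∀ i, a i < p) (F : MvPolynomial (Fin n) k) :
    cf a ha (Ideal.Quotient.mk (truncIdeal p k n) F) = F.coeff a := rfl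

theorem mk_monomial_eq_zero {a : Fin n →₀ ℕ} (ha : ¬ ∀ i, a i < p) (c : k) :
    Ideal.Quotient.mk (truncIdeal p k n) (MvPolynomial.monomial a c) = 0 := by
  push Not at ha
  obtain ⟨i, hi⟩ := ha
  rw [Ideal.Quotient.eq_zero_iff_mem]
  have : MvPolynomial.monomial a c
      = MvPolynomial.monomial (a - Finsupp.single i p) c * (MvPolynomial.X i ^ p) := by
    rw [MvPolynomial.X_pow_eq_monomial, MvPolynomial.monomial_mul, mul_one, tsub_add_cancel_of_le]
    rw [Finsupp.single_le_iff]; exact hi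
  rw [this]
  exact Ideal.mul_mem_left _ _ (Ideal.subset_span ⟨i, rfl⟩)

theorem tp_ext {f : TruncPoly p k n} (h : ∀ a ha, cf a ha f = 0) : f = 0 := by
  obtain ⟨F, rfl⟩ := Ideal.Quotient.mk_surjective f
  rw [F.as_sum, map_sum]
  apply Finset.sum_eq_zero
  intro a _
  by_cases ha : ∀ i, a i < p
  · have := h a ha
    rw [cf_mk] at this
    rw [this, map_zero, map_zero]
  · exact mk_monomial_eq_zero ha _

/-- exponent attached to a function -/
noncomputable def expo (a : Fin n → Fin p) : Fin n →₀ ℕ :=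
  Finsupp.equivFunOnFinite.symm fun i => (a i : ℕ)

theorem expo_lt (a : Fin n → Fin p) (i : Fin n) : expo a i < p := (a i).2

/-- the coefficient isomorphism -/
noncomputable def cfEquiv : TruncPoly p k n ≃ₗ[k] ((Fin n → Fin p) → k) :=
  LinearEquiv.ofBijective (LinearMap.pi fun a => cf (expo a) (expo_lt a)) (by
    constructor
    · rw [injective_iff_map_eq_zero]
      intro f hf
      apply tp_ext
      intro a ha
      have := congrFun hf (fun i => ⟨a i, ha i⟩)
      have e : expo (fun i => (⟨a i, ha i⟩ : Fin p)) = a := by ext i; rfl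
      simp only [LinearMap.pi_apply, Pi.zero_apply] at this
      rw [← this]
      congr 2; exact e.symm
    · intro g
      refine ⟨∑ b, Ideal.Quotient.mk _ (MvPolynomial.monomial (expo b) (g b)), ?_⟩
      ext a
      rw [LinearMap.pi_apply, map_sum, Finset.sum_eq_single a]
      · rw [cf_mk]; simp
      · intro b _ hb
        rw [cf_mk, MvPolynomial.coeff_monomial, if_neg]
        intro h
        apply hb
        ext i
        exact congrArg (fun f => f i) h
      · simp)

noncomputable instance : FiniteDimensional k (TruncPoly p k n) :=
  Module.Finite.equiv (cfEquiv (p := p) (k := k) (n := n)).symm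

theorem finrank_tp : Module.finrank k (TruncPoly p k n) = p ^ n := by
  rw [(cfEquiv (p := p) (k := k) (n := n)).finrank_eq]
  simp

/-- augmentation -/
noncomputable def eps (hp : p ≠ 0) : TruncPoly p k n →ₐ[k] k :=
  Ideal.Quotient.liftₐ (truncIdeal p k n) (MvPolynomial.aeval (fun _ => (0 : k))) (by
    intro f hf
    rw [← RingHom.mem_ker]
    revert f
    change truncIdeal p k n ≤ RingHom.ker _
    rw [Ideal.span_le]
    rintro _ ⟨i, rfl⟩
    simp [RingHom.mem_ker, hp])

theorem eps_X (hp : p ≠ 0) (i : Fin n) : eps (k := k) hp (truncX p k n i) = 0 := by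
  change MvPolynomial.aeval (fun _ => (0 : k)) (MvPolynomial.X i) = 0
  simp

theorem eps_eq_cf (hp : p ≠ 0) (f : TruncPoly p k n) :
    eps hp f = cf 0 (fun _ => Nat.pos_of_ne_zero hp) f := by
  obtain ⟨F, rfl⟩ := Ideal.Quotient.mk_surjective f
  rw [cf_mk]
  change MvPolynomial.aeval (fun _ => (0 : k)) F = _
  rw [← MvPolynomial.constantCoeff_eq, MvPolynomial.aeval_zero' F]
  simp

theorem truncX_pow (i : Fin n) : truncX p k n i ^ p = 0 := by
  unfold truncX
  rw [← map_pow, Ideal.Quotient.eq_zero_iff_mem]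
  exact Ideal.subset_span ⟨i, rfl⟩

theorem tp_induction {P : TruncPoly p k n → Prop} (hC : ∀ c : k, P (algebraMap k _ c))
    (hadd : ∀ f g, P f → P g → P (f + g)) (hX : ∀ f i, P f → P (f * truncX p k n i)) (f) : P f := by
  obtain ⟨F, rfl⟩ := Ideal.Quotient.mk_surjective f
  induction F using MvPolynomial.induction_on with
  | C a => exact hC a
  | add f g hf hg => rw [map_add]; exact hadd _ _ hf hg
  | mul_X f i hf => rw [map_mul]; exact hX _ i hf

/-- algebra homomorphisms out of `A(n)` -/
noncomputable def tpLift {B : Type*} [CommRing B] [Algebra k B] (g : Fin n → B)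
    (hg : ∀ i, g i ^ p = 0) : TruncPoly p k n →ₐ[k] B :=
  Ideal.Quotient.liftₐ (truncIdeal p k n) (MvPolynomial.aeval g) (by
    intro f hf
    rw [← RingHom.mem_ker]
    revert f
    change truncIdeal p k n ≤ RingHom.ker _
    rw [Ideal.span_le]
    rintro _ ⟨i, rfl⟩
    simp [RingHom.mem_ker, hg i])

theorem tpLift_X {B : Type*} [CommRing B] [Algebra k B] (g : Fin n → B)
    (hg : ∀ i, g i ^ p = 0) (i : Fin n) : tpLift (p := p) (k := k) g hg (truncX p k n i) = g i := by
  change MvPolynomial.aeval g (MvPolynomial.X i) = g i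
  simp

variable [CharP k p]

theorem pow_p_of_eps (hp : p.Prime) (f : TruncPoly p k n) :
    f ^ p = algebraMap k _ ((eps hp.ne_zero f) ^ p) := by
  have : Fact p.Prime := ⟨hp⟩
  have : CharP (TruncPoly p k n) p := by
    have : Nontrivial (TruncPoly p k n) := (eps (k := k) (n := n) hp.ne_zero).toRingHom.domain_nontrivial
    exact charP_of_injective_algebraMap (algebraMap k _).injective p
  induction f using tp_induction with
  | hC c => simp
  | hadd f g hf hg => rw [add_pow_char, hf, hg, map_add, add_pow_char, map_add]
  | hX f i hf => rw [mul_pow, truncX_pow, mul_zero, map_mul, eps_X, mul_zero, zero_pow hp.ne_zero, map_zero]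

theorem isUnit_of_eps (hp : p.Prime) {f : TruncPoly p k n} (hf : eps hp.ne_zero f ≠ 0) :
    IsUnit f := by
  have h := pow_p_of_eps hp f
  have : IsUnit (f ^ p) := by rw [h]; exact (IsUnit.mk0 _ (pow_ne_zero _ hf)).map _
  exact (isUnit_pow_iff hp.ne_zero).1 this

theorem pd_mk (i : Fin n) (F : MvPolynomial (Fin n) k) :
    truncPD p k n i (Ideal.Quotient.mk (truncIdeal p k n) F)
      = Ideal.Quotient.mk (truncIdeal p k n) (MvPolynomial.pderiv i F) := rfl

theorem pd_X (i j : Fin n) : truncPD p k n i (truncX p k n j) = if i = j then 1 else 0 := by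
  unfold truncX
  rw [pd_mk, MvPolynomial.pderiv_X]
  split_ifs with h
  · subst h; simp
  · rw [Pi.single_eq_of_ne (Ne.symm h)]; simp

theorem der_ext {D D' : WittAlg p k n} (h : ∀ i, D (truncX p k n i) = D' (truncX p k n i)) :
    D = D' := by
  ext f
  induction f using tp_induction with
  | hC c => simp
  | hadd f g hf hg => rw [map_add, map_add, hf, hg]
  | hX f i hf => rw [Derivation.leibniz, Derivation.leibniz, hf, h]

theorem sum_der_apply {ι : Type*} (s : Finset ι) {A : Type*} [CommRing A] [Algebra k A]
    (D : ι → Derivation k A A) (f : A) :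
    (∑ i ∈ s, D i) f = ∑ i ∈ s, D i f := by
  rw [← Derivation.coeFnAddMonoidHom_apply, map_sum, Finset.sum_apply]; rfl

theorem der_eq (D : WittAlg p k n) : D = ∑ i, D (truncX p k n i) • truncPD p k n i := by
  apply der_ext
  intro j
  rw [sum_der_apply]
  simp [pd_X]

theorem der_apply (D : WittAlg p k n) (f : TruncPoly p k n) :
    D f = ∑ i, D (truncX p k n i) * truncPD p k n i f := by
  conv_lhs => rw [der_eq D]
  rw [sum_der_apply]; rfl

theorem pd_comm (i j : Fin n) (f : TruncPoly p k n) :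
    truncPD p k n i (truncPD p k n j f) = truncPD p k n j (truncPD p k n i f) := by
  have : ⁅truncPD p k n i, truncPD p k n j⁆ = 0 := by
    apply der_ext
    intro l
    rw [Derivation.commutator_apply, pd_X, pd_X]
    split_ifs <;> simp
  have := congrArg (fun D => D f) this
  simpa [Derivation.commutator_apply, sub_eq_zero] using this

theorem cf_pd (a : Fin n →₀ ℕ) (ha : ∀ i, a i < p) (i : Fin n)
    (hb : ∀ j, (a + Finsupp.single i 1 : Fin n →₀ ℕ) j < p) (f : TruncPoly p k n) :
    cf a ha (truncPD p k n i f) = cf (a + Finsupp.single i 1) hb f * ((a i : k) + 1) := by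
  obtain ⟨F, rfl⟩ := Ideal.Quotient.mk_surjective f
  rw [pd_mk, cf_mk, cf_mk, MvPolynomial.coeff_pderiv]

theorem cf_pd_top (a : Fin n →₀ ℕ) (ha : ∀ i, a i < p) (i : Fin n) (hi : a i + 1 = p)
    (f : TruncPoly p k n) : cf a ha (truncPD p k n i f) = 0 := by
  obtain ⟨F, rfl⟩ := Ideal.Quotient.mk_surjective f
  rw [pd_mk, cf_mk, MvPolynomial.coeff_pderiv]
  have : ((a i : k) + 1) = 0 := by
    have := CharP.cast_eq_zero k p
    rw [← hi] at this; exact_mod_cast this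
  rw [this, mul_zero]

/-- a nonzero coefficient in positive degree is seen by a partial derivative -/
theorem cf_of_pd (a : Fin n →₀ ℕ) (ha : ∀ i, a i < p) (i : Fin n) (hi : a i ≠ 0)
    (f : TruncPoly p k n)
    (h : cf (a - Finsupp.single i 1) (fun j => lt_of_le_of_lt (by simp) (ha j))
      (truncPD p k n i f) = 0) : cf a ha f = 0 := by
  have e : a - Finsupp.single i 1 + Finsupp.single i 1 = a := by
    apply tsub_add_cancel_of_le
    rw [Finsupp.single_le_iff]; omega
  rw [cf_pd _ _ i (by rw [e]; exact ha)] at h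
  have e2 : (((a - Finsupp.single i 1 : Fin n →₀ ℕ) i : ℕ) : k) + 1 = (a i : k) := by
    have : (a - Finsupp.single i 1 : Fin n →₀ ℕ) i + 1 = a i := by simp; omega
    exact_mod_cast congrArg (Nat.cast (R := k)) this
  rw [e2] at h
  have h0 : (a i : k) ≠ 0 := by
    rw [Ne, CharP.cast_eq_zero_iff k p]
    exact Nat.not_dvd_of_pos_of_lt (by omega) (ha i)
  have := (mul_eq_zero.1 h).resolve_right h0
  convert this using 2
  congr 1; exact e.symm

theorem const_of_pd (hp : p.Prime) {f : TruncPoly p k n} (h : ∀ i, truncPD p k n i f = 0) :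
    f = algebraMap k _ (eps hp.ne_zero f) := by
  rw [← sub_eq_zero]
  apply tp_ext
  intro a ha
  by_cases h0 : a = 0
  · subst h0
    rw [← eps_eq_cf hp.ne_zero, map_sub, AlgHom.commutes]; simp
  · obtain ⟨i, hi⟩ : ∃ i, a i ≠ 0 := by
      by_contra hcon; push Not at hcon; exact h0 (Finsupp.ext hcon)
    apply cf_of_pd a ha i hi
    rw [map_sub, h, Derivation.map_algebraMap, sub_zero, map_zero]

theorem eps_pd_X (hp : p.Prime) (i j : Fin n) :
    eps hp.ne_zero (truncPD p k n i (truncX p k n j)) = if i = j then 1 else 0 := by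
  rw [pd_X]; split_ifs <;> simp

end TP

section DerPow
variable {p : ℕ} {k : Type*} [Field k] [CharP k p]

theorem comm_pow (hp : p.Prime) {R : Type*} [Ring R] [Algebra k R] (x y : R) :
    (fun z => x * z - z * x)^[p] y = x ^ p * y - y * x ^ p := by
  have : Fact p.Prime := ⟨hp⟩
  rcases subsingleton_or_nontrivial R with h | h
  · exact Subsingleton.elim _ _
  have : CharP (Module.End k R) p := charP_of_injective_algebraMap (algebraMap k _).injective p
  have h1 := sub_pow_char_of_commute (R := Module.End k R) p (x := LinearMap.mulLeft k x)
    (y := LinearMap.mulRight k x) (LinearMap.commute_mulLeft_right x x)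
  have h2 := congrArg (fun F => F y) h1
  simp only [Module.End.pow_apply, LinearMap.pow_mulLeft, LinearMap.pow_mulRight,
    LinearMap.sub_apply, LinearMap.mulLeft_apply, LinearMap.mulRight_apply] at h2
  exact h2

variable {A : Type*} [CommRing A] [Algebra k A]

/-- the `p`-th power of a derivation -/
noncomputable def derPow (hp : p.Prime) (D : Derivation k A A) : Derivation k A A :=
  Derivation.mk' (D.toLinearMap ^ p) (by
    have h : ∀ j f, (fun z => (D.toLinearMap : Module.End k A) * z - z * D.toLinearMap)^[j]
        (LinearMap.mulLeft k f) = LinearMap.mulLeft k ((D.toLinearMap ^ j) f) := by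
      intro j f
      induction j with
      | zero => simp
      | succ j ih =>
        rw [Function.iterate_succ_apply', ih, pow_succ']
        ext g
        simp [mul_comm]
    intro f g
    have h1 := h p f
    rw [comm_pow (k := k) hp] at h1
    have := congrArg (fun F => F g) h1
    simp only [LinearMap.sub_apply, Module.End.mul_apply, LinearMap.mulLeft_apply] at this
    rw [sub_eq_iff_eq_add] at this
    rw [this, smul_eq_mul, smul_eq_mul]; ring)

theorem derPow_coe (hp : p.Prime) (D : Derivation k A A) :
    (derPow hp D).toLinearMap = D.toLinearMap ^ p := rfl

theorem derPow_iter (hp : p.Prime) (D : Derivation k A A) (j : ℕ) :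
    ((derPow hp)^[j] D).toLinearMap = D.toLinearMap ^ (p ^ j) := by
  induction j with
  | zero => simp
  | succ j ih => rw [Function.iterate_succ_apply', derPow_coe, ih, ← pow_mul, pow_succ]

theorem lie_derPow (hp : p.Prime) (D E : Derivation k A A) :
    ⁅derPow hp D, E⁆ = (fun z => ⁅D, z⁆)^[p] E := by
  have h : ∀ j, ((fun z => ⁅D, z⁆)^[j] E).toLinearMap =
      (fun z => (D.toLinearMap : Module.End k A) * z - z * D.toLinearMap)^[j] E.toLinearMap := by
    intro j
    induction j with
    | zero => simp
    | succ j ih =>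
      rw [Function.iterate_succ_apply', Function.iterate_succ_apply', ← ih]
      ext f
      change (⁅D, ((fun z => ⁅D, z⁆)^[j] E)⁆ : Derivation k A A) f = _
      rw [Derivation.commutator_apply]; rfl
  have h1 := h p
  rw [comm_pow (k := k) hp] at h1
  ext f
  have := congrArg (fun F => F f) h1
  simp only [LinearMap.sub_apply, Module.End.mul_apply] at this
  rw [Derivation.commutator_apply]
  exact this.symm

end DerPow

section Odo
variable {p : ℕ} {k : Type*} [Field k] [CharP k p] {A : Type*} [CommRing A] [Algebra k A]

/-- the odometer monomials -/
def odoU (p : ℕ) (X : ℕ → A) : ℕ → ℕ → ℕ → A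
  | 0, _, _ => 1
  | l + 1, i, N => X i ^ (N % p) * odoU p X l (i + 1) (N / p)

/-- the products `∏_{j<i} x_j^{p-1}` -/
def odoT (p : ℕ) (X : ℕ → A) (i : ℕ) : A := ∏ j ∈ Finset.range i, X j ^ (p - 1)

theorem odoT_succ (X : ℕ → A) (i : ℕ) : odoT p X (i + 1) = odoT p X i * X i ^ (p - 1) :=
  Finset.prod_range_succ _ _

theorem odoU_zero (hp : p.Prime) (X : ℕ → A) (l i : ℕ) : odoU p X l i 0 = 1 := by
  induction l generalizing i with
  | zero => rfl
  | succ l ih => simp [odoU, ih]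

theorem odoU_pow (hp : p.Prime) (X : ℕ → A) (l i j : ℕ) (hj : j < l) :
    odoU p X l i (p ^ j) = X (i + j) := by
  have hp2 := hp.two_le
  induction l generalizing i j with
  | zero => omega
  | succ l ih =>
    rcases j with _ | j
    · simp [odoU, Nat.mod_eq_of_lt hp.one_lt, Nat.div_eq_of_lt hp.one_lt, odoU_zero hp]
    · rw [odoU, pow_succ, Nat.mul_mod_left, Nat.mul_div_cancel _ hp.pos, ih _ _ (by omega), pow_zero,
        one_mul]
      congr 1; omega

theorem odoU_top (hp : p.Prime) (X : ℕ → A) (l i : ℕ) :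
    odoT p X i * odoU p X l i (p ^ l - 1) = odoT p X (i + l) := by
  have hp2 := hp.two_le
  induction l generalizing i with
  | zero => simp [odoU]
  | succ l ih =>
    have h1 : 1 ≤ p ^ l := Nat.one_le_pow _ _ hp.pos
    have e : p ^ (l + 1) - 1 = (p - 1) + p * (p ^ l - 1) := by
      rw [pow_succ', Nat.mul_sub, mul_one]
      have : p ≤ p * p ^ l := Nat.le_mul_of_pos_right _ h1
      omega
    rw [odoU, e, Nat.add_mul_mod_self_left, Nat.mod_eq_of_lt (by omega), Nat.add_mul_div_left _ _ hp.pos,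
      Nat.div_eq_of_lt (by omega : p - 1 < p), zero_add, ← mul_assoc, ← odoT_succ, ih]
    congr 1; omega

theorem pred_div_mod {N p : ℕ} (hp : 0 < p) (hs : ¬ N % p = 0) :
    (N - 1) / p = N / p ∧ (N - 1) % p = N % p - 1 := by
  have h := Nat.div_add_mod N p
  have hlt := Nat.mod_lt N hp
  generalize N / p = Q at *
  generalize N % p = s at *
  obtain rfl := h
  have e : p * Q + s - 1 = (s - 1) + p * Q := by omega
  rw [e, Nat.add_mul_div_left _ _ hp, Nat.add_mul_mod_self_left,
    Nat.mod_eq_of_lt (by omega), Nat.div_eq_of_lt (by omega)]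
  simp

theorem odo_step (hp : p.Prime) (X : ℕ → A) (m : ℕ) (hX : ∀ i < m, X i ^ p = 0)
    (e : Derivation k A A) (he : ∀ i < m, e (X i) = odoT p X i) (l i N : ℕ) (hl : i + l ≤ m)
    (hN : 1 ≤ N) (hN2 : N < p ^ l) :
    ∃ a : k, a ≠ 0 ∧ e (odoU p X l i N) = a • (odoT p X i * odoU p X l i (N - 1)) := by
  induction l generalizing i N with
  | zero => simp at hN2; omega
  | succ l ih =>
    have hdiv : N / p < p ^ l := Nat.div_lt_of_lt_mul (by rwa [pow_succ'] at hN2)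
    by_cases hs : N % p = 0
    · obtain ⟨M, rfl⟩ := Nat.dvd_of_mod_eq_zero hs
      have hM : 1 ≤ M := Nat.pos_of_ne_zero (by rintro rfl; simp at hN)
      rw [Nat.mul_div_cancel_left _ hp.pos] at hdiv
      obtain ⟨a, ha, h⟩ := ih (i + 1) M (by omega) hM hdiv
      refine ⟨a, ha, ?_⟩
      have e1 : p * M - 1 = (p - 1) + p * (M - 1) := by
        rw [Nat.mul_sub, mul_one]
        have : p ≤ p * M := Nat.le_mul_of_pos_right _ hM
        have := hp.pos
        omega
      have hp1 : p - 1 < p := Nat.sub_lt hp.pos one_pos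
      rw [odoU, odoU, hs, pow_zero, one_mul, Nat.mul_div_cancel_left _ hp.pos, h, e1,
        Nat.add_mul_mod_self_left, Nat.mod_eq_of_lt hp1, Nat.add_mul_div_left _ _ hp.pos,
        Nat.div_eq_of_lt hp1, zero_add, odoT_succ, mul_assoc]
    · have hlt := Nat.mod_lt N hp.pos
      refine ⟨(N % p : ℕ), ?_, ?_⟩
      · rw [Ne, CharP.cast_eq_zero_iff k p]
        exact Nat.not_dvd_of_pos_of_lt (by omega) hlt
      · have e1 := pred_div_mod hp.pos hs
        have h2 : X i ^ (N % p) * e (odoU p X l (i + 1) (N / p)) = 0 := by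
          by_cases h0 : N / p = 0
          · rw [h0, odoU_zero hp, Derivation.map_one_eq_zero, mul_zero]
          · obtain ⟨a, -, h⟩ := ih (i + 1) (N / p) (by omega) (Nat.pos_of_ne_zero h0) hdiv
            have h3 : X i ^ (N % p) * X i ^ (p - 1) = 0 := by
              rw [← pow_add, show N % p + (p - 1) = p + (N % p - 1) by omega, pow_add,
                hX i (by omega), zero_mul]
            rw [h, odoT_succ, mul_smul_comm,
              show X i ^ (N % p) * (odoT p X i * X i ^ (p - 1) * odoU p X l (i + 1) (N / p - 1))
                = (X i ^ (N % p) * X i ^ (p - 1)) * (odoT p X i * odoU p X l (i + 1) (N / p - 1)) by ring,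
              h3, zero_mul, smul_zero]
        rw [odoU, odoU, e1.1, e1.2, Derivation.leibniz, smul_eq_mul, h2, zero_add,
          Derivation.leibniz_pow, he i (by omega), smul_eq_mul, smul_eq_mul, nsmul_eq_mul,
          Algebra.smul_def]
        simp only [map_natCast]
        ring

theorem odo_kill (hp : p.Prime) (X : ℕ → A) (m : ℕ) (z : A) (hz : ∀ j < m, z * X j = 0)
    (l i N : ℕ) (hl : i + l ≤ m) (hN : 1 ≤ N) (hN2 : N < p ^ l) : z * odoU p X l i N = 0 := by
  induction l generalizing i N with
  | zero => simp at hN2; omega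
  | succ l ih =>
    have hdiv : N / p < p ^ l := Nat.div_lt_of_lt_mul (by rwa [pow_succ'] at hN2)
    rw [odoU]
    by_cases hs : N % p = 0
    · obtain ⟨M, rfl⟩ := Nat.dvd_of_mod_eq_zero hs
      have hM : 1 ≤ M := Nat.pos_of_ne_zero (by rintro rfl; simp at hN)
      rw [Nat.mul_div_cancel_left _ hp.pos] at hdiv
      rw [hs, pow_zero, one_mul, Nat.mul_div_cancel_left _ hp.pos, ih _ _ (by omega) hM hdiv]
    · obtain ⟨s, hs2⟩ := Nat.exists_eq_succ_of_ne_zero hs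
      rw [hs2, pow_succ', ← mul_assoc, ← mul_assoc, hz i (by omega)]; simp

theorem odo_der_zero (X : ℕ → A) (f : Derivation k A A) (l i N : ℕ)
    (hf : ∀ j, i ≤ j → f (X j) = 0) : f (odoU p X l i N) = 0 := by
  induction l generalizing i N with
  | zero => simp [odoU]
  | succ l ih =>
    rw [odoU, Derivation.leibniz, Derivation.leibniz_pow, ih _ _ (fun j hj => hf j (by omega)),
      hf i le_rfl]
    simp

theorem odoT_mul_X (hp : p.Prime) (X : ℕ → A) (m : ℕ) (hX : ∀ i < m, X i ^ p = 0) (j : ℕ)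
    (hj : j < m) : odoT p X m * X j = 0 := by
  rw [odoT, ← Finset.mul_prod_erase _ _ (Finset.mem_range.2 hj)]
  have : X j ^ (p - 1) * X j = 0 := by
    rw [← pow_succ, Nat.sub_add_cancel hp.one_le, hX j hj]
  rw [mul_right_comm, this, zero_mul]

/-- the odometer identity -/
theorem odometer (hp : p.Prime) (X : ℕ → A) (m : ℕ) (hm : 1 ≤ m) (hX : ∀ i < m, X i ^ p = 0)
    (e f : Derivation k A A) (he : ∀ i < m, e (X i) = odoT p X i)
    (hf0 : f (X 0) = odoT p X m) (hf : ∀ j, 1 ≤ j → f (X j) = 0) :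
    ∃ c : k, c ≠ 0 ∧ ∀ l : k, ∀ i < m,
      ((derPow hp)^[m] (e + l • f) - (c * l) • (e + l • f)) (X i) = 0 := by
  obtain ⟨m, rfl⟩ : ∃ m', m = m' + 1 := ⟨m - 1, by omega⟩
  set q := p ^ (m + 1) with hq
  have hq2 : 2 ≤ q := hp.two_le.trans (Nat.le_self_pow (by omega) p)
  set u := odoU p X (m + 1) 0 with hu
  have hstep : ∀ N, ∃ a : k, 1 ≤ N → N < q → a ≠ 0 ∧ e (u N) = a • u (N - 1) := by
    intro N
    by_cases h : 1 ≤ N ∧ N < q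
    · obtain ⟨a, ha, h2⟩ := odo_step hp X (m + 1) hX e he (m + 1) 0 N (by omega) h.1 h.2
      exact ⟨a, fun _ _ => ⟨ha, by rw [h2]; simp [odoT, hu]⟩⟩
    · exact ⟨0, fun h1 h2 => absurd ⟨h1, h2⟩ h⟩
  choose a ha using hstep
  have hfu : ∀ N, 2 ≤ N → N < q → f (u N) = 0 := by
    intro N h2 hN
    rw [hu, odoU, Derivation.leibniz, odo_der_zero X f _ _ _ (fun j hj => hf j (by omega)),
      smul_zero, zero_add, Derivation.leibniz_pow, hf0, smul_eq_mul, smul_eq_mul]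
    have hk := odoT_mul_X hp X (m + 1) hX
    rw [nsmul_eq_mul]
    by_cases h0 : N / p = 0
    · have hlt : N < p := by
        rcases Nat.div_eq_zero_iff.1 h0 with h | h
        · exact absurd h hp.ne_zero
        · exact h
      rw [Nat.mod_eq_of_lt hlt]
      obtain ⟨s, rfl⟩ : ∃ s, N = s + 2 := ⟨N - 2, by omega⟩
      have : X 0 ^ (s + 2 - 1) * odoT p X (m + 1) = 0 := by
        rw [show s + 2 - 1 = s + 1 by omega, pow_succ, mul_assoc, mul_comm (X 0), hk 0 (by omega), mul_zero]
      rw [this]; simp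
    · have hdiv : N / p < p ^ m := Nat.div_lt_of_lt_mul (by rwa [hq, pow_succ'] at hN)
      have := odo_kill hp X (m + 1) _ hk m (0 + 1) (N / p) (by omega) (Nat.pos_of_ne_zero h0) hdiv
      rw [show ∀ a b c d : A, a * (b * (c * d)) = (d * a) * (b * c) by intros; ring]
      rw [this, zero_mul]
  have hu1 : u 1 = X 0 := by
    have := odoU_pow hp X (m + 1) 0 0 (by omega)
    simpa using this
  have hutop : u (q - 1) = odoT p X (m + 1) := by
    have := odoU_top hp X (m + 1) 0
    simpa [odoT] using this
  have hchain : ∀ j, ∃ c : k, j ≤ q - 2 → c ≠ 0 ∧ ∀ l : k,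
      ((e + l • f).toLinearMap ^ j) (u (q - 1)) = c • u (q - 1 - j) := by
    intro j
    induction j with
    | zero => exact ⟨1, fun _ => ⟨one_ne_zero, by simp⟩⟩
    | succ j ih =>
      obtain ⟨c, hc⟩ := ih
      refine ⟨c * a (q - 1 - j), fun hj => ?_⟩
      obtain ⟨hc0, hc⟩ := hc (by omega)
      obtain ⟨ha0, ha1⟩ := ha (q - 1 - j) (by omega) (by omega)
      refine ⟨mul_ne_zero hc0 ha0, fun l => ?_⟩
      rw [pow_succ', Module.End.mul_apply, hc, map_smul]
      change c • (e (u (q - 1 - j)) + l • f (u (q - 1 - j))) = _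
      rw [ha1, hfu _ (by omega) (by omega), smul_zero, add_zero, smul_smul]
      rfl
  choose c hc using hchain
  refine ⟨c (q - 2), (hc _ le_rfl).1, fun l => ?_⟩
  set D := e + l • f with hD
  have hq1 : ((D.toLinearMap) ^ (q - 1)) (u (q - 1)) = c (q - 2) • (1 + l • u (q - 1)) := by
    rw [show q - 1 = (q - 2) + 1 by omega, pow_succ', Module.End.mul_apply,
      show q - 2 + 1 = q - 1 by omega, (hc _ le_rfl).2 l, map_smul,
      show q - 1 - (q - 2) = 1 by omega, hu1]
    change c (q - 2) • (e (X 0) + l • f (X 0)) = _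
    rw [he 0 (by omega), hf0, hutop]; simp [odoT]
  set Z := (derPow hp)^[m + 1] D - (c (q - 2) * l) • D with hZ
  have hZ1 : Z.toLinearMap = D.toLinearMap ^ q - (c (q - 2) * l) • D.toLinearMap := by
    rw [← derPow_iter hp]; rfl
  have hZu : Z.toLinearMap (u (q - 1)) = 0 := by
    rw [hZ1, LinearMap.sub_apply, LinearMap.smul_apply]
    conv_lhs => rw [show q = (q - 1) + 1 by omega]
    rw [pow_succ', Module.End.mul_apply, show q - 1 + 1 - 1 = q - 1 by omega,
      show q - 1 + 1 - 2 = q - 2 by omega, hq1, map_smul, map_add, map_smul]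
    change c (q - 2) • (D 1 + l • D (u (q - 1))) - _ • D (u (q - 1)) = 0
    rw [Derivation.map_one_eq_zero, zero_add, smul_smul, sub_self]
  have hcomm : Commute Z.toLinearMap (D.toLinearMap : Module.End k A) := by
    rw [hZ1]
    exact ((Commute.refl _).pow_left _).sub_left ((Commute.refl _).smul_left _)
  intro i hi
  have hi2 : p ^ i < q := Nat.pow_lt_pow_right hp.one_lt hi
  have hi1 : 1 ≤ p ^ i := Nat.one_le_pow _ _ hp.pos
  obtain ⟨h0, h1⟩ := hc (q - 1 - p ^ i) (by omega)
  have h2 := h1 l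
  rw [show q - 1 - (q - 1 - p ^ i) = p ^ i by omega, hu, odoU_pow hp X _ _ _ hi, zero_add] at h2
  have h3 : Z.toLinearMap (c (q - 1 - p ^ i) • X i) = 0 := by
    rw [← h2, ← Module.End.mul_apply, (hcomm.pow_right _).eq, Module.End.mul_apply, hZu, map_zero]
  rw [map_smul] at h3
  exact (smul_eq_zero.1 h3).resolve_left h0

end Odo

section LowerCartan
variable {p : ℕ} {k : Type*} [Field k] [CharP k p] {L : Type*} [LieRing L] [LieAlgebra k L]
  {op : L → L} {n : ℕ}

theorem iota_op (hp : p.Prime) (hop : IsPMap p k op) (ι : L →ₗ⁅k⁆ WittAlg p k n)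
    (hcent : ∀ E : WittAlg p k n, (∀ x, ⁅E, ι x⁆ = 0) → E = 0) (x : L) :
    ι (op x) = derPow hp (ι x) := by
  rw [← sub_eq_zero]
  apply hcent
  intro y
  refine (sub_lie (ι (op x)) (derPow hp (ι x)) (ι y)).trans ?_
  rw [lie_derPow, ← LieHom.map_lie, ← LieAlgebra.ad_apply k L (op x) y, hop.ad_op,
    Module.End.pow_apply, sub_eq_zero]
  have key : ∀ j : ℕ, ι ((⇑((LieAlgebra.ad k L) x))^[j] y) = (fun z => ⁅ι x, z⁆)^[j] (ι y) := ?_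
  · exact key p
  intro j
  induction j with
  | zero => rfl
  | succ j ih => rw [Function.iterate_succ_apply', Function.iterate_succ_apply', LieAlgebra.ad_apply,
      LieHom.map_lie, ih]

theorem odo_nonnil (hp : p.Prime) (m : ℕ) (hm : 1 ≤ m) (Y : ℕ → TruncPoly p k n) (hY : ∀ i < m, Y i ^ p = 0)
    (a b : WittAlg p k n) (ha : ∀ i < m, a (Y i) = odoT p Y i) (hb0 : b (Y 0) = odoT p Y m)
    {c : k} (hc : c ≠ 0) (h : ∀ l : k, ∀ i < m,
      ((derPow hp)^[m] (a + l • b) - (c * l) • (a + l • b)) (Y i) = 0)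
    (N : ℕ) (h0 : (derPow hp)^[N] (a + b) = 0) : False := by
  set D := a + b with hD
  have h1 : D.toLinearMap ^ (p ^ N) = 0 := by
    rw [← derPow_iter hp, hD, h0]; rfl
  have hm1 := h 1 0 (by omega)
  rw [one_smul, mul_one, ← hD] at hm1
  have hm2 : ∀ r, (D.toLinearMap ^ (r + p ^ m)) (Y 0) = c • (D.toLinearMap ^ (r + 1)) (Y 0) := by
    intro r
    rw [pow_add, Module.End.mul_apply, ← derPow_iter hp]
    change (D.toLinearMap ^ r) (((derPow hp)^[m] D) (Y 0)) = _
    rw [Derivation.sub_apply, Derivation.smul_apply, sub_eq_zero] at hm1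
    rw [hm1, map_smul, pow_succ]; rfl
  have hpm : 2 ≤ p ^ m := hp.two_le.trans (Nat.le_self_pow (by omega) p)
  have hdesc : ∀ s t, p ^ N ≤ t + s → (D.toLinearMap ^ (t + 1)) (Y 0) = 0 := by
    intro s
    induction s with
    | zero => intro t ht; rw [pow_eq_zero_of_le (by omega) h1]; rfl
    | succ s ih =>
      intro t ht
      have h2 := hm2 t
      rw [show t + p ^ m = (t + p ^ m - 1) + 1 by omega, ih _ (by omega)] at h2
      exact (smul_eq_zero.1 h2.symm).resolve_left hc
  have h3 := hdesc (p ^ N) 0 (by omega)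
  rw [zero_add, pow_one] at h3
  change a (Y 0) + b (Y 0) = 0 at h3
  rw [ha 0 (by omega), hb0] at h3
  have h4 := congrArg (eps hp.ne_zero) h3
  have h5 : eps hp.ne_zero (Y 0) = 0 := by
    have := congrArg (eps hp.ne_zero) (hY 0 (by omega))
    rw [map_pow, map_zero] at this
    exact eq_zero_of_pow_eq_zero this
  have h6 : eps hp.ne_zero (odoT p Y m) = 0 := by
    rw [odoT, map_prod]
    apply Finset.prod_eq_zero (Finset.mem_range.2 (by omega : 0 < m))
    rw [map_pow, h5, zero_pow]
    have := hp.two_le; omega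
  rw [map_add, h6, map_zero, odoT, Finset.range_zero, Finset.prod_empty, map_one, add_zero] at h4
  exact one_ne_zero h4

theorem lower_cartan (hp : p.Prime) [IsAlgClosed k] (hs : LieAlgebra.IsSimple k L)
    (hop : IsPMap p k op)
    {V : Type*} [AddCommGroup V] [Module k V] [LieRingModule L V] [LieModule k L V]
    [FiniteDimensional k V] (hV : IsRestrictedModule p k op V)
    (hnt : ¬ LieModule.IsTrivial L V)
    (ι : L →ₗ⁅k⁆ WittAlg p k n) (hinj : Function.Injective ι)
    (hcent : ∀ E : WittAlg p k n, (∀ x, ⁅E, ι x⁆ = 0) → E = 0)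
    (m : ℕ) (hm : 1 ≤ m) (Y : ℕ → TruncPoly p k n) (hY : ∀ i < m, Y i ^ p = 0) (a b : L)
    (ha : ∀ i < m, ι a (Y i) = odoT p Y i) (hb0 : ι b (Y 0) = odoT p Y m)
    (hb : ∀ i, 1 ≤ i → ι b (Y i) = 0)
    (hstar : ∀ E : L, (∀ i < m, ι E (Y i) = 0) → derPow hp (ι E) = 0) :
    p ^ m - 1 ≤ Module.finrank k V := by
  have hio := iota_op hp hop ι hcent
  have hit : ∀ j x, ι (op^[j] x) = (derPow hp)^[j] (ι x) := by
    intro j x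
    induction j with
    | zero => rfl
    | succ j ih => rw [Function.iterate_succ_apply', Function.iterate_succ_apply', hio, ih]
  obtain ⟨c, hc, h⟩ := odometer hp Y m hm hY (ι a) (ι b) ha hb0 hb
  refine pencil_bound hp hs hop hV hnt m 1 a b c hc ?_ ?_
  · intro l
    rw [pow_one, ← ad_iter hop, ← map_smul, ← map_sub, ← hop.ad_op]
    have : op (op^[m] (a + l • b) - (c * l) • (a + l • b)) = 0 := by
      apply hinj
      rw [hio, map_zero]
      apply hstar
      intro i hi
      rw [map_sub, map_smul, hit, map_add, map_smul]
      exact h l i hi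
    rw [this, map_zero]
  · rintro ⟨N, hN⟩
    have h0 : op^[N] (a + b) = 0 := by
      apply ad_inj_of_simple' (k := k) hs
      rw [ad_iter hop]
      exact pow_eq_zero_of_le (Nat.lt_pow_self hp.one_lt).le hN
    refine odo_nonnil hp m hm Y hY (ι a) (ι b) ha hb0 hc h N ?_
    rw [← map_add, ← hit, h0, map_zero]

/-- combine the two bounds -/
theorem finish {m : ℕ} (hp : p.Prime) {V : Type*} [AddCommGroup V] [Module k V]
    [LieRingModule L V] [LieModule k L V]
    (hdim : Module.finrank k V < p ^ (mu k op) - 1)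
    (hu : ∀ t : LieSubalgebra k L, IsTorus k op t → Module.finrank k t ≤ m)
    (hl : ¬ LieModule.IsTrivial L V → p ^ m - 1 ≤ Module.finrank k V) : LieModule.IsTrivial L V := by
  by_contra hnt
  have h1 := hl hnt
  have h2 := Nat.pow_le_pow_right hp.pos (mu_le (k := k) hu)
  omega

/-- centralizer of the partial derivatives -/
theorem const_of_comm_pd (hp : p.Prime) {E : WittAlg p k n}
    (h : ∀ i, ⁅E, truncPD p k n i⁆ = 0) (j : Fin n) :
    ∃ c : k, E (truncX p k n j) = algebraMap k _ c := by
  refine ⟨_, const_of_pd hp fun i => ?_⟩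
  have := congrArg (fun D => D (truncX p k n j)) (h i)
  simp only [Derivation.commutator_apply, pd_X] at this
  rw [Derivation.zero_apply] at this
  split_ifs at this with hij
  · simpa using this
  · simpa using this

/-- the variables indexed by natural numbers -/
noncomputable def nX (p : ℕ) (k : Type*) [Field k] (n : ℕ) (i : ℕ) : TruncPoly p k n :=
  if h : i < n then truncX p k n ⟨i, h⟩ else 0

theorem nX_of_lt {i : ℕ} (h : i < n) : nX p k n i = truncX p k n ⟨i, h⟩ := dif_pos h

theorem nX_pow (i : ℕ) (hi : i < n) : nX p k n i ^ p = 0 := by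
  rw [nX_of_lt hi]; exact truncX_pow _

theorem der_sum_X (g : Fin n → TruncPoly p k n) (i : Fin n) :
    (∑ i, g i • truncPD p k n i) (truncX p k n i) = g i := by
  rw [sum_der_apply]
  simp [pd_X]

end LowerCartan

section WType
variable {p : ℕ} {k : Type*} [Field k] [CharP k p] {L : Type*} [LieRing L] [LieAlgebra k L]
  {op : L → L} {n : ℕ}

theorem cent_W (hp : p.Prime) (e : L ≃ₗ⁅k⁆ WittAlg p k n) (E : WittAlg p k n)
    (h : ∀ x, ⁅E, e.toLieHom x⁆ = 0) : E = 0 := by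
  have h' : ∀ D : WittAlg p k n, ⁅E, D⁆ = 0 := fun D => by
    have := h (e.symm D)
    simpa using this
  apply der_ext
  intro j
  obtain ⟨c, hc⟩ := const_of_comm_pd hp (fun i => h' _) j
  have := congrArg (fun D => D (truncX p k n j)) (h' (truncX p k n j • truncPD p k n j))
  simp only [Derivation.commutator_apply, Derivation.smul_apply, pd_X, if_true] at this
  rw [hc] at this ⊢
  simpa [hc] using this

theorem lower_W (hp : p.Prime) [IsAlgClosed k] (hs : LieAlgebra.IsSimple k L)
    (hop : IsPMap p k op)
    {V : Type*} [AddCommGroup V] [Module k V] [LieRingModule L V] [LieModule k L V]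
    [FiniteDimensional k V] (hV : IsRestrictedModule p k op V)
    (hnt : ¬ LieModule.IsTrivial L V) (hn : 1 ≤ n) (e : L ≃ₗ⁅k⁆ WittAlg p k n) :
    p ^ n - 1 ≤ Module.finrank k V := by
  refine lower_cartan hp hs hop hV hnt e.toLieHom e.injective (cent_W hp e) n hn (nX p k n)
    nX_pow (e.symm (∑ i : Fin n, odoT p (nX p k n) i • truncPD p k n i))
    (e.symm (odoT p (nX p k n) n • truncPD p k n ⟨0, by omega⟩)) ?_ ?_ ?_ ?_
  · intro i hi
    simp only [LieEquiv.coe_toLieHom, LieEquiv.apply_symm_apply]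
    rw [nX_of_lt hi, der_sum_X]
  · simp only [LieEquiv.coe_toLieHom, LieEquiv.apply_symm_apply]
    rw [nX_of_lt (by omega : 0 < n), Derivation.smul_apply, pd_X]; simp
  · intro i hi
    simp only [LieEquiv.coe_toLieHom, LieEquiv.apply_symm_apply]
    by_cases h : i < n
    · rw [nX_of_lt h, Derivation.smul_apply, pd_X, if_neg]
      · simp
      · intro h; have := congrArg Fin.val h; simp at this; omega
    · rw [nX, dif_neg h, map_zero]
  · intro E hE
    have : e.toLieHom E = 0 := by
      apply der_ext
      intro i
      have := hE i i.2
      rw [nX_of_lt i.2] at this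
      exact this
    rw [this]
    ext f
    change ((0 : Derivation k _ _).toLinearMap ^ p) f = 0
    rw [show ((0 : WittAlg p k n).toLinearMap : Module.End k _) = 0 from rfl, zero_pow hp.ne_zero]; rfl

end WType

section Upper
variable {p : ℕ} {k : Type*} [Field k] [CharP k p] {n : ℕ}

theorem matrix_kill (hp : p.Prime) {κ : Type*} [Fintype κ] [DecidableEq κ]
    (u : κ → κ → TruncPoly p k n) (b : Module.Basis κ k (κ → k))
    (hb : ∀ j, b j = fun l => eps hp.ne_zero (u j l)) (c : κ → TruncPoly p k n)
    (h : ∀ j, ∑ l, c l * u j l = 0) (l : κ) : c l = 0 := by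
  set M : Matrix κ κ (TruncPoly p k n) := Matrix.of u
  have h1 : eps hp.ne_zero M.det ≠ 0 := by
    have := RingHom.map_det (eps (k := k) (n := n) hp.ne_zero).toRingHom M
    change eps hp.ne_zero M.det = _ at this
    rw [this]
    have h2 : LinearIndependent k (fun j => ((eps (k := k) (n := n) hp.ne_zero).toRingHom.mapMatrix M).row j) := by
      have := b.linearIndependent
      convert this using 1
      funext j
      rw [hb]; rfl
    have h3 := Matrix.linearIndependent_rows_iff_isUnit.1 h2
    rw [Matrix.isUnit_iff_isUnit_det] at h3
    exact h3.ne_zero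
  have h2 : M.mulVec c = 0 := by
    funext j
    rw [Matrix.mulVec, dotProduct, Pi.zero_apply, ← h j]
    exact Finset.sum_congr rfl fun _ _ => mul_comm _ _
  have h3 := congrArg (fun v => M.adjugate.mulVec v) h2
  simp only [Matrix.mulVec_mulVec, Matrix.adjugate_mul, Matrix.mulVec_zero, Matrix.smul_mulVec,
    Matrix.one_mulVec] at h3
  have h4 := congrFun h3 l
  simp only [Pi.smul_apply, smul_eq_mul, Pi.zero_apply] at h4
  exact ((isUnit_of_eps hp h1).mul_right_eq_zero).1 h4

/-- the linear part -/
noncomputable def linJ (hp : p.Prime) : TruncPoly p k n →ₗ[k] (Fin n → k) :=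
  LinearMap.pi fun i => (eps hp.ne_zero).toLinearMap ∘ₗ (truncPD p k n i).toLinearMap

theorem linJ_apply (hp : p.Prime) (f : TruncPoly p k n) (i : Fin n) :
    linJ hp f i = eps hp.ne_zero (truncPD p k n i f) := rfl

theorem linJ_surj (hp : p.Prime) : Function.Surjective (linJ (k := k) (n := n) hp) := by
  intro c
  refine ⟨∑ i, c i • truncX p k n i, ?_⟩
  funext j
  rw [linJ_apply, map_sum, map_sum]
  rw [Finset.sum_eq_single j]
  · rw [Derivation.map_smul, map_smul, eps_pd_X hp, if_pos rfl, smul_eq_mul, mul_one]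
  · intro i _ hij
    rw [Derivation.map_smul, map_smul, eps_pd_X hp, if_neg (Ne.symm hij), smul_zero]
  · simp

theorem der_kill (hp : p.Prime) (y : Fin n → TruncPoly p k n) (b : Module.Basis (Fin n) k (Fin n → k))
    (hb : ∀ j, b j = linJ hp (y j)) (D : WittAlg p k n) (h : ∀ j, D (y j) = 0) : D = 0 := by
  apply der_ext
  intro l
  refine matrix_kill hp (fun j l => truncPD p k n l (y j)) b hb (fun l => D (truncX p k n l)) ?_ l
  intro j
  rw [← der_apply, h]

variable {L : Type*} [LieRing L] [LieAlgebra k L] {op : L → L}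

/-- action of a subalgebra on `A(n)` -/
noncomputable def actA (ι : L →ₗ⁅k⁆ WittAlg p k n) : L →ₗ[k] Module.End k (TruncPoly p k n) :=
  derToEnd p k n ∘ₗ (ι : L →ₗ[k] WittAlg p k n)

theorem actA_apply (ι : L →ₗ⁅k⁆ WittAlg p k n) (x : L) (f : TruncPoly p k n) :
    actA ι x f = ι x f := rfl

theorem actA_pss (hp : p.Prime) (ι : L →ₗ⁅k⁆ WittAlg p k n)
    (hio : ∀ x, ι (op x) = derPow hp (ι x))
    {t : LieSubalgebra k L} (ht : IsTorus k op t) (x : t) : PSS p (actA ι x) := by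
  refine pss_of_hom (op := op) (actA ι) ?_ (ht.2 _ x.2)
  intro x
  change (ι (op x)).toLinearMap = (ι x).toLinearMap ^ p
  rw [hio, derPow_coe]

theorem act_comm [IsAlgClosed k] [FiniteDimensional k L] (hp : p.Prime) (hop : IsPMap p k op)
    (ι : L →ₗ⁅k⁆ WittAlg p k n) {t : LieSubalgebra k L} (ht : IsTorus k op t) (x y : t) :
    Commute (actA ι x) (actA ι y) := by
  have h := torus_abelian hp.two_le hop ht x.2 y.2
  have h2 : ⁅ι x, ι y⁆ = 0 := by rw [← LieHom.map_lie, h, map_zero]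
  refine LinearMap.ext fun f => ?_
  have h3 := congrArg (fun D => D f) h2
  simp only [Derivation.commutator_apply] at h3
  rw [Derivation.zero_apply, sub_eq_zero] at h3
  exact h3

theorem weight_sys [IsAlgClosed k] [FiniteDimensional k L] (hp : p.Prime) (hop : IsPMap p k op)
    (ι : L →ₗ⁅k⁆ WittAlg p k n) (hio : ∀ x, ι (op x) = derPow hp (ι x))
    {t : LieSubalgebra k L} (ht : IsTorus k op t) :
    Submodule.span k {v | IsWt ((actA ι).domRestrict t.toSubmodule) v} = ⊤ ∧
    ∃ y : Fin n → TruncPoly p k n, (∀ j, IsWt ((actA ι).domRestrict t.toSubmodule) (y j)) ∧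
    ∃ b : Module.Basis (Fin n) k (Fin n → k), ∀ j, b j = linJ hp (y j) := by
  have h := joint_diag_top ((actA ι).domRestrict t.toSubmodule)
    (fun s u => act_comm hp hop ι ht s u) (fun s => (actA_pss hp ι hio ht s).isSemisimple)
  refine ⟨h, ?_⟩
  have := exists_basis_of_span (linJ (k := k) (n := n) hp) (linJ_surj hp) h (ι := Fin n) (by simp)
  exact this

theorem upper_W [IsAlgClosed k] [FiniteDimensional k L] (hp : p.Prime) (hop : IsPMap p k op)
    (ι : L →ₗ⁅k⁆ WittAlg p k n) (hinj : Function.Injective ι)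
    (hio : ∀ x, ι (op x) = derPow hp (ι x))
    (t : LieSubalgebra k L) (ht : IsTorus k op t) : Module.finrank k t ≤ n := by
  obtain ⟨_, y, hy, b, hb⟩ := weight_sys hp hop ι hio ht
  choose χ hχ using hy
  have := finrank_le_of_sep χ (fun s hs => by
    have h1 : ι s = 0 := by
      apply der_kill hp y b hb
      intro j
      have := hχ j s
      rw [hs j, zero_smul] at this
      exact this
    have : (s : L) = 0 := hinj (by rw [h1, map_zero])
    exact Subtype.ext this)
  rw [Fintype.card_fin] at this
  exact this

end Upper

section WMain
variable {p : ℕ} {k : Type*} [Field k] [CharP k p] {L : Type*} [LieRing L] [LieAlgebra k L]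
  {op : L → L} {n : ℕ}
theorem main_W [IsAlgClosed k] [FiniteDimensional k L] (hp : p.Prime)
    (hs : LieAlgebra.IsSimple k L) (hop : IsPMap p k op)
    {V : Type*} [AddCommGroup V] [Module k V] [LieRingModule L V] [LieModule k L V]
    [FiniteDimensional k V] (hV : IsRestrictedModule p k op V)
    (hdim : Module.finrank k V < p ^ (mu k op) - 1) (hn : 1 ≤ n) (e : L ≃ₗ⁅k⁆ WittAlg p k n) :
    LieModule.IsTrivial L V :=
  finish hp hdim (upper_W hp hop e.toLieHom e.injective
    (iota_op hp hop e.toLieHom (cent_W hp e))) (fun hnt => lower_W hp hs hop hV hnt hn e)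
end WMain

section Tor
variable {p : ℕ} {k : Type*} [Field k] [CharP k p] {n : ℕ}

theorem derPow_zero_of_sq (hp : p.Prime) (D : WittAlg p k n)
    (h : ∀ i, D (D (truncX p k n i)) = 0) : derPow hp D = 0 := by
  apply der_ext
  intro i
  have h1 : derPow hp D (truncX p k n i) = (D.toLinearMap ^ p) (truncX p k n i) := by
    rw [← derPow_coe hp]; rfl
  rw [h1]
  have key : ∀ q, 2 ≤ q → (D.toLinearMap ^ q) (truncX p k n i) = 0 := by
    intro q hq
    obtain ⟨q, rfl⟩ := Nat.exists_eq_add_of_le hq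
    rw [add_comm, pow_add, Module.End.mul_apply, pow_two, Module.End.mul_apply]
    change (D.toLinearMap ^ q) (D (D (truncX p k n i))) = _
    rw [h, map_zero]
  rw [key p hp.two_le]; rfl

/-- the toral element with weights `w` -/
noncomputable def tor (w : Fin n → k) : WittAlg p k n :=
  ∑ i, (w i • truncX p k n i) • truncPD p k n i

theorem tor_X (w : Fin n → k) (i : Fin n) : tor w (truncX p k n i) = w i • truncX p k n i :=
  der_sum_X _ _

theorem wt_mul {D : WittAlg p k n} {f g : TruncPoly p k n} {s u : k} (hf : D f = s • f)
    (hg : D g = u • g) : D (f * g) = (s + u) • (f * g) := by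
  rw [Derivation.leibniz, hf, hg, smul_eq_mul, smul_eq_mul, add_smul, mul_smul_comm, mul_smul_comm,
    mul_comm g f, add_comm]

theorem wt_pow {D : WittAlg p k n} {f : TruncPoly p k n} {s : k} (hf : D f = s • f) (j : ℕ) :
    D (f ^ j) = (j * s) • f ^ j := by
  induction j with
  | zero => simp
  | succ j ih => rw [pow_succ, wt_mul ih hf]; congr 1; push_cast; ring

theorem wt_odoT (hp : p.Prime) {D : WittAlg p k n} {Y : ℕ → TruncPoly p k n} {w : ℕ → k} (i : ℕ)
    (h : ∀ j < i, D (Y j) = w j • Y j) :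
    D (odoT p Y i) = (-∑ j ∈ Finset.range i, w j) • odoT p Y i := by
  induction i with
  | zero => simp [odoT]
  | succ i ih =>
    rw [odoT_succ, Finset.sum_range_succ,
      wt_mul (ih fun j hj => h j (by omega)) (wt_pow (h i (by omega)) _)]
    congr 1
    rw [Nat.cast_sub hp.one_le, CharP.cast_eq_zero]; push_cast; ring

theorem lie_smul_pd {D : WittAlg p k n} (g : TruncPoly p k n) (c : Fin n) {s u : k}
    (hX : ∀ i, D (truncX p k n i) = (if i = c then u else 0) • truncX p k n i + (if i = c then 0 else D (truncX p k n i)))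
    (hg : D g = s • g) (hD : ∀ i, i ≠ c → truncPD p k n c (D (truncX p k n i)) = 0) :
    ⁅D, g • truncPD p k n c⁆ = (s - u) • (g • truncPD p k n c) := by
  apply der_ext
  intro i
  rw [Derivation.commutator_apply, Derivation.smul_apply, Derivation.smul_apply, Derivation.smul_apply,
    Derivation.smul_apply, pd_X]
  by_cases h : i = c
  · subst h
    have := hX i
    simp only [if_true, add_zero] at this
    rw [this, Derivation.map_smul, pd_X]
    simp [hg, sub_smul]
  · rw [hD i h, if_neg (Ne.symm h)]
    simp

theorem lie_tor_smul (w : Fin n → k) (g : TruncPoly p k n) (c : Fin n) {s : k}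
    (hg : tor w g = s • g) :
    ⁅tor w, g • truncPD p k n c⁆ = (s - w c) • (g • truncPD p k n c) := by
  apply lie_smul_pd
  · intro i
    split_ifs with h
    · subst h; rw [tor_X, add_zero]
    · rw [zero_smul, zero_add]
  · exact hg
  · intro i hi
    rw [tor_X, Derivation.map_smul, pd_X, if_neg (Ne.symm hi), smul_zero]

theorem tor_pd (w : Fin n → k) (g : TruncPoly p k n) (c : Fin n) {s : k}
    (hg : tor w g = s • g) : tor w (truncPD p k n c g) = (s - w c) • truncPD p k n c g := by
  have h := lie_tor_smul w (1 : TruncPoly p k n) c (s := 0) (by simp)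
  have h2 := congrArg (fun D => D g) h
  simp only [Derivation.commutator_apply, one_smul, hg, Derivation.map_smul, Derivation.smul_apply] at h2
  rw [sub_eq_iff_eq_add] at h2
  rw [h2, ← add_smul]; congr 1; ring

theorem derivedSub_le {L : Type*} [LieRing L] [LieAlgebra k L] (K : LieSubalgebra k L) :
    derivedSub k K ≤ K := by
  apply LieSubalgebra.lieSpan_le.2
  rintro _ ⟨x, hx, y, hy, rfl⟩
  exact K.lie_mem hx hy

theorem mem_derived {L : Type*} [LieRing L] [LieAlgebra k L] {K : LieSubalgebra k L} {x y z : L}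
    (hx : x ∈ K) (hy : y ∈ K) {s : k} (hs : s ≠ 0) (h : ⁅x, y⁆ = s • z) : z ∈ derivedSub k K := by
  have : z = s⁻¹ • ⁅x, y⁆ := by rw [h, smul_smul, inv_mul_cancel₀ hs, one_smul]
  rw [this]
  apply (derivedSub k K).smul_mem
  exact LieSubalgebra.subset_lieSpan ⟨x, hx, y, hy, rfl⟩

end Tor

section SType
variable {p : ℕ} {k : Type*} [Field k] [CharP k p] {n : ℕ}

theorem div_add (D E : WittAlg p k n) :
    divergence p k n (D + E) = divergence p k n D + divergence p k n E := by
  simp [divergence, Finset.sum_add_distrib]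

theorem div_smul (c : k) (D : WittAlg p k n) :
    divergence p k n (c • D) = c • divergence p k n D := by
  simp only [divergence, Derivation.smul_apply, Derivation.map_smul, Finset.smul_sum]

theorem div_zero' : divergence p k n 0 = 0 := by simp [divergence]

theorem div_sum {κ : Type*} (s : Finset κ) (D : κ → WittAlg p k n) :
    divergence p k n (∑ i ∈ s, D i) = ∑ i ∈ s, divergence p k n (D i) := by
  classical
  induction s using Finset.induction_on with
  | empty => simp [div_zero']
  | insert a s ha ih => rw [Finset.sum_insert ha, div_add, ih, Finset.sum_insert ha]

theorem div_smul_pd (g : TruncPoly p k n) (c : Fin n) :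
    divergence p k n (g • truncPD p k n c) = truncPD p k n c g := by
  unfold divergence
  rw [Finset.sum_eq_single c]
  · rw [Derivation.smul_apply, pd_X, if_pos rfl]; simp
  · intro i _ hi
    rw [Derivation.smul_apply, pd_X, if_neg (Ne.symm hi)]; simp
  · simp

theorem pd_der (D : WittAlg p k n) (i : Fin n) (g : TruncPoly p k n) :
    truncPD p k n i (D g) = ∑ j, truncPD p k n i (D (truncX p k n j)) * truncPD p k n j g
      + D (truncPD p k n i g) := by
  rw [der_apply D g, der_apply D (truncPD p k n i g), map_sum, ← Finset.sum_add_distrib]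
  apply Finset.sum_congr rfl
  intro j _
  rw [Derivation.leibniz, smul_eq_mul, smul_eq_mul, pd_comm i j]; ring

theorem div_lie (D E : WittAlg p k n) :
    divergence p k n ⁅D, E⁆ = D (divergence p k n E) - E (divergence p k n D) := by
  unfold divergence
  simp only [Derivation.commutator_apply, map_sub, Finset.sum_sub_distrib]
  have e1 : ∀ D E : WittAlg p k n, ∑ i, truncPD p k n i (D (E (truncX p k n i)))
      = ∑ i, ∑ j, truncPD p k n i (D (truncX p k n j)) * truncPD p k n j (E (truncX p k n i))
        + ∑ i, D (truncPD p k n i (E (truncX p k n i))) := fun D E => by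
    rw [← Finset.sum_add_distrib]
    exact Finset.sum_congr rfl fun i _ => pd_der _ _ _
  rw [e1, e1, map_sum, map_sum]
  have : ∑ i, ∑ j, truncPD p k n i (D (truncX p k n j)) * truncPD p k n j (E (truncX p k n i))
    = ∑ i, ∑ j, truncPD p k n i (E (truncX p k n j)) * truncPD p k n j (D (truncX p k n i)) := by
    rw [Finset.sum_comm]
    refine Finset.sum_congr rfl fun _ _ => Finset.sum_congr rfl fun _ _ => mul_comm _ _
  rw [this]; ring

/-- divergence-free derivations -/
noncomputable def divFree (p : ℕ) (k : Type*) [Field k] [CharP k p] (n : ℕ) :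
    LieSubalgebra k (WittAlg p k n) where
  carrier := {D | divergence p k n D = 0}
  add_mem' := by intro a b ha hb; simp only [Set.mem_ofPred_eq] at *; rw [div_add, ha, hb, add_zero]
  zero_mem' := div_zero'
  smul_mem' := by intro c a ha; simp only [Set.mem_ofPred_eq] at *; rw [div_smul, ha, smul_zero]
  lie_mem' := by
    intro a b ha hb
    change divergence p k n ⁅a, b⁆ = 0
    change divergence p k n a = 0 at ha
    change divergence p k n b = 0 at hb
    rw [div_lie, ha, hb, map_zero, map_zero, sub_zero]

theorem special_div {D : WittAlg p k n} (h : D ∈ specialAlg p k n) : divergence p k n D = 0 := by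
  have h1 := derivedSub_le _ h
  have h2 : specialAmbient p k n ≤ divFree p k n := LieSubalgebra.lieSpan_le.2 (fun D hD => hD)
  exact h2 h1

theorem mem_special (w : Fin n → k) (hw : ∑ i, w i = 0) {D : WittAlg p k n}
    (hD : divergence p k n D = 0) {s : k} (hs : s ≠ 0) (h : ⁅tor w, D⁆ = s • D) :
    D ∈ specialAlg p k n := by
  refine mem_derived (x := tor w) (y := D) ?_ ?_ hs h
  · apply LieSubalgebra.subset_lieSpan
    change divergence p k n (tor w) = 0
    rw [tor, div_sum]
    simp only [div_smul_pd, Derivation.map_smul, pd_X, if_true]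
    rw [← Finset.sum_smul, hw, zero_smul]
  · exact LieSubalgebra.subset_lieSpan hD

theorem sum_pm {i j : Fin n} : ∑ l, ((Pi.single i 1 - Pi.single j 1 : Fin n → k)) l = 0 := by
  simp [Finset.sum_sub_distrib]

theorem smul_pd_mem_special {i j : Fin n} (hij : i ≠ j) (g : TruncPoly p k n)
    (hg0 : truncPD p k n i g = 0)
    (hg : tor (Pi.single i 1 - Pi.single j 1 : Fin n → k) g = (0 : k) • g) :
    g • truncPD p k n i ∈ specialAlg p k n := by
  refine mem_special (Pi.single i 1 - Pi.single j 1) sum_pm (by rw [div_smul_pd, hg0])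
    (s := -1) (by simp) ?_
  rw [lie_tor_smul _ _ _ hg]
  congr 1
  simp [hij]

theorem xpd_mem_special (hn : 3 ≤ n) {i j : Fin n} (hij : i ≠ j) :
    truncX p k n i • truncPD p k n j ∈ specialAlg p k n := by
  obtain ⟨l, hl⟩ : ∃ l, l ∉ ({i, j} : Finset (Fin n)) := by
    by_contra! h
    have := Finset.card_le_card (fun l _ => h l : (Finset.univ : Finset (Fin n)) ⊆ {i, j})
    have h2 := Finset.card_le_two (a := i) (b := j)
    simp only [Finset.card_univ, Fintype.card_fin] at this
    omega
  simp only [Finset.mem_insert, Finset.mem_singleton, not_or] at hl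
  refine mem_special (Pi.single i 1 - Pi.single l 1) sum_pm ?_ (s := 1) (by simp) ?_
  · rw [div_smul_pd, pd_X, if_neg (Ne.symm hij)]
  · rw [lie_tor_smul _ _ _ (s := 1)]
    · congr 1
      rw [Pi.sub_apply, Pi.single_eq_of_ne (Ne.symm hij), Pi.single_eq_of_ne (Ne.symm hl.2)]
      simp
    · rw [tor_X]; congr 1
      rw [Pi.sub_apply, Pi.single_eq_same, Pi.single_eq_of_ne (Ne.symm hl.1)]; simp

variable {L : Type*} [LieRing L] [LieAlgebra k L] {op : L → L}

/-- embedding -/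
noncomputable def subIota {K : LieSubalgebra k (WittAlg p k n)} (e : L ≃ₗ⁅k⁆ K) :
    L →ₗ⁅k⁆ WittAlg p k n := K.incl.comp e.toLieHom

theorem subIota_inj {K : LieSubalgebra k (WittAlg p k n)} (e : L ≃ₗ⁅k⁆ K) :
    Function.Injective (subIota e) := Subtype.val_injective.comp e.injective

theorem subIota_mem {K : LieSubalgebra k (WittAlg p k n)} (e : L ≃ₗ⁅k⁆ K) (x : L) :
    subIota e x ∈ K := (e x).2

theorem subIota_symm {K : LieSubalgebra k (WittAlg p k n)} (e : L ≃ₗ⁅k⁆ K) {D} (h : D ∈ K) :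
    subIota e (e.symm ⟨D, h⟩) = D := by
  change ((e (e.symm ⟨D, h⟩) : K) : WittAlg p k n) = D
  rw [LieEquiv.apply_symm_apply]

theorem cent_S (hp : p.Prime) (hn : 3 ≤ n) (e : L ≃ₗ⁅k⁆ specialAlg p k n) (E : WittAlg p k n)
    (h : ∀ x, ⁅E, subIota e x⁆ = 0) : E = 0 := by
  have h' : ∀ D ∈ specialAlg p k n, ⁅E, D⁆ = 0 := fun D hD => by
    have := h (e.symm ⟨D, hD⟩)
    rwa [subIota_symm] at this
  have hne : ∀ j : Fin n, ∃ l : Fin n, j ≠ l := fun j => by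
    have : Nontrivial (Fin n) := Fin.nontrivial_iff_two_le.2 (by omega)
    obtain ⟨l, hl⟩ := exists_ne j
    exact ⟨l, hl.symm⟩
  apply der_ext
  intro j
  obtain ⟨c, hc⟩ := const_of_comm_pd hp (E := E) (fun i => h' _ (by
    obtain ⟨l, hl⟩ := hne i
    have := smul_pd_mem_special (p := p) (k := k) hl 1 (by simp) (by simp)
    rwa [one_smul] at this)) j
  obtain ⟨l, hl⟩ := hne j
  have := congrArg (fun D => D (truncX p k n l)) (h' _ (xpd_mem_special hn hl))
  simp only [Derivation.commutator_apply, Derivation.smul_apply, pd_X, if_true] at this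
  obtain ⟨c', hc'⟩ := const_of_comm_pd hp (E := E) (fun i => h' _ (by
    obtain ⟨l, hl⟩ := hne i
    have := smul_pd_mem_special (p := p) (k := k) hl 1 (by simp) (by simp)
    rwa [one_smul] at this)) l
  rw [hc', smul_eq_mul, mul_one] at this
  rw [hc] at this ⊢
  simpa [hc] using this

end SType

section SLow
variable {p : ℕ} {k : Type*} [Field k] [CharP k p] {n : ℕ}
variable {L : Type*} [LieRing L] [LieAlgebra k L] {op : L → L}

/-- the first `m` variables -/
noncomputable def mX (p : ℕ) (k : Type*) [Field k] (n m : ℕ) (i : ℕ) : TruncPoly p k n :=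
  if i < m then nX p k n i else 0

theorem mX_of_lt {m i : ℕ} (h : i < m) (h' : i < n) : mX p k n m i = truncX p k n ⟨i, h'⟩ := by
  rw [mX, if_pos h, nX_of_lt h']

theorem pd_odoT {m : ℕ} (hm : m ≤ n) (i : ℕ) (hi : i ≤ m) (c : Fin n) (hc : i ≤ c.1) :
    truncPD p k n c (odoT p (mX p k n m) i) = 0 := by
  induction i with
  | zero => simp [odoT]
  | succ i ih =>
    rw [odoT_succ, Derivation.leibniz, ih (by omega) (by omega), Derivation.leibniz_pow,
      mX_of_lt (by omega) (by omega : i < n), pd_X, if_neg]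
    · simp
    · intro h; rw [h] at hc; simp at hc

theorem tor_odoT (hp : p.Prime) {m : ℕ} (hm : m ≤ n) (i : ℕ) (hi : i ≤ m) (w : Fin n → k) :
    tor w (odoT p (mX p k n m) i)
      = (-∑ j ∈ Finset.range i, (if h : j < n then w ⟨j, h⟩ else 0)) • odoT p (mX p k n m) i := by
  apply wt_odoT hp
  intro j hj
  rw [mX_of_lt (by omega) (by omega : j < n), dif_pos (by omega), tor_X]

theorem wlie_add (D E F : WittAlg p k n) : ⁅D, E + F⁆ = ⁅D, E⁆ + ⁅D, F⁆ := lie_add D E F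

theorem wlie_smul (c : k) (D E : WittAlg p k n) : ⁅D, c • E⁆ = c • ⁅D, E⁆ := lie_smul c D E

theorem lower_S (hp : p.Prime) [IsAlgClosed k] (hs : LieAlgebra.IsSimple k L)
    (hop : IsPMap p k op)
    {V : Type*} [AddCommGroup V] [Module k V] [LieRingModule L V] [LieModule k L V]
    [FiniteDimensional k V] (hV : IsRestrictedModule p k op V)
    (hnt : ¬ LieModule.IsTrivial L V) {m : ℕ} (hm : 2 ≤ m) (e : L ≃ₗ⁅k⁆ specialAlg p k (m+1)) :
    p ^ m - 1 ≤ Module.finrank k V := by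
  set Y := mX p k (m+1) m with hY
  set z0 : Fin (m+1) := ⟨0, by omega⟩
  set z1 : Fin (m+1) := ⟨1, by omega⟩
  have hz : z0 ≠ z1 := by simp [z0, z1]
  have hzl : z0 ≠ Fin.last m := by intro h; have := congrArg Fin.val h; simp [z0] at this; omega
  have hzl1 : z1 ≠ Fin.last m := by intro h; have := congrArg Fin.val h; simp [z1] at this; omega
  set a : WittAlg p k (m+1) := ∑ i : Fin m, odoT p Y i • truncPD p k (m+1) i.castSucc with ha
  set b : WittAlg p k (m+1) := odoT p Y m • truncPD p k (m+1) z0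
    + (-1 : k) • ((truncPD p k (m+1) z0 (odoT p Y m) * truncX p k (m+1) (Fin.last m)) •
        truncPD p k (m+1) (Fin.last m)) with hb
  have hlast : truncPD p k (m+1) (Fin.last m) (odoT p Y m) = 0 := pd_odoT (by omega) m le_rfl _ (by simp)
  have ham : a ∈ specialAlg p k (m+1) := by
    apply (specialAlg p k (m+1)).toSubmodule.sum_mem
    intro i _
    refine smul_pd_mem_special (j := Fin.last m) (Fin.castSucc_lt_last i).ne _
      (pd_odoT (by omega) _ i.2.le _ (by simp)) ?_
    rw [tor_odoT hp (by omega) _ i.2.le]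
    congr 1
    rw [neg_eq_zero]
    apply Finset.sum_eq_zero
    intro j hj
    rw [Finset.mem_range] at hj
    have hi := i.2
    rw [dif_pos (by omega), Pi.sub_apply, Pi.single_eq_of_ne, Pi.single_eq_of_ne, sub_zero]
    · intro h; have := congrArg Fin.val h; simp at this; omega
    · intro h; have := congrArg Fin.val h; simp at this; omega
  have hbm : b ∈ specialAlg p k (m+1) := by
    have ht : tor (Pi.single z0 1 - Pi.single z1 1 : Fin (m+1) → k) (odoT p Y m)
        = (0 : k) • odoT p Y m := by
      rw [tor_odoT hp (by omega) _ le_rfl]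
      congr 1
      rw [neg_eq_zero]
      rw [← Finset.sum_subset (s₁ := {0, 1})]
      · rw [Finset.sum_pair (by simp)]
        rw [dif_pos (by omega), dif_pos (by omega)]
        change (Pi.single z0 1 - Pi.single z1 1 : Fin (m+1) → k) z0 +
          (Pi.single z0 1 - Pi.single z1 1 : Fin (m+1) → k) z1 = 0
        simp [hz, hz.symm]
      · intro x hx; simp at hx ⊢; omega
      · intro x hx hx2
        simp at hx hx2
        rw [dif_pos (by omega), Pi.sub_apply, Pi.single_eq_of_ne, Pi.single_eq_of_ne, sub_zero]
        · intro h; have := congrArg Fin.val h; simp [z1] at this; omega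
        · intro h; have := congrArg Fin.val h; simp [z0] at this; omega
    refine mem_special (Pi.single z0 1 - Pi.single z1 1) sum_pm ?_ (s := -1) (by simp) ?_
    · rw [hb, div_add, div_smul, div_smul_pd, div_smul_pd, Derivation.leibniz, pd_X, if_pos rfl,
        pd_comm, hlast]
      simp
    · rw [hb, wlie_add, wlie_smul, lie_tor_smul _ _ _ ht]
      rw [lie_tor_smul _ _ _ (wt_mul (tor_pd _ _ z0 ht) (tor_X _ _))]
      rw [smul_add, smul_comm (-1 : k) (-1 : k)]
      have e1 : (Pi.single z0 1 - Pi.single z1 1 : Fin (m+1) → k) z0 = 1 := by simp [hz]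
      have e2 : (Pi.single z0 1 - Pi.single z1 1 : Fin (m+1) → k) (Fin.last m) = 0 := by
        rw [Pi.sub_apply, Pi.single_eq_of_ne hzl.symm, Pi.single_eq_of_ne hzl1.symm, sub_zero]
      rw [e1, e2]
      simp only [zero_sub, add_zero, sub_zero]
  refine lower_cartan hp hs hop hV hnt (subIota e) (subIota_inj e) (cent_S hp (by omega) e) m
    (by omega) Y ?_ (e.symm ⟨a, ham⟩) (e.symm ⟨b, hbm⟩) ?_ ?_ ?_ ?_
  · intro i hi
    rw [hY, mX_of_lt hi (by omega)]; exact truncX_pow _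
  · intro i hi
    rw [subIota_symm, ha, sum_der_apply]
    rw [Finset.sum_eq_single ⟨i, hi⟩]
    · rw [Derivation.smul_apply, hY, mX_of_lt hi (by omega), pd_X, if_pos (by ext; rfl)]; simp
    · intro j _ hj
      rw [Derivation.smul_apply, hY, mX_of_lt hi (by omega), pd_X, if_neg]; · simp
      intro h; apply hj; ext; have := congrArg Fin.val h; simpa using this
    · simp
  · rw [subIota_symm, hb, hY, mX_of_lt (by omega) (by omega : 0 < m + 1), Derivation.add_apply,
      Derivation.smul_apply, Derivation.smul_apply, Derivation.smul_apply, pd_X, pd_X, if_pos rfl,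
      if_neg hzl.symm]
    simp
  · intro i hi
    rw [subIota_symm]
    by_cases h : i < m
    · rw [hb, hY, mX_of_lt h (by omega), Derivation.add_apply,
        Derivation.smul_apply, Derivation.smul_apply, Derivation.smul_apply, pd_X, pd_X, if_neg,
        if_neg]
      · simp
      · intro h; have := congrArg Fin.val h; simp at this; omega
      · intro h; have := congrArg Fin.val h; simp [z0] at this; omega
    · rw [hY, mX, if_neg h, map_zero]
  · intro E hE
    set D := subIota e E with hD
    have hdiv := special_div (subIota_mem e E)
    rw [← hD] at hdiv
    have h0 : ∀ i : Fin (m+1), i ≠ Fin.last m → D (truncX p k (m+1) i) = 0 := by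
      intro i hi
      have hi' : i.1 < m := by
        have := i.2
        rcases Nat.lt_or_ge i.1 m with h | h
        · exact h
        · exact absurd (Fin.ext (by simp; omega)) hi
      have := hE i hi'
      rwa [hY, mX_of_lt hi' i.2] at this
    have h1 : truncPD p k (m+1) (Fin.last m) (D (truncX p k (m+1) (Fin.last m))) = 0 := by
      rw [divergence, Finset.sum_eq_single (Fin.last m)] at hdiv
      · exact hdiv
      · intro i _ hi
        rw [h0 i hi, map_zero]
      · simp
    apply derPow_zero_of_sq
    intro i
    by_cases hi : i = Fin.last m
    · subst hi
      rw [der_apply D (D _)]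
      apply Finset.sum_eq_zero
      intro j _
      by_cases hj : j = Fin.last m
      · subst hj; rw [h1, mul_zero]
      · rw [h0 j hj, zero_mul]
    · rw [h0 i hi, map_zero]

end SLow

section SUp
variable {p : ℕ} {k : Type*} [Field k] [CharP k p] {n : ℕ}
variable {L : Type*} [LieRing L] [LieAlgebra k L] {op : L → L}

theorem trace_lin (hp : p.Prime) (y : Fin n → TruncPoly p k n)
    (b : Module.Basis (Fin n) k (Fin n → k)) (hb : ∀ j, b j = linJ hp (y j))
    (D : WittAlg p k n) (h0 : ∀ i, eps hp.ne_zero (D (truncX p k n i)) = 0) (c : Fin n → k)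
    (hc : ∀ j, D (y j) = c j • y j) : ∑ j, c j = eps hp.ne_zero (divergence p k n D) := by
  set N : Matrix (Fin n) (Fin n) k := Matrix.of fun i j =>
    eps hp.ne_zero (truncPD p k n i (D (truncX p k n j))) with hN
  have h1 : eps hp.ne_zero (divergence p k n D) = N.trace := by
    rw [divergence, map_sum]; rfl
  have hD0 : ∀ f, eps hp.ne_zero (D f) = 0 := by
    intro f
    rw [der_apply, map_sum]
    apply Finset.sum_eq_zero
    intro i _
    rw [map_mul, h0, zero_mul]
  have h2 : ∀ j, Matrix.toLin' N (b j) = c j • b j := by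
    intro j
    rw [hb]
    funext i
    have h3 := congrArg (fun f => eps hp.ne_zero (truncPD p k n i f)) (hc j)
    simp only [Derivation.map_smul, map_smul] at h3
    rw [pd_der, map_add, hD0, add_zero, map_sum] at h3
    rw [Pi.smul_apply, linJ_apply, ← h3, Matrix.toLin'_apply, Matrix.mulVec, dotProduct]
    simp only [map_mul]
    rfl
  have h4 : LinearMap.toMatrix b b (Matrix.toLin' N) = Matrix.diagonal c := by
    ext i j
    rw [LinearMap.toMatrix_apply, h2, map_smul, Finsupp.smul_apply, Module.Basis.repr_self,
      Matrix.diagonal_apply, Finsupp.single_apply]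
    by_cases h : i = j
    · subst h; simp
    · simp [h, Ne.symm h]
  rw [h1, ← Matrix.trace_toLin'_eq, LinearMap.trace_eq_matrix_trace k b, h4, Matrix.trace_diagonal]

/-- the top exponent -/
noncomputable def topE (p n : ℕ) : Fin n →₀ ℕ := Finsupp.equivFunOnFinite.symm fun _ => p - 1

theorem topE_lt (hp : p.Prime) (i : Fin n) : topE p n i < p := by
  have := hp.pos
  simp [topE]; omega

/-- the top coefficient -/
noncomputable def integ (hp : p.Prime) : TruncPoly p k n →ₗ[k] k := cf (topE p n) (topE_lt hp)

theorem integ_pd (hp : p.Prime) (i : Fin n) (f : TruncPoly p k n) :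
    integ hp (truncPD p k n i f) = 0 := by
  apply cf_pd_top
  have := hp.pos
  simp [topE]; omega

theorem integ_der (hp : p.Prime) (D : WittAlg p k n) (hD : divergence p k n D = 0)
    (f : TruncPoly p k n) : integ hp (D f) = 0 := by
  have : D f = ∑ i, truncPD p k n i (D (truncX p k n i) * f) - divergence p k n D * f := by
    rw [der_apply, divergence, Finset.sum_mul, ← Finset.sum_sub_distrib]
    apply Finset.sum_congr rfl
    intro i _
    rw [Derivation.leibniz, smul_eq_mul, smul_eq_mul]; ring
  rw [this, hD, zero_mul, sub_zero, map_sum]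
  exact Finset.sum_eq_zero fun i _ => integ_pd hp i _

theorem integ_const (hp : p.Prime) (hn : 1 ≤ n) (c : k) :
    integ hp (algebraMap k (TruncPoly p k n) c) = 0 := by
  change (MvPolynomial.C c).coeff (topE p n) = 0
  rw [MvPolynomial.coeff_C, if_neg]
  intro h
  have := DFunLike.congr_fun h ⟨0, by omega⟩
  have h2 := hp.two_le
  simp [topE] at this
  omega

theorem integ_ne (hp : p.Prime) : integ (k := k) (n := n) hp ≠ 0 := by
  intro h
  have := LinearMap.congr_fun h (Ideal.Quotient.mk (truncIdeal p k n) (MvPolynomial.monomial (topE p n) 1))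
  rw [integ, cf_mk, MvPolynomial.coeff_monomial, if_pos rfl] at this
  exact one_ne_zero this

theorem upper_S [IsAlgClosed k] [FiniteDimensional k L] (hp : p.Prime) (hop : IsPMap p k op)
    (ι : L →ₗ⁅k⁆ WittAlg p k n) (hinj : Function.Injective ι)
    (hio : ∀ x, ι (op x) = derPow hp (ι x)) (hn : 1 ≤ n)
    (hdiv : ∀ x, divergence p k n (ι x) = 0)
    (t : LieSubalgebra k L) (ht : IsTorus k op t) : Module.finrank k t ≤ n - 1 := by
  by_contra hcon
  have hle := upper_W hp hop ι hinj hio t ht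
  have hfr : Module.finrank k t.toSubmodule = n := by
    change Module.finrank k t = n
    omega
  obtain ⟨hspan, y, hy, b, hb⟩ := weight_sys hp hop ι hio ht
  choose χ hχ using hy
  have hχ' : ∀ j (s : t.toSubmodule), ι s (y j) = χ j s • y j := hχ
  have hpi : Function.Injective (LinearMap.pi χ) := by
    rw [injective_iff_map_eq_zero]
    intro s hs
    have h1 : ι s = 0 := by
      apply der_kill hp y b hb
      intro j
      rw [hχ', show χ j s = 0 from congrFun hs j, zero_smul]
    exact Subtype.ext (hinj (h1.trans (map_zero ι).symm))
  have hsurj : Function.Surjective (LinearMap.pi χ) :=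
    (LinearMap.injective_iff_surjective_of_finrank_eq_finrank (by rw [hfr]; simp)).1 hpi
  choose s hs using fun i : Fin n => hsurj (Pi.single i 1)
  have hs' : ∀ i j, ι (s i) (y j) = (Pi.single i 1 : Fin n → k) j • y j := by
    intro i j
    rw [hχ', ← hs i]; rfl
  have hunit : ∀ j, eps hp.ne_zero (y j) ≠ 0 := by
    intro j hj
    have h0 : ∀ l, eps hp.ne_zero (ι (s j) (y l)) = 0 := by
      intro l
      rw [hs', map_smul]
      by_cases h : l = j
      · subst h; rw [hj, smul_zero]
      · rw [Pi.single_eq_of_ne h, zero_smul]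
    have h1 : ∀ i, eps hp.ne_zero (ι (s j) (truncX p k n i)) = 0 := by
      intro i
      have := matrix_kill (n := n) hp (fun j l => algebraMap k _ (eps hp.ne_zero (truncPD p k n l (y j)))) b
        (fun j => by rw [hb]; funext l; rw [linJ_apply]; simp)
        (fun l => algebraMap k _ (eps hp.ne_zero (ι (s j) (truncX p k n l)))) (by
          intro l
          have := h0 l
          rw [der_apply, map_sum] at this
          simp only [map_mul] at this
          have h3 := congrArg (algebraMap k (TruncPoly p k n)) this
          rw [map_sum, map_zero] at h3
          simpa only [map_mul] using h3) i
      have h2 := congrArg (eps hp.ne_zero) this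
      simpa using h2
    have := trace_lin hp y b hb (ι (s j)) h1 _ (hs' j)
    rw [hdiv, map_zero] at this
    simp at this
  -- the fields `ι (s j)` are independent at the origin
  have hind : LinearIndependent k (fun j : Fin n => fun l : Fin n =>
      eps hp.ne_zero (ι (s j) (truncX p k n l))) := by
    rw [Fintype.linearIndependent_iff]
    intro g hg i
    have h1 : ∑ j, g j * eps hp.ne_zero (ι (s j) (y i)) = 0 := by
      have h2 : ∀ j, eps hp.ne_zero (ι (s j) (y i)) = ∑ l, eps hp.ne_zero (ι (s j) (truncX p k n l))
          * eps hp.ne_zero (truncPD p k n l (y i)) := by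
        intro j
        rw [der_apply, map_sum]; simp only [map_mul]
      simp only [h2, Finset.mul_sum]
      rw [Finset.sum_comm]
      apply Finset.sum_eq_zero
      intro l _
      have h3 := congrFun hg l
      rw [Finset.sum_apply] at h3
      simp only [Pi.smul_apply, smul_eq_mul, Pi.zero_apply] at h3
      simp only [← mul_assoc]
      rw [← Finset.sum_mul, h3, zero_mul]
    rw [Finset.sum_eq_single i] at h1
    · rw [hs', Pi.single_eq_same, one_smul] at h1
      exact (mul_eq_zero.1 h1).resolve_right (hunit i)
    · intro j _ hj
      rw [hs', Pi.single_eq_of_ne (Ne.symm hj), zero_smul, map_zero, mul_zero]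
    · simp
  have hn' : Nonempty (Fin n) := ⟨⟨0, by omega⟩⟩
  set b' := basisOfLinearIndependentOfCardEqFinrank hind (by simp) with hb'
  apply integ_ne (k := k) (n := n) hp
  rw [← LinearMap.ker_eq_top, eq_top_iff, ← hspan, Submodule.span_le]
  rintro f ⟨ψ, hψ⟩
  have hψ' : ∀ u : t.toSubmodule, ι u f = ψ u • f := hψ
  change integ hp f = 0
  by_cases hall : ∀ j, ψ (s j) = 0
  · have : f = algebraMap k _ (eps hp.ne_zero f) := by
      apply const_of_pd hp
      intro i
      refine matrix_kill hp (fun j l => ι (s j) (truncX p k n l)) b' ?_ (fun l => truncPD p k n l f) ?_ i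
      · intro j
        rw [hb', coe_basisOfLinearIndependentOfCardEqFinrank]
      · intro j
        have := hψ' (s j)
        rw [hall j, zero_smul, der_apply] at this
        rw [← this]
        exact Finset.sum_congr rfl fun _ _ => mul_comm _ _
    rw [this]
    exact integ_const hp hn _
  · push Not at hall
    obtain ⟨j, hj⟩ := hall
    have := integ_der hp _ (hdiv (s j)) f
    rw [hψ', map_smul, smul_eq_mul] at this
    exact (mul_eq_zero.1 this).resolve_left hj

theorem main_S [IsAlgClosed k] [FiniteDimensional k L] (hp : p.Prime)
    (hs : LieAlgebra.IsSimple k L) (hop : IsPMap p k op)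
    {V : Type*} [AddCommGroup V] [Module k V] [LieRingModule L V] [LieModule k L V]
    [FiniteDimensional k V] (hV : IsRestrictedModule p k op V)
    (hdim : Module.finrank k V < p ^ (mu k op) - 1) (hn : 3 ≤ n) (e : L ≃ₗ⁅k⁆ specialAlg p k n) :
    LieModule.IsTrivial L V := by
  obtain ⟨m, rfl⟩ : ∃ m, n = m + 1 := ⟨n - 1, by omega⟩
  exact finish hp hdim (upper_S hp hop (subIota e) (subIota_inj e)
    (iota_op hp hop (subIota e) (cent_S hp hn e)) (by omega)
    (fun x => special_div (subIota_mem e x)))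
    (fun hnt => lower_S hp hs hop hV hnt (by omega) e)
end SUp

section Lagr
variable {k : Type*} [Field k] [IsAlgClosed k] {A : Type*} [AddCommGroup A] [Module k A]
  [FiniteDimensional k A] {Q : Type*} [AddCommGroup Q] [Module k Q] [FiniteDimensional k Q]

theorem lagrangian (br : A →ₗ[k] A →ₗ[k] A) (halt : ∀ f, br f f = 0)
    (hjac : ∀ f g h, br f (br g h) = br (br f g) h + br g (br f h)) (β : A →ₗ[k] k)
    (J : A →ₗ[k] Q) (hJ : Function.Surjective J)
    (hR : ∀ f, J f = 0 ↔ ∀ g, β (br f g) = 0)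
    (F : Submodule k A) (hF : ∀ f ∈ F, ∀ g ∈ F, br f g = 0)
    (hss : ∀ f ∈ F, Module.End.IsSemisimple (br f)) (Z : Submodule k A)
    (hZ : ∀ x ∈ F, (∀ a, J (br x a) = 0) → x ∈ Z) :
    2 * Module.finrank k F ≤ Module.finrank k Q + 2 * Module.finrank k Z := by
  have hsk : ∀ f g, br f g = - br g f := by
    intro f g
    have h := halt (f + g)
    simp only [map_add, LinearMap.add_apply, halt, zero_add, add_zero] at h
    rw [eq_neg_iff_add_eq_zero, ← h, add_comm]
  set B : LinearMap.BilinForm k A := br.compr₂ β with hB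
  have hBa : ∀ f g, B f g = β (br f g) := fun f g => rfl
  have hBs : ∀ f g, B f g = - B g f := fun f g => by rw [hBa, hBa, hsk, map_neg]
  have hrefl : B.IsRefl := by
    intro f g h
    rw [hBs, h, neg_zero]
  set R := LinearMap.ker J with hRdef
  have hR' : ∀ f, f ∈ R ↔ ∀ g, B f g = 0 := fun f => hR f
  set F0 := F ⊓ R with hF0
  have hinv : ∀ x ∈ F0, ∀ f g, B (br x f) g = - B f (br x g) := by
    intro x hx f g
    have h1 := hjac x f g
    have h2 := (hR' x).1 hx.2 (br f g)
    rw [hBa, h1, map_add] at h2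
    rw [hBa, hBa]
    exact eq_neg_of_add_eq_zero_left h2
  have hxR : ∀ x ∈ F0, ∀ f ∈ R, br x f ∈ R := by
    intro x hx f hf
    rw [hR']
    intro g
    rw [hinv x hx, (hR' f).1 hf, neg_zero]
  -- the action of F0
  set φ : F0 →ₗ[k] Module.End k A := br.domRestrict F0 with hφ
  have hφa : ∀ (x : F0) a, φ x a = br x a := fun x a => rfl
  have hcomm : ∀ s t, Commute (φ s) (φ t) := by
    intro s t
    refine LinearMap.ext fun a => ?_
    change br s (br t a) = br t (br s a)
    rw [hjac, hF _ s.2.1 _ t.2.1, map_zero, LinearMap.zero_apply, zero_add]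
  have hssφ : ∀ t, (φ t).IsSemisimple := fun t => hss _ t.2.1
  -- maximal stable isotropic
  set P : Submodule k A → Prop := fun N => F ⊔ R ≤ N ∧ (∀ x ∈ F0, ∀ v ∈ N, br x v ∈ N) ∧
    ∀ u ∈ N, ∀ v ∈ N, B u v = 0 with hP
  have hP0 : P (F ⊔ R) := by
    refine ⟨le_rfl, ?_, ?_⟩
    · intro x hx v hv
      obtain ⟨a, ha, b, hb, rfl⟩ := Submodule.mem_sup.1 hv
      rw [map_add, hF _ hx.1 _ ha, zero_add]
      exact Submodule.mem_sup_right (hxR x hx b hb)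
    · intro u hu v hv
      obtain ⟨a, ha, b, hb, rfl⟩ := Submodule.mem_sup.1 hu
      obtain ⟨c, hc, d, hd, rfl⟩ := Submodule.mem_sup.1 hv
      have h1 : B a c = 0 := by rw [hBa, hF a ha c hc, map_zero]
      have h2 : B a d = 0 := by rw [hBs, (hR' d).1 hd, neg_zero]
      simp only [map_add, LinearMap.add_apply, h1, h2, (hR' b).1 hb, add_zero]
  obtain ⟨N, hN, hmax⟩ := (wellFounded_gt : WellFounded ((· > ·) : Submodule k A → Submodule k A → Prop)).has_min
    {N | P N} ⟨_, hP0⟩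
  obtain ⟨hN1, hN2, hN3⟩ := hN
  have hperp : B.orthogonal N ≤ N := by
    by_contra hnot
    have hst : ∀ t : F0, ∀ v ∈ B.orthogonal N, φ t v ∈ B.orthogonal N := by
      intro t v hv u hu
      have h1 := hv _ (hN2 t t.2 u hu)
      change B u (br t v) = 0
      change B (br t u) v = 0 at h1
      rw [hinv t t.2] at h1
      exact neg_eq_zero.1 h1
    have hsp := joint_diag φ hcomm hssφ (B.orthogonal N) hst
    have : ∃ v, v ∈ B.orthogonal N ∧ IsWt φ v ∧ v ∉ N := by
      by_contra! hall
      apply hnot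
      rw [← hsp, Submodule.span_le]
      exact fun v hv => hall v hv.1 hv.2
    obtain ⟨v, hv1, ⟨χ, hχ⟩, hv3⟩ := this
    refine hmax (N ⊔ Submodule.span k {v}) ⟨hN1.trans le_sup_left, ?_, ?_⟩ ?_
    · intro x hx u hu
      obtain ⟨a, ha, b, hb, rfl⟩ := Submodule.mem_sup.1 hu
      obtain ⟨c, rfl⟩ := Submodule.mem_span_singleton.1 hb
      rw [map_add, map_smul]
      refine Submodule.add_mem _ (Submodule.mem_sup_left (hN2 x hx a ha))
        (Submodule.mem_sup_right ?_)
      have := hχ ⟨x, hx⟩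
      change br x v = _ at this
      rw [this, smul_smul]
      exact Submodule.smul_mem _ _ (Submodule.mem_span_singleton_self v)
    · intro u hu u' hu'
      obtain ⟨a, ha, b, hb, rfl⟩ := Submodule.mem_sup.1 hu
      obtain ⟨c, rfl⟩ := Submodule.mem_span_singleton.1 hb
      obtain ⟨a', ha', b', hb', rfl⟩ := Submodule.mem_sup.1 hu'
      obtain ⟨c', rfl⟩ := Submodule.mem_span_singleton.1 hb'
      have h1 : B a v = 0 := hv1 a ha
      have h2 : B v a' = 0 := by rw [hBs, show B a' v = 0 from hv1 a' ha', neg_zero]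
      have h3 : B v v = 0 := by rw [hBa, halt, map_zero]
      simp only [map_add, map_smul, LinearMap.add_apply, LinearMap.smul_apply, h1, h2, h3,
        hN3 a ha a' ha', smul_zero, add_zero]
    · refine lt_of_le_of_ne le_sup_left ?_
      intro h
      apply hv3
      rw [h]
      exact Submodule.mem_sup_right (Submodule.mem_span_singleton_self v)
  have hperp' : B.orthogonal N = N := le_antisymm hperp (fun v hv u hu => hN3 u hu v hv)
  -- dimension count
  have hRtop : B.orthogonal ⊤ = R := by
    ext v
    rw [hR']
    constructor
    · intro h g
      rw [hBs, show B g v = 0 from h g trivial, neg_zero]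
    · intro h g _
      change B g v = 0
      rw [hBs, h, neg_zero]
  have hdimN := LinearMap.BilinForm.finrank_add_finrank_orthogonal hrefl N
  rw [hperp', hRtop, inf_eq_right.2 (le_sup_right.trans hN1)] at hdimN
  have hdimR : Module.finrank k R + Module.finrank k Q = Module.finrank k A := by
    have := LinearMap.finrank_range_add_finrank_ker J
    rw [LinearMap.range_eq_top.2 hJ, finrank_top] at this
    rw [hRdef]; omega
  -- weights on N/(F+R)
  set S := (F ⊔ R).comap N.subtype with hS
  have hspN : Submodule.span k {v : N | IsWt φ v.1} = ⊤ := by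
    have hsp := joint_diag φ hcomm hssφ N (fun t v hv => hN2 t t.2 v hv)
    apply Submodule.map_injective_of_injective N.injective_subtype
    rw [Submodule.map_span, Submodule.map_top, Submodule.range_subtype]
    convert hsp using 2
    ext v
    constructor
    · rintro ⟨w, hw, rfl⟩; exact ⟨w.2, hw⟩
    · rintro ⟨h1, h2⟩; exact ⟨⟨v, h1⟩, h2, rfl⟩
  obtain ⟨y, hy, b, hb⟩ := exists_basis_of_span S.mkQ S.mkQ_surjective hspN
    (ι := Fin (Module.finrank k (N ⧸ S))) (by simp)
  choose χ hχ using hy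
  have hχ' : ∀ i (x : F0), br x (y i : A) = χ i x • (y i : A) := hχ
  set Z' := Z.comap F0.subtype with hZ'
  have hker : LinearMap.ker (LinearMap.pi χ) ≤ Z' := by
    intro x hx
    have hx' : ∀ i, br x (y i : A) = 0 := by
      intro i
      rw [hχ', show χ i x = 0 from congrFun hx i, zero_smul]
    have h1 : ∀ v ∈ N, br x v ∈ R := by
      intro v hv
      have h2 : S.mkQ ⟨v, hv⟩ ∈ Submodule.span k (Set.range b) := by rw [b.span_eq]; trivial
      have h3 : Set.range b = S.mkQ '' Set.range y := by
        rw [← Set.range_comp]; congr 1; funext i; exact hb i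
      rw [h3, ← Submodule.map_span] at h2
      obtain ⟨u, hu, hu2⟩ := h2
      have h4 : (⟨v, hv⟩ : N) - u ∈ S := by
        rw [← Submodule.ker_mkQ S, LinearMap.mem_ker, map_sub, hu2, sub_self]
      have h5 : br x (u : A) = 0 := by
        have : Submodule.span k (Set.range y) ≤ LinearMap.ker ((br x) ∘ₗ N.subtype) := by
          rw [Submodule.span_le]
          rintro _ ⟨i, rfl⟩
          exact hx' i
        exact this hu
      have h6 : v - u ∈ F ⊔ R := h4
      obtain ⟨a, ha, c, hc, hac⟩ := Submodule.mem_sup.1 h6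
      have h7 : v = a + c + u := by rw [hac]; abel
      rw [h7, map_add, map_add, h5, add_zero, hF _ x.2.1 _ ha, zero_add]
      exact hxR _ x.2 _ hc
    have h2 : ∀ a, br x a ∈ N := by
      intro a
      rw [← hperp']
      intro u hu
      change B u (br x a) = 0
      rw [hBs, hinv _ x.2, hBs, (hR' _).1 (h1 u hu)]; simp
    have h3 : ∀ a, br x a ∈ R := by
      have htop := joint_diag_top φ hcomm hssφ
      intro a
      have : (⊤ : Submodule k A) ≤ R.comap (br x) := by
        rw [← htop, Submodule.span_le]
        rintro v ⟨ψ, hψ⟩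
        change br x v ∈ R
        have h4 : br x v = ψ x • v := hψ x
        have h5 := h1 _ (h2 v)
        rw [h4] at h5 ⊢
        rw [map_smul, h4] at h5
        by_cases h6 : ψ x = 0
        · rw [h6, zero_smul]; exact zero_mem _
        · have := R.smul_mem (ψ x)⁻¹ h5
          rwa [smul_smul, inv_mul_cancel₀ h6, one_smul] at this
      exact this trivial
    exact hZ _ x.2.1 h3
  have hk1 : Module.finrank k (LinearMap.ker (LinearMap.pi χ)) ≤ Module.finrank k Z := by
    refine (Submodule.finrank_mono hker).trans ?_
    have : Z'.map F0.subtype ≤ Z := Submodule.map_comap_le _ _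
    refine le_trans ?_ (Submodule.finrank_mono this)
    exact ((Submodule.equivMapOfInjective _ F0.injective_subtype Z').finrank_eq).le
  have hk2 := LinearMap.finrank_range_add_finrank_ker (LinearMap.pi χ)
  have hk3 := Submodule.finrank_le (LinearMap.range (LinearMap.pi χ))
  simp only [Module.finrank_fintype_fun_eq_card, Fintype.card_fin] at hk3
  have hk4 := Submodule.finrank_quotient_add_finrank S
  have hk5 : Module.finrank k S = Module.finrank k (F ⊔ R : Submodule k A) :=
    (Submodule.comapSubtypeEquivOfLe hN1).finrank_eq
  have hk6 := Submodule.finrank_sup_add_finrank_inf_eq F R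
  rw [← hF0] at hk6
  omega

end Lagr

section PB
variable {k : Type*} [Field k] {A : Type*} [CommRing A] [Algebra k A] {κ : Type*} [Fintype κ]

/-- Poisson derivation for commuting derivations -/
noncomputable def pb (a b : κ → Derivation k A A) (f : A) : Derivation k A A :=
  ∑ i, (a i f • b i - b i f • a i)

theorem pb_apply (a b : κ → Derivation k A A) (f g : A) :
    pb a b f g = ∑ i, (a i f * b i g - b i f * a i g) := by
  rw [pb, sum_der_apply]
  simp [Derivation.sub_apply, Derivation.smul_apply]

theorem pb_skew (a b : κ → Derivation k A A) (f g : A) : pb a b f g = - pb a b g f := by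
  rw [pb_apply, pb_apply, ← Finset.sum_neg_distrib]
  exact Finset.sum_congr rfl fun _ _ => by ring

theorem pb_self (a b : κ → Derivation k A A) (f : A) : pb a b f f = 0 := by
  rw [pb_apply]
  exact Finset.sum_eq_zero fun _ _ => by ring

theorem pb_add (a b : κ → Derivation k A A) (f g : A) : pb a b (f + g) = pb a b f + pb a b g := by
  refine Derivation.ext fun h => ?_
  rw [Derivation.add_apply, pb_skew, map_add, pb_skew a b f, pb_skew a b g]; ring

theorem pb_smul (a b : κ → Derivation k A A) (c : k) (g : A) : pb a b (c • g) = c • pb a b g := by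
  refine Derivation.ext fun h => ?_
  rw [Derivation.smul_apply, pb_skew, Derivation.map_smul, pb_skew a b g, smul_neg]

/-- `pb` as a linear map -/
noncomputable def pbL (a b : κ → Derivation k A A) : A →ₗ[k] Derivation k A A where
  toFun := pb a b
  map_add' := pb_add a b
  map_smul' := pb_smul a b

/-- abstract range of a linear map into derivations -/
def derRange (H : A →ₗ[k] Derivation k A A)
    (h : ∀ f g, ∃ u, H u = ⁅H f, H g⁆) : LieSubalgebra k (Derivation k A A) where
  toSubmodule := LinearMap.range H
  lie_mem' := by
    rintro _ _ ⟨f, rfl⟩ ⟨g, rfl⟩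
    exact h f g

/-- abstract evaluation -/
def brL (H : A →ₗ[k] Derivation k A A) : A →ₗ[k] A →ₗ[k] A where
  toFun := fun f => (H f).toLinearMap
  map_add' := fun f g => by rw [map_add]; rfl
  map_smul' := fun c g => by rw [map_smul]; rfl

theorem pb_mul (a b : κ → Derivation k A A) (f g h : A) :
    pb a b (f * g) h = f * pb a b g h + g * pb a b f h := by
  rw [pb_skew, Derivation.leibniz, pb_skew a b g, pb_skew a b f, smul_eq_mul, smul_eq_mul]; ring

theorem pb_der (a b : κ → Derivation k A A) (δ : Derivation k A A)
    (ha : ∀ i f, δ (a i f) = a i (δ f)) (hb : ∀ i f, δ (b i f) = b i (δ f)) (f g : A) :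
    δ (pb a b f g) = pb a b (δ f) g + pb a b f (δ g) := by
  rw [pb_apply, pb_apply, pb_apply, map_sum, ← Finset.sum_add_distrib]
  refine Finset.sum_congr rfl fun i _ => ?_
  rw [map_sub, Derivation.leibniz, Derivation.leibniz, ha, hb, ha, hb]
  simp only [smul_eq_mul]; ring

theorem pb_jac (a b : κ → Derivation k A A) (haa : ∀ i j f, a i (a j f) = a j (a i f))
    (hab : ∀ i j f, a i (b j f) = b j (a i f)) (hbb : ∀ i j f, b i (b j f) = b j (b i f))
    (f g h : A) :
    pb a b f (pb a b g h) = pb a b (pb a b f g) h + pb a b g (pb a b f h) := by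
  have ka : ∀ i u v, pb a b u (a i v) = a i (pb a b u v) - pb a b (a i u) v := by
    intro i u v
    rw [pb_der a b (a i) (fun j f => haa i j f) (fun j f => hab i j f)]; ring
  have kb : ∀ i u v, pb a b u (b i v) = b i (pb a b u v) - pb a b (b i u) v := by
    intro i u v
    rw [pb_der a b (b i) (fun j f => (hab j i f).symm) (fun j f => hbb i j f)]; ring
  set U : κ → κ → A := fun i j => a i (a j f) * b j g * b i h + b i (b j f) * a j g * a i h
    + a i (b j f) * (b i g * a j h - a j g * b i h) with hU
  have h0 : ∑ i, (pb a b (a i f) g * b i h + a i g * pb a b (b i f) h - pb a b (b i f) g * a i h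
      - b i g * pb a b (a i f) h) = 0 := by
    have : ∀ i, (pb a b (a i f) g * b i h + a i g * pb a b (b i f) h - pb a b (b i f) g * a i h
      - b i g * pb a b (a i f) h) = ∑ j, (U i j - U j i) := by
      intro i
      simp only [pb_apply, Finset.sum_mul, Finset.mul_sum, ← Finset.sum_add_distrib,
        ← Finset.sum_sub_distrib]
      refine Finset.sum_congr rfl fun j _ => ?_
      simp only [hU]
      rw [haa j i, hbb j i, hab j i, hab i j]
      ring
    simp only [this, Finset.sum_sub_distrib]
    rw [Finset.sum_comm, sub_self]
  have h1 : pb a b f (pb a b g h) = pb a b (pb a b f g) h + pb a b g (pb a b f h)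
      - ∑ i, (pb a b (a i f) g * b i h + a i g * pb a b (b i f) h - pb a b (b i f) g * a i h
      - b i g * pb a b (a i f) h) := by
    rw [pb_apply a b g h, pb_apply a b (pb a b f g) h, pb_apply a b g (pb a b f h), map_sum,
      ← Finset.sum_add_distrib, ← Finset.sum_sub_distrib]
    refine Finset.sum_congr rfl fun i _ => ?_
    rw [map_sub, Derivation.leibniz, Derivation.leibniz]
    simp only [smul_eq_mul, ka, kb]
    ring
  rw [h1, h0, sub_zero]

end PB

section Ham
variable {p : ℕ} {k : Type*} [Field k] [CharP k p] {n r : ℕ}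

/-- position indices -/
def qi (hn : 2 * r ≤ n) (i : Fin r) : Fin n := ⟨i.1, by have := i.isLt; omega⟩
/-- momentum indices -/
def si (hn : 2 * r ≤ n) (i : Fin r) : Fin n := ⟨i.1 + r, by have := i.isLt; omega⟩

theorem qi_inj (hn : 2 * r ≤ n) {i j : Fin r} : qi hn i = qi hn j ↔ i = j := by
  simp [qi, Fin.ext_iff]
theorem si_inj (hn : 2 * r ≤ n) {i j : Fin r} : si hn i = si hn j ↔ i = j := by
  simp [si, Fin.ext_iff]
theorem qi_ne_si (hn : 2 * r ≤ n) (i j : Fin r) : qi hn i ≠ si hn j := by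
  have := i.2
  simp [qi, si, Fin.ext_iff]; omega

theorem idx_cases (hn : 2 * r ≤ n) (c : Fin n) (hc : c.1 < 2 * r) :
    (∃ i, c = qi hn i) ∨ ∃ i, c = si hn i := by
  by_cases h : c.1 < r
  · exact Or.inl ⟨⟨c.1, h⟩, rfl⟩
  · right
    exact ⟨⟨c.1 - r, by omega⟩, Fin.ext (by simp [si]; omega)⟩

/-- Hamiltonian fields -/
noncomputable def ham (hn : 2 * r ≤ n) (f : TruncPoly p k n) : WittAlg p k n :=
  pb (fun i => truncPD p k n (qi hn i)) (fun i => truncPD p k n (si hn i)) f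

theorem ham_q (hn : 2 * r ≤ n) (f : TruncPoly p k n) (i : Fin r) :
    ham hn f (truncX p k n (qi hn i)) = - truncPD p k n (si hn i) f := by
  rw [ham, pb_apply, Finset.sum_eq_single i]
  · rw [pd_X, pd_X, if_pos rfl, if_neg (qi_ne_si hn _ _).symm]; ring
  · intro j _ hj
    rw [pd_X, pd_X, if_neg (qi_ne_si hn _ _).symm, if_neg (by rwa [qi_inj])]; ring
  · simp

theorem ham_s (hn : 2 * r ≤ n) (f : TruncPoly p k n) (i : Fin r) :
    ham hn f (truncX p k n (si hn i)) = truncPD p k n (qi hn i) f := by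
  rw [ham, pb_apply, Finset.sum_eq_single i]
  · rw [pd_X, pd_X, if_pos rfl, if_neg (qi_ne_si hn _ _)]; ring
  · intro j _ hj
    rw [pd_X, pd_X, if_neg (by rwa [si_inj]), if_neg (qi_ne_si hn _ _)]; ring
  · simp

theorem ham_o (hn : 2 * r ≤ n) (f : TruncPoly p k n) (c : Fin n) (hc : 2 * r ≤ c.1) :
    ham hn f (truncX p k n c) = 0 := by
  rw [ham, pb_apply]
  apply Finset.sum_eq_zero
  intro j _
  have := j.2
  rw [pd_X, pd_X, if_neg, if_neg]
  · ring
  · intro h; have := congrArg Fin.val h; simp [qi] at this; omega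
  · intro h; have := congrArg Fin.val h; simp [si] at this; omega

theorem ham_jac (hn : 2 * r ≤ n) (f g h : TruncPoly p k n) :
    ham hn f (ham hn g h) = ham hn (ham hn f g) h + ham hn g (ham hn f h) :=
  pb_jac (fun i => truncPD p k n (qi hn i)) (fun i => truncPD p k n (si hn i)) (fun _ _ _ => pd_comm _ _ _) (fun _ _ _ => pd_comm _ _ _) (fun _ _ _ => pd_comm _ _ _)
    f g h

theorem ham_skew (hn : 2 * r ≤ n) (f g : TruncPoly p k n) : ham hn f g = - ham hn g f :=
  pb_skew _ _ f g

theorem ham_self (hn : 2 * r ≤ n) (f : TruncPoly p k n) : ham hn f f = 0 := pb_self _ _ f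

/-- `ham` as a linear map -/
noncomputable def hamL (hn : 2 * r ≤ n) : TruncPoly p k n →ₗ[k] WittAlg p k n :=
  pbL (fun i => truncPD p k n (qi hn i)) (fun i => truncPD p k n (si hn i))

theorem hamL_apply (hn : 2 * r ≤ n) (f : TruncPoly p k n) : hamL hn f = ham hn f := rfl

theorem ham_lie (hn : 2 * r ≤ n) (f g : TruncPoly p k n) :
    ⁅ham hn f, ham hn g⁆ = ham hn (ham hn f g) := by
  refine Derivation.ext fun h => ?_
  rw [Derivation.commutator_apply, ham_jac]; ring

theorem pb_comm_pd (hn : 2 * r ≤ n) (c : Fin n) (f g : TruncPoly p k n) :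
    truncPD p k n c (ham hn f g) = ham hn (truncPD p k n c f) g + ham hn f (truncPD p k n c g) :=
  pb_der (fun i => truncPD p k n (qi hn i)) (fun i => truncPD p k n (si hn i)) (truncPD p k n c) (fun _ _ => pd_comm _ _ _) (fun _ _ => pd_comm _ _ _) f g

end Ham

theorem rank_nullity_comap {k V W : Type*} [Field k] [AddCommGroup V] [Module k V]
    [AddCommGroup W] [Module k W] [FiniteDimensional k V] (H : V →ₗ[k] W) (IT : Submodule k W)
    (h : IT ≤ LinearMap.range H) :
    Module.finrank k IT + Module.finrank k (LinearMap.ker H) = Module.finrank k (IT.comap H) := by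
  have h3 := LinearMap.finrank_range_add_finrank_ker (H.domRestrict (IT.comap H))
  have h4 : LinearMap.range (H.domRestrict (IT.comap H)) = IT := by
    apply le_antisymm
    · rintro _ ⟨⟨f, hf⟩, rfl⟩
      exact hf
    · intro x hx
      obtain ⟨f, rfl⟩ := h hx
      exact ⟨⟨f, hx⟩, rfl⟩
  have h5 : Module.finrank k (LinearMap.ker (H.domRestrict (IT.comap H)))
      = Module.finrank k (LinearMap.ker H) := by
    have h6 : LinearMap.ker H ≤ IT.comap H := fun x hx => by
      change H x ∈ IT
      rw [LinearMap.mem_ker.1 hx]; exact zero_mem _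
    have h7 : LinearMap.ker (H.domRestrict (IT.comap H))
      = (LinearMap.ker H).comap (IT.comap H).subtype := rfl
    rw [h7]
    exact (Submodule.comapSubtypeEquivOfLe h6).finrank_eq
  rw [h4, h5] at h3
  exact h3

theorem rank_nullity_der {k A : Type*} [Field k] [CommRing A] [Algebra k A]
    [FiniteDimensional k A] (H : A →ₗ[k] Derivation k A A) (IT : Submodule k (Derivation k A A))
    (h : IT ≤ LinearMap.range H) :
    Module.finrank k IT + Module.finrank k (LinearMap.ker H) = Module.finrank k (IT.comap H) :=
  rank_nullity_comap H IT h

section HType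
variable {p : ℕ} {k : Type*} [Field k] [CharP k p] {r : ℕ}
variable {L : Type*} [LieRing L] [LieAlgebra k L] {op : L → L}

theorem DH_eq (f : TruncPoly p k (2 * r)) : DH p k r f = ham le_rfl f := rfl

/-- the range of `DH` -/
noncomputable def hamRange (p : ℕ) (k : Type*) [Field k] [CharP k p] (r : ℕ) :
    LieSubalgebra k (WittAlg p k (2 * r)) :=
  derRange (hamL le_rfl) fun f g => ⟨ham le_rfl f g, (ham_lie _ f g).symm⟩

theorem hamAlg_range {D : WittAlg p k (2 * r)} (h : D ∈ hamiltonianAlg p k r) :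
    ∃ f, D = ham le_rfl f := by
  have h2 : hamiltonianAmbient p k r ≤ hamRange p k r := LieSubalgebra.lieSpan_le.2 (by
    rintro _ ⟨f, rfl⟩; exact ⟨f, rfl⟩)
  obtain ⟨f, hf⟩ := h2 (derivedSub_le _ h)
  exact ⟨f, hf.symm⟩

theorem mem_hamAlg {f g h : TruncPoly p k (2 * r)} {s : k} (hs : s ≠ 0) (hfg : ham le_rfl f g = s • h) :
    ham le_rfl h ∈ hamiltonianAlg p k r := by
  refine mem_derived (x := ham le_rfl f) (y := ham le_rfl g)
    (LieSubalgebra.subset_lieSpan ⟨f, rfl⟩) (LieSubalgebra.subset_lieSpan ⟨g, rfl⟩) hs ?_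
  rw [ham_lie, hfg]
  exact (hamL le_rfl).map_smul s h

theorem upper_H [IsAlgClosed k] [FiniteDimensional k L] (hp : p.Prime) (hop : IsPMap p k op)
    (ι : L →ₗ⁅k⁆ WittAlg p k (2 * r)) (hinj : Function.Injective ι)
    (hio : ∀ x, ι (op x) = derPow hp (ι x))
    (hran : ∀ x, ∃ f, ι x = ham le_rfl f)
    (t : LieSubalgebra k L) (ht : IsTorus k op t) : Module.finrank k t ≤ r := by
  set H : TruncPoly p k (2*r) →ₗ[k] WittAlg p k (2*r) := hamL le_rfl with hH
  set IT : Submodule k (WittAlg p k (2*r)) := t.toSubmodule.map (ι : L →ₗ[k] WittAlg p k (2*r)) with hIT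
  set F := IT.comap H with hF
  set br : TruncPoly p k (2*r) →ₗ[k] TruncPoly p k (2*r) →ₗ[k] TruncPoly p k (2*r) :=
    brL H with hbr
  have hbra : ∀ f g, br f g = ham le_rfl f g := fun f g => rfl
  have hFt : ∀ f ∈ F, ∃ x : t, ι x = ham le_rfl f := by
    rintro f ⟨x, hx, hx2⟩
    exact ⟨⟨x, hx⟩, hx2⟩
  have hpss : ∀ f ∈ F, PSS p (br f) := by
    intro f hf
    obtain ⟨x, hx⟩ := hFt f hf
    have := actA_pss hp ι hio ht x
    have e : actA ι x = br f := LinearMap.ext fun g => by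
      rw [actA_apply, hx]; rfl
    rwa [e] at this
  have key := lagrangian br (fun f => ham_self _ f) (fun f g h => ham_jac _ f g h)
    (eps hp.ne_zero).toLinearMap (linJ hp) (linJ_surj hp) ?_ F ?_ (fun f hf => (hpss f hf).isSemisimple)
    (LinearMap.ker H) ?_
  · have h1 : Module.finrank k t = Module.finrank k IT :=
      (Submodule.equivMapOfInjective (ι : L →ₗ[k] WittAlg p k (2*r)) hinj t.toSubmodule).finrank_eq
    have h2 : Module.finrank k IT + Module.finrank k (LinearMap.ker H) = Module.finrank k F := by
      refine rank_nullity_der (k := k) (A := TruncPoly p k (2*r)) H IT ?_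
      rintro _ ⟨x, hx, rfl⟩
      obtain ⟨f, hf⟩ := hran x
      exact ⟨f, hf.symm⟩
    have h3 : Module.finrank k (Fin (2*r) → k) = 2 * r := by simp
    omega
  · intro f
    constructor
    · intro h g
      change eps hp.ne_zero (ham le_rfl f g) = 0
      rw [ham, pb_apply, map_sum]
      apply Finset.sum_eq_zero
      intro i _
      have h1 := congrFun h (qi le_rfl i)
      have h2 := congrFun h (si le_rfl i)
      rw [linJ_apply] at h1 h2
      rw [map_sub, map_mul, map_mul, h1, h2]; simp
    · intro h
      funext c
      rw [linJ_apply]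
      rcases idx_cases le_rfl c c.2 with ⟨i, rfl⟩ | ⟨i, rfl⟩
      · have := h (truncX p k _ (si le_rfl i))
        rw [hbra, ham_s] at this
        exact this
      · have := h (truncX p k _ (qi le_rfl i))
        rw [hbra, ham_q, map_neg, neg_eq_zero] at this
        exact this
  · intro f hf g hg
    obtain ⟨x, hx⟩ := hFt f hf
    obtain ⟨y, hy⟩ := hFt g hg
    have h := torus_abelian hp.two_le hop ht x.2 y.2
    have h2 : ⁅ι x, ι y⁆ = 0 := by rw [← LieHom.map_lie, h, map_zero]
    rw [hx, hy, ham_lie] at h2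
    apply (hpss f hf).ker_sq hp.two_le
    rw [hbra, hbra, ham_skew, h2]; simp
  · intro f hf h
    obtain ⟨x, hx⟩ := hFt f hf
    obtain ⟨_, y, hy, b, hb⟩ := weight_sys hp hop ι hio ht
    choose χ hχ using hy
    change ham le_rfl f = 0
    rw [← hx]
    apply der_kill hp y b hb
    intro j
    have h1 : ι x (y j) = χ j x • y j := hχ j x
    have h2 := h (y j)
    rw [hbra, ← hx, h1, map_smul, ← hb] at h2
    rw [h1, (smul_eq_zero.1 h2).resolve_right (b.ne_zero j), zero_smul]

end HType

section Ham2
variable {p : ℕ} {k : Type*} [Field k] [CharP k p] {n r : ℕ}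

/-- weight of the torus element -/
noncomputable def qsw (k : Type*) [Field k] (hn : 2 * r ≤ n) (j : Fin r) : Fin n → k :=
  fun c => if c = si hn j then 1 else if c = qi hn j then -1 else 0

theorem qsw_s (hn : 2 * r ≤ n) (j i : Fin r) : qsw k hn j (si hn i) = if i = j then 1 else 0 := by
  simp [qsw, si_inj, (qi_ne_si hn _ _).symm]

theorem qsw_q (hn : 2 * r ≤ n) (j i : Fin r) : qsw k hn j (qi hn i) = if i = j then -1 else 0 := by
  simp [qsw, qi_inj, (qi_ne_si hn _ _)]

theorem ham_qs (hn : 2 * r ≤ n) (j : Fin r) :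
    ham hn (truncX p k n (qi hn j) * truncX p k n (si hn j)) = tor (qsw k hn j) := by
  apply der_ext
  intro c
  rw [tor_X]
  by_cases hc : c.1 < 2 * r
  · rcases idx_cases hn c hc with ⟨i, rfl⟩ | ⟨i, rfl⟩
    · rw [ham_q, Derivation.leibniz, pd_X, pd_X, qsw_q, if_neg (qi_ne_si hn _ _).symm]
      by_cases h : i = j
      · subst h; simp
      · rw [if_neg h, if_neg (by rwa [si_inj])]; simp
    · rw [ham_s, Derivation.leibniz, pd_X, pd_X, qsw_s, if_neg (qi_ne_si hn _ _)]
      by_cases h : i = j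
      · subst h; simp
      · rw [if_neg h, if_neg (by rwa [qi_inj])]; simp
  · rw [ham_o hn _ c (by omega), qsw, if_neg, if_neg, zero_smul]
    · intro h; have := congrArg Fin.val h; have := j.2; simp [qi] at *; omega
    · intro h; have := congrArg Fin.val h; have := j.2; simp [si] at *; omega

theorem wt_tau (hp : p.Prime) (hn : 2 * r ≤ n) (j : Fin r) (i : ℕ) (hi : i ≤ r) :
    tor (qsw k hn j) (odoT p (mX p k n r) i) = (if j.1 < i then (1:k) else 0) • odoT p (mX p k n r) i := by
  rw [tor_odoT hp (by omega) _ hi]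
  congr 1
  have h1 : ∀ l ∈ Finset.range i, (if h : l < n then qsw k hn j ⟨l, h⟩ else 0)
      = if l = j.1 then (-1 : k) else 0 := by
    intro l hl
    rw [Finset.mem_range] at hl
    rw [dif_pos (by omega)]
    have := qsw_q (k := k) hn j ⟨l, by omega⟩
    simp only [Fin.ext_iff] at this
    exact this
  rw [Finset.sum_congr rfl h1, Finset.sum_ite_eq']
  split_ifs with h2 h3 h3
  · simp
  · simp at h2; omega
  · simp at h2; omega
  · simp

theorem pd_tau_s (hn : 2 * r ≤ n) (j : Fin r) (i : ℕ) (hi : i ≤ r) :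
    truncPD p k n (si hn j) (odoT p (mX p k n r) i) = 0 :=
  pd_odoT (by omega) i hi _ (by simp [si]; omega)

theorem wt_tau_s (hp : p.Prime) (hn : 2 * r ≤ n) (j l : Fin r) (i : ℕ) (hi : i ≤ r) :
    tor (qsw k hn j) (odoT p (mX p k n r) i * truncX p k n (si hn l))
      = ((if j.1 < i then (1:k) else 0) + if l = j then 1 else 0) •
        (odoT p (mX p k n r) i * truncX p k n (si hn l)) := by
  refine wt_mul (wt_tau hp hn j i hi) ?_
  rw [tor_X, qsw_s]

theorem ham_kill_s (hn : 2 * r ≤ n) {h : TruncPoly p k n} (hh : ∀ i, truncPD p k n (si hn i) h = 0)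
    (c : Fin n) : ham hn h (ham hn h (truncX p k n c)) = 0 := by
  by_cases hc : c.1 < 2 * r
  · rcases idx_cases hn c hc with ⟨i, rfl⟩ | ⟨i, rfl⟩
    · rw [ham_q, hh, neg_zero, map_zero]
    · rw [ham_s, ham, pb_apply]
      apply Finset.sum_eq_zero
      intro j _
      rw [hh, pd_comm, hh]; simp
  · rw [ham_o hn _ c (by omega), map_zero]

end Ham2

section HLow
variable {p : ℕ} {k : Type*} [Field k] [CharP k p] {r : ℕ}
variable {L : Type*} [LieRing L] [LieAlgebra k L] {op : L → L}

theorem ne_two (hp : p.Prime) (hp3 : 3 < p) : (2 : k) ≠ 0 := by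
  intro h
  have : ((2 : ℕ) : k) = 0 := by exact_mod_cast h
  rw [CharP.cast_eq_zero_iff k p] at this
  have := Nat.le_of_dvd (by norm_num) this
  omega

theorem mem_ham_q (i : Fin r) : ham le_rfl (truncX p k (2*r) (qi le_rfl i)) ∈ hamiltonianAlg p k r := by
  refine mem_hamAlg (f := truncX p k (2*r) (qi le_rfl i) * truncX p k (2*r) (si le_rfl i))
    (g := truncX p k (2*r) (qi le_rfl i)) (s := -1) (by simp) ?_
  rw [ham_qs, tor_X, qsw_q, if_pos rfl]

theorem mem_ham_s (i : Fin r) : ham le_rfl (truncX p k (2*r) (si le_rfl i)) ∈ hamiltonianAlg p k r := by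
  refine mem_hamAlg (f := truncX p k (2*r) (qi le_rfl i) * truncX p k (2*r) (si le_rfl i))
    (g := truncX p k (2*r) (si le_rfl i)) (s := 1) (by simp) ?_
  rw [ham_qs, tor_X, qsw_s, if_pos rfl]

theorem mem_ham_qs (hp : p.Prime) (hp3 : 3 < p) (i : Fin r) :
    tor (qsw k le_rfl i) ∈ hamiltonianAlg p k r := by
  rw [← ham_qs]
  refine mem_hamAlg (f := truncX p k (2*r) (qi le_rfl i) ^ 2)
    (g := truncX p k (2*r) (si le_rfl i) ^ 2) (s := 4) ?_ ?_
  · have := ne_two (k := k) hp hp3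
    have h4 : (4 : k) = 2 * 2 := by norm_num
    rw [h4]; exact mul_ne_zero this this
  · rw [Derivation.leibniz_pow, ham_s, Derivation.leibniz_pow, pd_X, if_pos rfl]
    simp only [Nat.add_one_sub_one, pow_one, smul_eq_mul, mul_one, nsmul_eq_mul]
    rw [← Nat.cast_ofNat (R := k), Nat.cast_smul_eq_nsmul, nsmul_eq_mul]
    push_cast
    ring

theorem ham_q_eq (i : Fin r) : ham le_rfl (truncX p k (2*r) (qi le_rfl i)) = truncPD p k (2*r) (si le_rfl i) := by
  apply der_ext
  intro c
  rw [pd_X]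
  rcases idx_cases le_rfl c c.2 with ⟨j, rfl⟩ | ⟨j, rfl⟩
  · rw [ham_q, pd_X, if_neg (qi_ne_si _ _ _).symm, if_neg (qi_ne_si _ _ _).symm]; simp
  · rw [ham_s, pd_X]; simp only [qi_inj, si_inj, eq_comm]

theorem ham_s_eq (i : Fin r) : ham le_rfl (truncX p k (2*r) (si le_rfl i)) = -truncPD p k (2*r) (qi le_rfl i) := by
  apply der_ext
  intro c
  rw [Derivation.neg_apply, pd_X]
  rcases idx_cases le_rfl c c.2 with ⟨j, rfl⟩ | ⟨j, rfl⟩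
  · rw [ham_q, pd_X]; simp only [qi_inj, si_inj, eq_comm]
  · rw [ham_s, pd_X, if_neg (qi_ne_si _ _ _), if_neg (qi_ne_si _ _ _)]; simp

theorem cent_H (hp : p.Prime) (hp3 : 3 < p) (e : L ≃ₗ⁅k⁆ hamiltonianAlg p k r) (E : WittAlg p k (2*r))
    (h : ∀ x, ⁅E, subIota e x⁆ = 0) : E = 0 := by
  have h' : ∀ D ∈ hamiltonianAlg p k r, ⁅E, D⁆ = 0 := fun D hD => by
    have := h (e.symm ⟨D, hD⟩)
    rwa [subIota_symm] at this
  have hc := const_of_comm_pd hp (E := E) (fun i => h' _ (by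
    rcases idx_cases le_rfl i i.2 with ⟨j, rfl⟩ | ⟨j, rfl⟩
    · rw [← neg_neg (truncPD p k (2*r) _), ← ham_s_eq]
      exact neg_mem (mem_ham_s j)
    · rw [← ham_q_eq]; exact mem_ham_q j))
  apply der_ext
  intro c
  obtain ⟨s, hs⟩ := hc c
  have key : ∀ w : Fin (2*r) → k, ⁅E, tor w⁆ = 0 → w c ≠ 0 → E (truncX p k (2*r) c) = 0 := by
    intro w hw hwc
    have := congrArg (fun D => D (truncX p k (2*r) c)) hw
    simp only [Derivation.commutator_apply, tor_X, Derivation.map_smul] at this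
    rw [hs, Derivation.map_algebraMap, sub_zero] at this
    rw [hs]
    exact (smul_eq_zero.1 this).resolve_left hwc
  rcases idx_cases le_rfl c c.2 with ⟨j, rfl⟩ | ⟨j, rfl⟩
  · exact key _ (h' _ (mem_ham_qs hp hp3 j)) (by rw [qsw_q]; simp)
  · exact key _ (h' _ (mem_ham_qs hp hp3 j)) (by rw [qsw_s]; simp)

theorem lower_H (hp : p.Prime) (hp3 : 3 < p) [IsAlgClosed k] (hs : LieAlgebra.IsSimple k L)
    (hop : IsPMap p k op)
    {V : Type*} [AddCommGroup V] [Module k V] [LieRingModule L V] [LieModule k L V]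
    [FiniteDimensional k V] (hV : IsRestrictedModule p k op V)
    (hnt : ¬ LieModule.IsTrivial L V) (hr : 1 ≤ r) (e : L ≃ₗ⁅k⁆ hamiltonianAlg p k r) :
    p ^ r - 1 ≤ Module.finrank k V := by
  set Y := mX p k (2*r) r with hY
  set z0 : Fin r := ⟨0, hr⟩
  set a : WittAlg p k (2*r) := - ∑ i : Fin r, ham le_rfl (odoT p Y i * truncX p k (2*r) (si le_rfl i)) with ha
  set b : WittAlg p k (2*r) := - ham le_rfl (odoT p Y r * truncX p k (2*r) (si le_rfl z0)) with hb
  have ham1 : ∀ (i : Fin r) (f : TruncPoly p k (2*r)) (s : k), s ≠ 0 → tor (qsw k le_rfl i) f = s • f →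
      ham le_rfl f ∈ hamiltonianAlg p k r := by
    intro i f s hs hf
    refine mem_hamAlg (f := truncX p k (2*r) (qi le_rfl i) * truncX p k (2*r) (si le_rfl i))
      (g := f) (s := s) hs ?_
    rw [ham_qs, hf]
  have ham' : a ∈ hamiltonianAlg p k r := by
    apply neg_mem
    apply (hamiltonianAlg p k r).toSubmodule.sum_mem
    intro i _
    refine ham1 i _ 1 one_ne_zero ?_
    rw [hY, wt_tau_s hp le_rfl i i i i.2.le]
    simp
  have hbm : b ∈ hamiltonianAlg p k r := by
    apply neg_mem
    refine ham1 z0 _ 2 (ne_two hp hp3) ?_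
    rw [hY, wt_tau_s hp le_rfl z0 z0 r le_rfl]
    rw [if_pos (show z0.1 < r from hr), if_pos rfl]
    norm_num
  have hval : ∀ (l i : Fin r) (m : ℕ), m ≤ r → ham le_rfl (odoT p Y m * truncX p k (2*r) (si le_rfl l))
      (truncX p k (2*r) (qi le_rfl i)) = if l = i then - odoT p Y m else 0 := by
    intro l i m hm
    rw [ham_q, Derivation.leibniz, pd_tau_s le_rfl _ _ hm, pd_X]
    by_cases h : i = l
    · subst h; simp
    · rw [if_neg (by rwa [si_inj]), if_neg (Ne.symm h)]; simp
  refine lower_cartan hp hs hop hV hnt (subIota e) (subIota_inj e) (cent_H hp hp3 e) r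
    (by omega) Y ?_ (e.symm ⟨a, ham'⟩) (e.symm ⟨b, hbm⟩) ?_ ?_ ?_ ?_
  · intro i hi
    rw [hY, mX_of_lt hi (by omega)]; exact truncX_pow _
  · intro i hi
    rw [subIota_symm, ha, Derivation.neg_apply, sum_der_apply]
    have : Y i = truncX p k (2*r) (qi le_rfl ⟨i, hi⟩) := mX_of_lt hi _
    rw [this, Finset.sum_eq_single ⟨i, hi⟩]
    · rw [hval _ _ _ hi.le, if_pos rfl, neg_neg]
    · intro j _ hj
      rw [hval _ _ _ j.2.le, if_neg hj]
    · simp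
  · have : Y 0 = truncX p k (2*r) (qi le_rfl z0) := mX_of_lt hr _
    rw [subIota_symm, hb, Derivation.neg_apply, this, hval _ _ _ le_rfl, if_pos rfl, neg_neg]
  · intro i hi
    rw [subIota_symm]
    by_cases h : i < r
    · have : Y i = truncX p k (2*r) (qi le_rfl ⟨i, h⟩) := mX_of_lt h _
      rw [this, hb, Derivation.neg_apply, hval _ _ _ le_rfl, if_neg, neg_zero]
      intro h; have := congrArg Fin.val h; simp [z0] at this; omega
    · rw [hY, mX, if_neg h, map_zero]
  · intro E hE
    obtain ⟨h, hh⟩ := hamAlg_range (subIota_mem e E)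
    apply derPow_zero_of_sq
    intro c
    rw [hh]
    apply ham_kill_s
    intro i
    have h1 := hE i i.2
    have : Y i = truncX p k (2*r) (qi le_rfl i) := mX_of_lt i.2 _
    rw [hh, this, ham_q] at h1
    exact neg_eq_zero.1 h1

theorem main_H [IsAlgClosed k] [FiniteDimensional k L] (hp : p.Prime) (hp3 : 3 < p)
    (hs : LieAlgebra.IsSimple k L) (hop : IsPMap p k op)
    {V : Type*} [AddCommGroup V] [Module k V] [LieRingModule L V] [LieModule k L V]
    [FiniteDimensional k V] (hV : IsRestrictedModule p k op V)
    (hdim : Module.finrank k V < p ^ (mu k op) - 1) (hn : 1 ≤ r) (e : L ≃ₗ⁅k⁆ hamiltonianAlg p k r) :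
    LieModule.IsTrivial L V :=
  finish hp hdim (upper_H hp hop (subIota e) (subIota_inj e)
    (iota_op hp hop (subIota e) (cent_H hp hp3 e))
    (fun x => hamAlg_range (subIota_mem e x)))
    (fun hnt => lower_H hp hp3 hs hop hV hnt hn e)
end HLow

section KD
variable {k : Type*} [Field k] {A : Type*} [CommRing A] [Algebra k A] {κ : Type*} [Fintype κ]

/-- abstract contact field -/
noncomputable def kd (a b : κ → Derivation k A A) (c Eu : Derivation k A A) (f : A) : Derivation k A A :=
  pb a b f + c f • Eu + (2 * f - Eu f) • c

theorem kd_apply (a b : κ → Derivation k A A) (c Eu : Derivation k A A) (f g : A) :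
    kd a b c Eu f g = pb a b f g + c f * Eu g + (2 * f - Eu f) * c g := rfl

/-- linear version -/
noncomputable def kdL (a b : κ → Derivation k A A) (c Eu : Derivation k A A) :
    A →ₗ[k] Derivation k A A where
  toFun := kd a b c Eu
  map_add' := fun f g => by
    refine Derivation.ext fun h => ?_
    rw [Derivation.add_apply, kd_apply, kd_apply, kd_apply, pb_add, Derivation.add_apply, map_add,
      map_add]; ring
  map_smul' := fun s g => by
    refine Derivation.ext fun h => ?_
    rw [RingHom.id_apply, Derivation.smul_apply, kd_apply, kd_apply, pb_smul, Derivation.smul_apply,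
      Derivation.map_smul, Derivation.map_smul, smul_add, smul_add, smul_mul_assoc, ← smul_mul_assoc s (2 * g - _),
      smul_sub, mul_smul_comm]

/-- contact bracket -/
noncomputable def kbr (a b : κ → Derivation k A A) (c Eu : Derivation k A A) : A →ₗ[k] A →ₗ[k] A :=
  brL (kdL a b c Eu) - (2 : k) • (LinearMap.mul k A ∘ₗ c.toLinearMap)

theorem kbr_apply (a b : κ → Derivation k A A) (c Eu : Derivation k A A) (f g : A) :
    kbr a b c Eu f g = pb a b f g + c f * Eu g + (2 * f - Eu f) * c g - 2 * (c f * g) := by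
  have : kbr a b c Eu f g = kd a b c Eu f g - (2 : k) • (c f * g) := rfl
  rw [this, kd_apply, two_smul, two_mul (c f * g)]

theorem kbr_kd (a b : κ → Derivation k A A) (c Eu : Derivation k A A) (f g : A) :
    kbr a b c Eu f g = kd a b c Eu f g - 2 * (c f * g) := by
  rw [kbr_apply, kd_apply]

theorem kbr_self (a b : κ → Derivation k A A) (c Eu : Derivation k A A) (f : A) :
    kbr a b c Eu f f = 0 := by
  rw [kbr_apply, pb_self]; ring

variable (a b : κ → Derivation k A A) (c Eu : Derivation k A A)

theorem Eu_pb (hEa : ∀ i f, Eu (a i f) = a i (Eu f) - a i f)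
    (hEb : ∀ i f, Eu (b i f) = b i (Eu f) - b i f) (f g : A) : Eu (pb a b f g) = pb a b (Eu f) g + pb a b f (Eu g) - 2 * pb a b f g := by
  rw [pb_apply, pb_apply, pb_apply, map_sum, Finset.mul_sum, ← Finset.sum_add_distrib, ← Finset.sum_sub_distrib]
  refine Finset.sum_congr rfl fun i _ => ?_
  rw [map_sub, Derivation.leibniz, Derivation.leibniz, hEa, hEb, hEa, hEb]
  simp only [smul_eq_mul]; ring

theorem der_two (D : Derivation k A A) : D (2 : A) = 0 := by
  have := D.map_natCast 2
  simpa using this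

theorem pb_two (g : A) : pb a b 2 g = 0 := by
  rw [pb_skew, der_two, neg_zero]

theorem pb_sub' (f g h : A) : pb a b (f - g) h = pb a b f h - pb a b g h := by
  rw [pb_skew, map_sub, pb_skew a b f, pb_skew a b g]; ring

theorem pb_add' (f g h : A) : pb a b (f + g) h = pb a b f h + pb a b g h := by
  rw [pb_add]; rfl

theorem kd_lie
    (haa : ∀ i j f, a i (a j f) = a j (a i f))
    (hab : ∀ i j f, a i (b j f) = b j (a i f)) (hbb : ∀ i j f, b i (b j f) = b j (b i f))
    (hca : ∀ i f, c (a i f) = a i (c f)) (hcb : ∀ i f, c (b i f) = b i (c f))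
    (hEc : ∀ f, Eu (c f) = c (Eu f))
    (hEa : ∀ i f, Eu (a i f) = a i (Eu f) - a i f) (hEb : ∀ i f, Eu (b i f) = b i (Eu f) - b i f)
    (f g : A) : ⁅kd a b c Eu f, kd a b c Eu g⁆ = kd a b c Eu (kbr a b c Eu f g) := by
  refine Derivation.ext fun h => ?_
  rw [Derivation.commutator_apply]
  have jac := pb_jac a b haa hab hbb f g h
  have hc := fun u v => pb_der a b c hca hcb u v
  have hE := fun u v => Eu_pb a b Eu hEa hEb u v
  have s1 := pb_skew a b g (c f)
  have s2 := pb_skew a b g (Eu f)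
  have s3 := pb_skew a b g f
  simp only [kbr_apply, kd_apply, map_add, map_sub, Derivation.leibniz, smul_eq_mul, der_two, hc, hE,
    hEc, pb_add', pb_sub', pb_two, pb_mul, s1, s2, s3]
  linear_combination jac

theorem c_kbr (hca : ∀ i f, c (a i f) = a i (c f)) (hcb : ∀ i f, c (b i f) = b i (c f))
    (hEc : ∀ f, Eu (c f) = c (Eu f)) (f g : A) : c (kbr a b c Eu f g) = kd a b c Eu f (c g) - kd a b c Eu g (c f) := by
  have hc := fun u v => pb_der a b c hca hcb u v
  have s1 := pb_skew a b g (c f)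
  simp only [kbr_apply, kd_apply, map_add, map_sub, Derivation.leibniz, smul_eq_mul, der_two, hc,
    hEc, s1]
  ring

theorem kbr_jac
    (haa : ∀ i j f, a i (a j f) = a j (a i f))
    (hab : ∀ i j f, a i (b j f) = b j (a i f)) (hbb : ∀ i j f, b i (b j f) = b j (b i f))
    (hca : ∀ i f, c (a i f) = a i (c f)) (hcb : ∀ i f, c (b i f) = b i (c f))
    (hEc : ∀ f, Eu (c f) = c (Eu f))
    (hEa : ∀ i f, Eu (a i f) = a i (Eu f) - a i f) (hEb : ∀ i f, Eu (b i f) = b i (Eu f) - b i f)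
    (f g h : A) : kbr a b c Eu f (kbr a b c Eu g h) =
    kbr a b c Eu (kbr a b c Eu f g) h + kbr a b c Eu g (kbr a b c Eu f h) := by
  have h1 := congrArg (fun D => D h) (kd_lie a b c Eu haa hab hbb hca hcb hEc hEa hEb f g)
  simp only [Derivation.commutator_apply] at h1
  have h2 := c_kbr a b c Eu hca hcb hEc f g
  rw [kbr_kd a b c Eu g h, kbr_kd a b c Eu f h, kbr_kd a b c Eu (kbr a b c Eu f g) h, ← h1, h2,
    kbr_kd, kbr_kd]
  simp only [map_sub, der_two, Derivation.leibniz, smul_eq_mul]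
  ring

end KD

section K1
variable {p : ℕ} {k : Type*} [Field k] [CharP k p] {r : ℕ}

theorem hk (r : ℕ) : 2 * r ≤ 2 * r + 1 := Nat.le_succ _

theorem qi_ne_last (i : Fin r) : qi (hk r) i ≠ Fin.last (2 * r) := by
  intro h; have := congrArg Fin.val h; have := i.2; simp [qi] at *; omega

theorem si_ne_last (i : Fin r) : si (hk r) i ≠ Fin.last (2 * r) := by
  intro h; have := congrArg Fin.val h; have := i.2; simp [si] at *; omega

theorem kcases (c : Fin (2 * r + 1)) :
    (∃ i, c = qi (hk r) i) ∨ (∃ i, c = si (hk r) i) ∨ c = Fin.last (2 * r) := by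
  by_cases h : c.1 < 2 * r
  · rcases idx_cases (hk r) c h with h | h
    · exact Or.inl h
    · exact Or.inr (Or.inl h)
  · exact Or.inr (Or.inr (Fin.ext (by have := c.2; simp; omega)))

/-- Euler weights -/
noncomputable def kw (k : Type*) [Field k] (r : ℕ) : Fin (2 * r + 1) → k :=
  fun c => if c = Fin.last (2 * r) then 0 else 1

theorem kw_q (i : Fin r) : kw k r (qi (hk r) i) = 1 := if_neg (qi_ne_last i)
theorem kw_s (i : Fin r) : kw k r (si (hk r) i) = 1 := if_neg (si_ne_last i)
theorem kw_z : kw k r (Fin.last (2 * r)) = 0 := if_pos rfl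

theorem tor_pd_comm {n : ℕ} (w : Fin n → k) (c : Fin n) (g : TruncPoly p k n) :
    tor w (truncPD p k n c g) = truncPD p k n c (tor w g) - w c • truncPD p k n c g := by
  have h := lie_tor_smul w (1 : TruncPoly p k n) c (s := 0) (by simp)
  have h2 := congrArg (fun D => D g) h
  simp only [Derivation.commutator_apply, one_smul, Derivation.smul_apply, zero_sub, neg_smul] at h2
  rw [sub_eq_iff_eq_add] at h2
  rw [h2, Derivation.neg_apply, Derivation.smul_apply]; ring

theorem Eu_eq : tor (p := p) (kw k r) = ∑ i : Fin r, (truncX p k _ (qi (hk r) i) • truncPD p k _ (qi (hk r) i)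
    + truncX p k _ (si (hk r) i) • truncPD p k _ (si (hk r) i)) := by
  apply der_ext
  intro c
  rw [tor_X, sum_der_apply]
  simp only [Derivation.add_apply, Derivation.smul_apply, pd_X, smul_eq_mul]
  rcases kcases c with ⟨j, rfl⟩ | ⟨j, rfl⟩ | rfl
  · rw [kw_q, one_smul, Finset.sum_eq_single j]
    · rw [if_pos rfl, if_neg (qi_ne_si _ _ _).symm]; ring
    · intro i _ hi
      rw [if_neg (by rwa [qi_inj]), if_neg (qi_ne_si _ _ _).symm]; ring
    · simp
  · rw [kw_s, one_smul, Finset.sum_eq_single j]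
    · rw [if_pos rfl, if_neg (qi_ne_si _ _ _)]; ring
    · intro i _ hi
      rw [if_neg (qi_ne_si _ _ _), if_neg (by rwa [si_inj])]; ring
    · simp
  · rw [kw_z, zero_smul]
    symm
    apply Finset.sum_eq_zero
    intro i _
    rw [if_neg (qi_ne_last _), if_neg (si_ne_last _)]; ring

/-- contact field -/
noncomputable def con (f : TruncPoly p k (2 * r + 1)) : WittAlg p k (2 * r + 1) :=
  kd (fun i => truncPD p k _ (qi (hk r) i)) (fun i => truncPD p k _ (si (hk r) i))
    (truncPD p k _ (Fin.last (2 * r))) (tor (kw k r)) f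

/-- contact field, linear -/
noncomputable def conL : TruncPoly p k (2 * r + 1) →ₗ[k] WittAlg p k (2 * r + 1) :=
  kdL (fun i => truncPD p k _ (qi (hk r) i)) (fun i => truncPD p k _ (si (hk r) i))
    (truncPD p k _ (Fin.last (2 * r))) (tor (kw k r))

/-- contact bracket -/
noncomputable def cbr : TruncPoly p k (2 * r + 1) →ₗ[k] TruncPoly p k (2 * r + 1) →ₗ[k] TruncPoly p k (2 * r + 1) :=
  kbr (fun i => truncPD p k _ (qi (hk r) i)) (fun i => truncPD p k _ (si (hk r) i))
    (truncPD p k _ (Fin.last (2 * r))) (tor (kw k r))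

theorem conL_apply (f : TruncPoly p k (2 * r + 1)) : conL f = con f := rfl

theorem con_apply (f g : TruncPoly p k (2 * r + 1)) : con f g = ham (hk r) f g
    + truncPD p k _ (Fin.last (2 * r)) f * tor (kw k r) g
    + (2 * f - tor (kw k r) f) * truncPD p k _ (Fin.last (2 * r)) g := rfl

theorem cbr_con (f g : TruncPoly p k (2 * r + 1)) :
    cbr f g = con f g - 2 * (truncPD p k _ (Fin.last (2 * r)) f * g) := kbr_kd _ _ _ _ f g

theorem cbr_self (f : TruncPoly p k (2 * r + 1)) : cbr f f = 0 := kbr_self _ _ _ _ f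

theorem kE1 (i : Fin r) (f : TruncPoly p k (2 * r + 1)) : tor (kw k r) (truncPD p k _ (qi (hk r) i) f)
    = truncPD p k _ (qi (hk r) i) (tor (kw k r) f) - truncPD p k _ (qi (hk r) i) f := by
  rw [tor_pd_comm, kw_q, one_smul]
theorem kE2 (i : Fin r) (f : TruncPoly p k (2 * r + 1)) : tor (kw k r) (truncPD p k _ (si (hk r) i) f)
    = truncPD p k _ (si (hk r) i) (tor (kw k r) f) - truncPD p k _ (si (hk r) i) f := by
  rw [tor_pd_comm, kw_s, one_smul]
theorem kE3 (f : TruncPoly p k (2 * r + 1)) : tor (kw k r) (truncPD p k _ (Fin.last (2*r)) f)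
    = truncPD p k _ (Fin.last (2*r)) (tor (kw k r) f) := by
  rw [tor_pd_comm, kw_z, zero_smul, sub_zero]

theorem con_lie (f g : TruncPoly p k (2 * r + 1)) : ⁅con f, con g⁆ = con (cbr f g) :=
  kd_lie (fun i => truncPD p k _ (qi (hk r) i)) (fun i => truncPD p k _ (si (hk r) i))
    (truncPD p k _ (Fin.last (2 * r))) (tor (kw k r))
    (fun _ _ _ => pd_comm _ _ _) (fun _ _ _ => pd_comm _ _ _) (fun _ _ _ => pd_comm _ _ _)
    (fun _ _ => pd_comm _ _ _) (fun _ _ => pd_comm _ _ _) kE3 kE1 kE2 f g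

theorem cbr_jac (f g h : TruncPoly p k (2 * r + 1)) : cbr f (cbr g h) = cbr (cbr f g) h + cbr g (cbr f h) :=
  kbr_jac (fun i => truncPD p k _ (qi (hk r) i)) (fun i => truncPD p k _ (si (hk r) i))
    (truncPD p k _ (Fin.last (2 * r))) (tor (kw k r))
    (fun _ _ _ => pd_comm _ _ _) (fun _ _ _ => pd_comm _ _ _) (fun _ _ _ => pd_comm _ _ _)
    (fun _ _ => pd_comm _ _ _) (fun _ _ => pd_comm _ _ _) kE3 kE1 kE2 f g h

theorem con_q (f : TruncPoly p k (2 * r + 1)) (i : Fin r) : con f (truncX p k _ (qi (hk r) i))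
    = - truncPD p k _ (si (hk r) i) f + truncPD p k _ (Fin.last (2 * r)) f * truncX p k _ (qi (hk r) i) := by
  rw [con_apply, ham_q, tor_X, kw_q, one_smul, pd_X, if_neg (qi_ne_last i).symm, mul_zero, add_zero]

theorem con_s (f : TruncPoly p k (2 * r + 1)) (i : Fin r) : con f (truncX p k _ (si (hk r) i))
    = truncPD p k _ (qi (hk r) i) f + truncPD p k _ (Fin.last (2 * r)) f * truncX p k _ (si (hk r) i) := by
  rw [con_apply, ham_s, tor_X, kw_s, one_smul, pd_X, if_neg (si_ne_last i).symm, mul_zero, add_zero]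

theorem con_z (f : TruncPoly p k (2 * r + 1)) : con f (truncX p k _ (Fin.last (2 * r)))
    = 2 * f - tor (kw k r) f := by
  rw [con_apply, ham_o _ _ _ (by simp), tor_X, kw_z, zero_smul, pd_X, if_pos rfl]; ring

theorem Eu_apply (f : TruncPoly p k (2 * r + 1)) : tor (kw k r) f = ∑ i : Fin r,
    (truncX p k _ (qi (hk r) i) * truncPD p k _ (qi (hk r) i) f
    + truncX p k _ (si (hk r) i) * truncPD p k _ (si (hk r) i) f) := by
  rw [Eu_eq, sum_der_apply]; rfl

theorem con_inv (f : TruncPoly p k (2 * r + 1)) : 2 * f = con f (truncX p k _ (Fin.last (2 * r)))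
    + ∑ i : Fin r, (truncX p k _ (qi (hk r) i) * con f (truncX p k _ (si (hk r) i))
      - truncX p k _ (si (hk r) i) * con f (truncX p k _ (qi (hk r) i))) := by
  rw [con_z, Eu_apply, sub_add, eq_comm, sub_eq_self, sub_eq_zero]
  refine Finset.sum_congr rfl fun i _ => ?_
  rw [con_s, con_q]; ring

theorem two_cancel (hp : p.Prime) (hp3 : 3 < p) {n : ℕ} {f : TruncPoly p k n} (h : 2 * f = 0) : f = 0 := by
  have : (2 : k) • f = 0 := by rw [two_smul, ← two_mul, h]
  exact (smul_eq_zero.1 this).resolve_left (ne_two hp hp3)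

theorem con_inj (hp : p.Prime) (hp3 : 3 < p) {f : TruncPoly p k (2 * r + 1)} (h : con f = 0) : f = 0 := by
  apply two_cancel hp hp3
  rw [con_inv, h]; simp

theorem sum_fin_split {M : Type*} [AddCommMonoid M] (r n : ℕ) (h : n = r + r) (g : ℕ → M) :
    ∑ i : Fin n, g i.1 = ∑ i : Fin r, (g i.1 + g (i.1 + r)) := by
  subst h
  rw [Fin.sum_univ_add, Finset.sum_add_distrib]
  congr 1
  exact Finset.sum_congr rfl fun i _ => by simp [add_comm]

theorem DK_eq (f : TruncPoly p k (2 * r + 1)) : DK p k r f = con f := by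
  have h1 : ∑ i : Fin (2 * r), truncX p k (2 * r + 1) ⟨i.1, by have := i.isLt; omega⟩ *
          truncPD p k (2 * r + 1) ⟨i.1, by have := i.isLt; omega⟩ f = tor (kw k r) f := by
    rw [Eu_apply]
    have := sum_fin_split r (2 * r) (by omega) (fun i => if h : i < 2 * r + 1 then
      truncX p k (2 * r + 1) ⟨i, h⟩ * truncPD p k (2 * r + 1) ⟨i, h⟩ f else 0)
    refine Eq.trans ?_ (this.trans ?_)
    · refine Finset.sum_congr rfl fun i _ => ?_
      rw [dif_pos (by have := i.2; omega)]
    · refine Finset.sum_congr rfl fun i _ => ?_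
      rw [dif_pos (by have := i.2; omega), dif_pos (by have := i.2; omega)]
      rfl
  unfold DK
  rw [h1]
  refine Derivation.ext fun g => ?_
  rw [con_apply, Derivation.add_apply, Derivation.smul_apply, smul_eq_mul, sum_der_apply]
  congr 1
  rw [Eu_apply, Finset.mul_sum, ham, pb_apply, ← Finset.sum_add_distrib]
  refine Finset.sum_congr rfl fun i _ => ?_
  simp only [Derivation.add_apply, Derivation.smul_apply, smul_eq_mul, qi, si]
  ring

/-- the range of `DK` -/
noncomputable def conRange (p : ℕ) (k : Type*) [Field k] [CharP k p] (r : ℕ) :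
    LieSubalgebra k (WittAlg p k (2 * r + 1)) :=
  derRange conL fun f g => ⟨cbr f g, (con_lie f g).symm⟩

theorem conAlg_range {D : WittAlg p k (2 * r + 1)} (h : D ∈ contactAlg p k r) :
    ∃ f, D = con f := by
  have h2 : contactAmbient p k r ≤ conRange p k r := LieSubalgebra.lieSpan_le.2 (by
    rintro _ ⟨f, rfl⟩; exact ⟨f, (DK_eq f).symm⟩)
  obtain ⟨f, hf⟩ := h2 (derivedSub_le _ h)
  exact ⟨f, hf.symm⟩

theorem mem_conAlg {f g h : TruncPoly p k (2 * r + 1)} {s : k} (hs : s ≠ 0) (hfg : cbr f g = s • h) :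
    con h ∈ contactAlg p k r := by
  refine mem_derived (x := con f) (y := con g)
    (LieSubalgebra.subset_lieSpan ⟨f, DK_eq f⟩) (LieSubalgebra.subset_lieSpan ⟨g, DK_eq g⟩) hs ?_
  rw [con_lie, hfg]
  exact conL.map_smul s h

end K1

section K2
variable {p : ℕ} {k : Type*} [Field k] [CharP k p] {r : ℕ}
variable {L : Type*} [LieRing L] [LieAlgebra k L] {op : L → L}

theorem con_one : con (1 : TruncPoly p k (2 * r + 1)) = (2 : TruncPoly p k (2 * r + 1)) • truncPD p k _ (Fin.last (2 * r)) := by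
  apply der_ext
  intro c
  rw [Derivation.smul_apply, pd_X]
  rcases kcases c with ⟨j, rfl⟩ | ⟨j, rfl⟩ | rfl
  · rw [con_q, if_neg (qi_ne_last j).symm]; simp
  · rw [con_s, if_neg (si_ne_last j).symm]; simp
  · rw [con_z, if_pos rfl]; simp

theorem con_qq (i : Fin r) : con (truncX p k _ (qi (hk r) i)) = truncPD p k _ (si (hk r) i)
    + truncX p k _ (qi (hk r) i) • truncPD p k _ (Fin.last (2 * r)) := by
  apply der_ext
  intro c
  rw [Derivation.add_apply, Derivation.smul_apply, pd_X, pd_X]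
  rcases kcases c with ⟨j, rfl⟩ | ⟨j, rfl⟩ | rfl
  · rw [con_q, pd_X, pd_X, if_neg (qi_ne_last j).symm, if_neg (qi_ne_last i).symm,
      if_neg (qi_ne_si _ _ _).symm, if_neg (qi_ne_si _ _ _).symm]; simp
  · rw [con_s, if_neg (si_ne_last j).symm, pd_X, pd_X, if_neg (qi_ne_last i).symm]
    simp only [qi_inj, si_inj, eq_comm, zero_mul, smul_zero]
  · rw [con_z, if_pos rfl, if_neg (si_ne_last i), tor_X, kw_q, one_smul, smul_eq_mul]; ring

theorem con_ss (i : Fin r) : con (truncX p k _ (si (hk r) i)) = - truncPD p k _ (qi (hk r) i)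
    + truncX p k _ (si (hk r) i) • truncPD p k _ (Fin.last (2 * r)) := by
  apply der_ext
  intro c
  rw [Derivation.add_apply, Derivation.smul_apply, Derivation.neg_apply, pd_X, pd_X]
  rcases kcases c with ⟨j, rfl⟩ | ⟨j, rfl⟩ | rfl
  · rw [con_q, if_neg (qi_ne_last j).symm, pd_X, pd_X, if_neg (si_ne_last i).symm]
    simp only [qi_inj, si_inj, eq_comm, zero_mul, smul_zero]
  · rw [con_s, pd_X, pd_X, if_neg (si_ne_last j).symm, if_neg (si_ne_last i).symm,
      if_neg (qi_ne_si _ _ _), if_neg (qi_ne_si _ _ _)]; simp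
  · rw [con_z, if_pos rfl, if_neg (qi_ne_last i), tor_X, kw_s, one_smul, smul_eq_mul]; ring

theorem cbr_qs (i : Fin r) (f : TruncPoly p k (2 * r + 1)) :
    cbr (truncX p k _ (qi (hk r) i) * truncX p k _ (si (hk r) i)) f = tor (qsw k (hk r) i) f := by
  have h1 : truncPD p k _ (Fin.last (2 * r)) (truncX p k _ (qi (hk r) i) * truncX p k _ (si (hk r) i)) = 0 := by
    rw [Derivation.leibniz, pd_X, pd_X, if_neg (si_ne_last i).symm, if_neg (qi_ne_last i).symm]; simp
  have h2 : tor (kw k r) (truncX p k _ (qi (hk r) i) * truncX p k _ (si (hk r) i))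
      = 2 * (truncX p k _ (qi (hk r) i) * truncX p k _ (si (hk r) i)) := by
    rw [Derivation.leibniz, tor_X, tor_X, kw_q, kw_s, one_smul, one_smul, smul_eq_mul, smul_eq_mul]; ring
  rw [cbr_con, con_apply, h1, h2, ham_qs]; ring

theorem mem_con_wt (i : Fin r) {f : TruncPoly p k (2 * r + 1)} {s : k} (hs : s ≠ 0)
    (h : tor (qsw k (hk r) i) f = s • f) : con f ∈ contactAlg p k r :=
  mem_conAlg hs ((cbr_qs i f).trans h)

theorem cbr_one (f : TruncPoly p k (2 * r + 1)) : cbr 1 f = 2 * truncPD p k _ (Fin.last (2 * r)) f := by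
  rw [cbr_con, con_one, Derivation.smul_apply, smul_eq_mul, Derivation.map_one_eq_zero]; ring

theorem mem_con_one (hp : p.Prime) (hp3 : 3 < p) : con (1 : TruncPoly p k (2 * r + 1)) ∈ contactAlg p k r := by
  refine mem_conAlg (f := 1) (g := truncX p k _ (Fin.last (2 * r))) (s := 2) (ne_two hp hp3) ?_
  rw [cbr_one, pd_X, if_pos rfl, two_smul]; ring

theorem mem_con_z (hp : p.Prime) (hp3 : 3 < p) :
    con (truncX p k _ (Fin.last (2 * r))) ∈ contactAlg p k r := by
  refine mem_conAlg (f := 1) (g := truncX p k _ (Fin.last (2 * r)) * truncX p k _ (Fin.last (2 * r)))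
    (s := 2 * 2) (mul_ne_zero (ne_two hp hp3) (ne_two hp hp3)) ?_
  rw [cbr_one, Derivation.leibniz, pd_X, if_pos rfl, mul_smul, two_smul, two_smul, smul_eq_mul]; ring

theorem cent_K (hp : p.Prime) (hp3 : 3 < p) (e : L ≃ₗ⁅k⁆ contactAlg p k r) (E : WittAlg p k (2*r+1))
    (h : ∀ x, ⁅E, subIota e x⁆ = 0) : E = 0 := by
  have h' : ∀ D ∈ contactAlg p k r, ∀ g, D (E g) = E (D g) := fun D hD g => by
    have := h (e.symm ⟨D, hD⟩)
    rw [subIota_symm] at this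
    have := congrArg (fun F => F g) this
    simp only [Derivation.commutator_apply] at this
    exact (sub_eq_zero.1 this).symm
  have k1 := h' _ (mem_con_one hp hp3)
  have k2 := fun i : Fin r => h' _ (mem_con_wt i (f := truncX p k _ (qi (hk r) i)) (s := -1) (by simp)
    (by rw [tor_X, qsw_q, if_pos rfl]))
  have k3 := fun i : Fin r => h' _ (mem_con_wt i (f := truncX p k _ (si (hk r) i)) (s := 1) (by simp)
    (by rw [tor_X, qsw_s, if_pos rfl]))
  have k4 := h' _ (mem_con_z hp hp3)
  have key : ∀ g, con 1 g = 0 → (∀ i, con (truncX p k _ (qi (hk r) i)) g = 0) →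
      (∀ i, con (truncX p k _ (si (hk r) i)) g = 0) → ∀ D : WittAlg p k (2*r+1), D g = 0 := by
    intro g g1 g2 g3 D
    rw [con_one, Derivation.smul_apply, smul_eq_mul] at g1
    have g1 := two_cancel hp hp3 g1
    have : ∀ c, truncPD p k _ c g = 0 := by
      intro c
      rcases kcases c with ⟨j, rfl⟩ | ⟨j, rfl⟩ | rfl
      · have := g3 j
        rw [con_ss, Derivation.add_apply, Derivation.smul_apply, g1, smul_zero, add_zero,
          Derivation.neg_apply] at this
        exact neg_eq_zero.1 this
      · have := g2 j
        rwa [con_qq, Derivation.add_apply, Derivation.smul_apply, g1, smul_zero, add_zero] at this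
      · exact g1
    rw [der_apply]
    exact Finset.sum_eq_zero fun c _ => by rw [this, mul_zero]
  have eq : ∀ j, E (truncX p k _ (qi (hk r) j)) = 0 := by
    intro j
    have := key (E (truncX p k _ (qi (hk r) j))) ?_ ?_ ?_ (con (truncX p k _ (Fin.last (2 * r))))
    · rw [k4, con_q, pd_X, pd_X, if_neg (si_ne_last _), if_pos rfl] at this
      simpa using this
    · rw [k1, con_q]; simp
    · intro i
      rw [k2, con_q, pd_X, pd_X, if_neg (qi_ne_si _ _ _).symm, if_neg (qi_ne_last _).symm]; simp
    · intro i
      rw [k3, con_q, pd_X, pd_X, if_neg (si_ne_last _).symm]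
      split_ifs <;> simp
  have es : ∀ j, E (truncX p k _ (si (hk r) j)) = 0 := by
    intro j
    have := key (E (truncX p k _ (si (hk r) j))) ?_ ?_ ?_ (con (truncX p k _ (Fin.last (2 * r))))
    · rw [k4, con_s, pd_X, pd_X, if_neg (qi_ne_last _), if_pos rfl] at this
      simpa using this
    · rw [k1, con_s]; simp
    · intro i
      rw [k2, con_s, pd_X, pd_X, if_neg (qi_ne_last _).symm]
      split_ifs <;> simp
    · intro i
      rw [k3, con_s, pd_X, pd_X, if_neg (qi_ne_si _ _ _), if_neg (si_ne_last _).symm]; simp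
  apply der_ext
  intro c
  rw [Derivation.zero_apply]
  rcases kcases c with ⟨j, rfl⟩ | ⟨j, rfl⟩ | rfl
  · exact eq j
  · exact es j
  · have := key (E (truncX p k _ (Fin.last (2 * r)))) ?_ ?_ ?_ (con (truncX p k _ (Fin.last (2 * r))))
    · rw [k4, con_z, tor_X, kw_z, zero_smul, sub_zero, two_mul (truncX p k _ (Fin.last (2 * r))), map_add, ← two_mul] at this
      exact two_cancel hp hp3 this
    · rw [k1, con_z]; simp [der_two]
    · intro i
      rw [k2, con_z, tor_X, kw_q, one_smul, two_mul (truncX p k _ (qi (hk r) i)), add_sub_cancel_right, eq]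
    · intro i
      rw [k3, con_z, tor_X, kw_s, one_smul, two_mul (truncX p k _ (si (hk r) i)), add_sub_cancel_right, es]

/-- the extra coordinate -/
noncomputable def wX (p : ℕ) (k : Type*) [Field k] (r : ℕ) : TruncPoly p k (2 * r + 1) :=
  truncX p k _ (Fin.last (2 * r)) + ∑ i : Fin r, truncX p k _ (qi (hk r) i) * truncX p k _ (si (hk r) i)

theorem con_w (f : TruncPoly p k (2 * r + 1)) : con f (wX p k r) =
    2 * f + 2 * ∑ i : Fin r, truncX p k _ (si (hk r) i) * con f (truncX p k _ (qi (hk r) i)) := by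
  rw [wX, map_add, con_z, Eu_apply, map_sum, Finset.mul_sum, sub_add, sub_eq_add_neg, ← Finset.sum_sub_distrib,
    ← Finset.sum_neg_distrib]
  congr 1
  refine Finset.sum_congr rfl fun i _ => ?_
  rw [Derivation.leibniz, con_q, con_s, smul_eq_mul, smul_eq_mul]; ring

theorem conq_mul (f g : TruncPoly p k (2 * r + 1)) (i : Fin r) :
    con (f * g) (truncX p k _ (qi (hk r) i)) = f * con g (truncX p k _ (qi (hk r) i))
      + g * con f (truncX p k _ (qi (hk r) i)) := by
  rw [con_q, con_q, con_q, Derivation.leibniz, Derivation.leibniz]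
  simp only [smul_eq_mul]; ring

theorem conq_pow {f : TruncPoly p k (2 * r + 1)} {i : Fin r}
    (h : con f (truncX p k _ (qi (hk r) i)) = 0) (j : ℕ) :
    con (f ^ j) (truncX p k _ (qi (hk r) i)) = 0 := by
  induction j with
  | zero => rw [pow_zero, con_one, Derivation.smul_apply, pd_X, if_neg (qi_ne_last _).symm, smul_zero]
  | succ j ih => rw [pow_succ, conq_mul, ih, h]; ring

/-- odometer coordinates -/
noncomputable def kY (p : ℕ) (k : Type*) [Field k] (r : ℕ) (i : ℕ) : TruncPoly p k (2 * r + 1) :=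
  if i = r then wX p k r else mX p k _ r i

theorem kY_lt {i : ℕ} (h : i < r) : kY p k r i = truncX p k _ (qi (hk r) ⟨i, h⟩) := by
  rw [kY, if_neg h.ne, mX_of_lt h (by omega)]; rfl

theorem kY_r : kY p k r r = wX p k r := if_pos rfl

theorem conq_qq (i j : Fin r) : con (truncX p k _ (qi (hk r) j)) (truncX p k _ (qi (hk r) i)) = 0 := by
  rw [con_q, pd_X, pd_X, if_neg (qi_ne_si _ _ _).symm, if_neg (qi_ne_last _).symm]; simp

theorem conq_ss (i j : Fin r) : con (truncX p k _ (si (hk r) j)) (truncX p k _ (qi (hk r) i))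
    = if i = j then -1 else 0 := by
  rw [con_q, pd_X, pd_X, if_neg (si_ne_last _).symm]
  by_cases h : i = j
  · subst h; simp
  · rw [if_neg (by rwa [si_inj]), if_neg h]; simp

theorem conq_add (f g : TruncPoly p k (2 * r + 1)) (x) : con (f + g) x = con f x + con g x := by
  rw [← conL_apply, map_add]; rfl

theorem conq_w (i : Fin r) : con (wX p k r) (truncX p k _ (qi (hk r) i)) = 0 := by
  have h : ∀ s : Finset (Fin r), con (∑ i ∈ s, truncX p k _ (qi (hk r) i) * truncX p k _ (si (hk r) i))
      (truncX p k _ (qi (hk r) i)) = ∑ j ∈ s, con (truncX p k _ (qi (hk r) j) * truncX p k _ (si (hk r) j))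
      (truncX p k _ (qi (hk r) i)) := by
    intro s
    rw [← conL_apply, map_sum, sum_der_apply]; rfl
  rw [wX, conq_add, h, Finset.sum_eq_single i]
  · rw [conq_mul, conq_qq, conq_ss, if_pos rfl, con_q, pd_X, pd_X, if_pos rfl, if_neg (si_ne_last _)]; ring
  · intro j _ hj
    rw [conq_mul, conq_qq, conq_ss, if_neg (Ne.symm hj)]; ring
  · simp

theorem conq_T (l : ℕ) (hl : l ≤ r + 1) (i : Fin r) :
    con (odoT p (kY p k r) l) (truncX p k _ (qi (hk r) i)) = 0 := by
  induction l with
  | zero =>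
    have h0 : odoT p (kY p k r) 0 = 1 := rfl
    rw [h0, con_one, Derivation.smul_apply, pd_X, if_neg (qi_ne_last _).symm, smul_zero]
  | succ l ih =>
    rw [odoT_succ, conq_mul, ih (by omega), conq_pow, mul_zero, mul_zero, add_zero]
    by_cases h : l = r
    · rw [h, kY_r, conq_w]
    · rw [kY_lt (by omega), conq_qq]

theorem con_Ts_q {T : TruncPoly p k (2 * r + 1)} (hT : ∀ i, con T (truncX p k _ (qi (hk r) i)) = 0)
    (j i : Fin r) : con (T * truncX p k _ (si (hk r) j)) (truncX p k _ (qi (hk r) i))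
      = if i = j then -T else 0 := by
  rw [conq_mul, hT, conq_ss]; split_ifs <;> simp

theorem con_Ts_w {T : TruncPoly p k (2 * r + 1)} (hT : ∀ i, con T (truncX p k _ (qi (hk r) i)) = 0)
    (j : Fin r) : con (T * truncX p k _ (si (hk r) j)) (wX p k r) = 0 := by
  rw [con_w, Finset.sum_eq_single j]
  · rw [con_Ts_q hT, if_pos rfl]; ring
  · intro i _ hi
    rw [con_Ts_q hT, if_neg hi, mul_zero]
  · simp

theorem con_T_w {T : TruncPoly p k (2 * r + 1)} (hT : ∀ i, con T (truncX p k _ (qi (hk r) i)) = 0) :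
    con T (wX p k r) = 2 * T := by
  rw [con_w, Finset.sum_eq_zero, mul_zero, add_zero]
  intro i _
  rw [hT, mul_zero]

theorem odoT_kY (l : ℕ) (hl : l ≤ r) : odoT p (kY p k r) l = odoT p (mX p k _ r) l := by
  refine Finset.prod_congr rfl fun i hi => ?_
  rw [Finset.mem_range] at hi
  rw [kY, if_neg (by omega)]

theorem wt_w (j : Fin r) : tor (qsw k (hk r) j) (wX p k r) = (0 : k) • wX p k r := by
  rw [zero_smul, wX, map_add, map_sum, tor_X, Finset.sum_eq_zero, add_zero]
  · rw [qsw, if_neg (si_ne_last _).symm, if_neg (qi_ne_last _).symm, zero_smul]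
  · intro i _
    rw [Derivation.leibniz, tor_X, tor_X, qsw_q, qsw_s]
    split_ifs
    · rw [one_smul, neg_one_smul, smul_eq_mul, smul_eq_mul]; ring
    · simp

theorem lower_K (hp : p.Prime) (hp3 : 3 < p) [IsAlgClosed k] (hs : LieAlgebra.IsSimple k L)
    (hop : IsPMap p k op)
    {V : Type*} [AddCommGroup V] [Module k V] [LieRingModule L V] [LieModule k L V]
    [FiniteDimensional k V] (hV : IsRestrictedModule p k op V)
    (hnt : ¬ LieModule.IsTrivial L V) (hr : 1 ≤ r) (e : L ≃ₗ⁅k⁆ contactAlg p k r) :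
    p ^ (r + 1) - 1 ≤ Module.finrank k V := by
  set Y := kY p k r with hY
  set z0 : Fin r := ⟨0, hr⟩
  set a : WittAlg p k (2*r+1) := (2⁻¹ : k) • con (odoT p Y r) -
    ∑ i : Fin r, con (odoT p Y i * truncX p k _ (si (hk r) i)) with ha
  set b : WittAlg p k (2*r+1) := - con (odoT p Y (r+1) * truncX p k _ (si (hk r) z0)) with hb
  have ham' : a ∈ contactAlg p k r := by
    apply sub_mem
    · apply (contactAlg p k r).toSubmodule.smul_mem
      refine mem_con_wt z0 one_ne_zero ?_
      rw [hY, odoT_kY _ le_rfl, wt_tau hp _ _ _ le_rfl, if_pos (show z0.1 < r from hr)]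
    · apply (contactAlg p k r).toSubmodule.sum_mem
      intro i _
      refine mem_con_wt i one_ne_zero ?_
      rw [hY, odoT_kY _ i.2.le, wt_tau_s hp (hk r) i i i i.2.le]
      simp
  have hbm : b ∈ contactAlg p k r := by
    apply neg_mem
    refine mem_con_wt z0 (ne_two hp hp3) ?_
    have h1 : tor (qsw k (hk r) z0) (odoT p Y r) = (1 : k) • odoT p Y r := by
      rw [hY, odoT_kY _ le_rfl, wt_tau hp _ _ _ le_rfl, if_pos (show z0.1 < r from hr)]
    have h2 := wt_pow (wt_w (p := p) (k := k) z0) (p - 1)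
    have h3 := tor_X (p := p) (qsw k (hk r) z0) (si (hk r) z0)
    rw [qsw_s, if_pos rfl] at h3
    have := wt_mul (wt_mul h1 h2) h3
    rw [odoT_succ, hY, kY_r, ← hY, this]
    congr 1; ring
  have v1 : ∀ (l : ℕ) (hl : l < r), b (Y l) = if l = 0 then odoT p Y (r+1) else 0 := by
    intro l hl
    rw [hb, Derivation.neg_apply, hY, kY_lt hl, con_Ts_q (conq_T _ le_rfl)]
    by_cases h : l = 0
    · subst h; rw [if_pos rfl, if_pos rfl, neg_neg]
    · rw [if_neg h, if_neg, neg_zero]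
      intro h'; exact h (congrArg Fin.val h')
  refine lower_cartan hp hs hop hV hnt (subIota e) (subIota_inj e) (cent_K hp hp3 e) (r + 1)
    (by omega) Y ?_ (e.symm ⟨a, ham'⟩) (e.symm ⟨b, hbm⟩) ?_ ?_ ?_ ?_
  · intro i hi
    by_cases h : i = r
    · rw [h, hY, kY_r, pow_p_of_eps hp]
      have : eps hp.ne_zero (wX p k r) = 0 := by
        rw [wX, map_add, map_sum, eps_X, Finset.sum_eq_zero, add_zero]
        intro i _
        rw [map_mul, eps_X, zero_mul]
      rw [this, zero_pow hp.ne_zero, map_zero]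
    · rw [hY, kY_lt (by omega)]; exact truncX_pow _
  · intro i hi
    rw [subIota_symm, ha, Derivation.sub_apply, Derivation.smul_apply, sum_der_apply]
    by_cases h : i = r
    · subst h
      rw [hY, kY_r, con_T_w (conq_T _ (by omega)), Finset.sum_eq_zero, sub_zero, two_mul (odoT p (kY p k i) i), ← two_smul k,
        smul_smul, inv_mul_cancel₀ (ne_two hp hp3), one_smul]
      intro j _
      exact con_Ts_w (conq_T _ (by have := j.2; omega)) j
    · have hi' : i < r := by omega
      rw [hY, kY_lt hi', conq_T _ (by omega), smul_zero, zero_sub, Finset.sum_eq_single ⟨i, hi'⟩]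
      · rw [con_Ts_q (conq_T _ (by simp; omega)), if_pos rfl, neg_neg]
      · intro j _ hj
        rw [con_Ts_q (conq_T _ (by have := j.2; omega)), if_neg (Ne.symm hj)]
      · simp
  · rw [subIota_symm, v1 0 hr, if_pos rfl]
  · intro i hi
    rw [subIota_symm]
    by_cases h : i < r
    · rw [v1 i h, if_neg (by omega)]
    · by_cases h2 : i = r
      · rw [h2, hb, Derivation.neg_apply, hY, kY_r, con_Ts_w (conq_T _ le_rfl), neg_zero]
      · rw [hY, kY, if_neg h2, mX, if_neg h, map_zero]
  · intro E hE
    obtain ⟨h, hh⟩ := conAlg_range (subIota_mem e E)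
    have h1 : ∀ i, con h (truncX p k _ (qi (hk r) i)) = 0 := fun i => by
      have := hE i (by have := i.2; omega)
      rwa [hh, hY, kY_lt i.2] at this
    have h2 := hE r (by omega)
    rw [hh, hY, kY_r, con_T_w h1] at h2
    apply derPow_zero_of_sq
    intro c
    rw [hh, two_cancel hp hp3 h2, ← conL_apply, map_zero]; rfl

end K2

section K3
variable {p : ℕ} {k : Type*} [Field k] [CharP k p] {r : ℕ}
variable {L : Type*} [LieRing L] [LieAlgebra k L] {op : L → L}

/-- one-jet -/
noncomputable def kJ {n : ℕ} (hp : p.Prime) : TruncPoly p k n →ₗ[k] (Option (Fin n) → k) :=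
  LinearMap.pi fun c => c.elim (eps hp.ne_zero).toLinearMap
    fun i => (eps hp.ne_zero).toLinearMap ∘ₗ (truncPD p k n i).toLinearMap

theorem kJ_none {n : ℕ} (hp : p.Prime) (f : TruncPoly p k n) : kJ hp f none = eps hp.ne_zero f := rfl
theorem kJ_some {n : ℕ} (hp : p.Prime) (f : TruncPoly p k n) (i : Fin n) :
    kJ hp f (some i) = eps hp.ne_zero (truncPD p k n i f) := rfl

theorem kJ_surj {n : ℕ} (hp : p.Prime) : Function.Surjective (kJ (k := k) (n := n) hp) := by
  intro c
  obtain ⟨f, hf⟩ := linJ_surj (k := k) (n := n) hp (fun i => c (some i))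
  refine ⟨f + algebraMap k _ (c none - eps hp.ne_zero f), ?_⟩
  funext l
  cases l with
  | none => rw [kJ_none, map_add, AlgHom.commutes]; simp
  | some i =>
    rw [kJ_some, map_add, Derivation.map_algebraMap, add_zero, ← linJ_apply hp, hf]

theorem con_cbr_iter (f g : TruncPoly p k (2 * r + 1)) (j : ℕ) :
    con (((cbr f) ^ j) g) = (fun z => ⁅con f, z⁆)^[j] (con g) := by
  induction j with
  | zero => rfl
  | succ j ih => rw [Function.iterate_succ_apply', ← ih, con_lie, pow_succ']; rfl

theorem con_injective (hp : p.Prime) (hp3 : 3 < p) : LinearMap.ker (conL (p := p) (k := k) (r := r)) = ⊥ := by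
  rw [LinearMap.ker_eq_bot']
  exact fun f h => con_inj hp hp3 h

theorem upper_K [IsAlgClosed k] [FiniteDimensional k L] (hp : p.Prime) (hp3 : 3 < p) (hop : IsPMap p k op)
    (ι : L →ₗ⁅k⁆ WittAlg p k (2 * r + 1)) (hinj : Function.Injective ι)
    (hio : ∀ x, ι (op x) = derPow hp (ι x))
    (hran : ∀ x, ∃ f, ι x = con f)
    (t : LieSubalgebra k L) (ht : IsTorus k op t) : Module.finrank k t ≤ r + 1 := by
  set IT : Submodule k (WittAlg p k (2*r+1)) := t.toSubmodule.map (ι : L →ₗ[k] WittAlg p k (2*r+1)) with hIT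
  set F := IT.comap conL with hF
  have hFt : ∀ f ∈ F, ∃ x : t, ι x = con f := by
    rintro f ⟨x, hx, hx2⟩
    exact ⟨⟨x, hx⟩, hx2⟩
  obtain ⟨g0, hg0⟩ := LinearMap.exists_leftInverse_of_injective (conL (p := p) (k := k) (r := r))
    (con_injective hp hp3)
  have hg : ∀ f, g0 (con f) = f := fun f => LinearMap.congr_fun hg0 f
  set act : L →ₗ[k] Module.End k (TruncPoly p k (2*r+1)) :=
    cbr ∘ₗ g0 ∘ₗ (ι : L →ₗ[k] WittAlg p k (2*r+1)) with hact
  have hacta : ∀ x f, ι x = con f → act x = cbr f := by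
    intro x f h
    change cbr (g0 (ι x)) = _
    rw [h, hg]
  have hactp : ∀ x, act (op x) = act x ^ p := by
    intro x
    obtain ⟨f, hf⟩ := hran x
    obtain ⟨f', hf'⟩ := hran (op x)
    rw [hacta _ _ hf, hacta _ _ hf']
    refine LinearMap.ext fun g => ?_
    rw [← sub_eq_zero]
    apply con_inj hp hp3
    rw [← conL_apply, map_sub, conL_apply, conL_apply, con_cbr_iter, ← con_lie, ← hf', hio, hf, lie_derPow, sub_self]
  have hpss : ∀ f ∈ F, PSS p (cbr f) := by
    intro f hf
    obtain ⟨x, hx⟩ := hFt f hf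
    have := pss_of_hom (op := op) act hactp (ht.2 x x.2)
    rwa [hacta _ _ hx] at this
  have hcm : ∀ f ∈ F, ∀ g ∈ F, cbr f g = 0 := by
    intro f hf g hg
    obtain ⟨x, hx⟩ := hFt f hf
    obtain ⟨y, hy⟩ := hFt g hg
    have h := torus_abelian hp.two_le hop ht x.2 y.2
    have h2 : ⁅ι x, ι y⁆ = 0 := by rw [← LieHom.map_lie, h, map_zero]
    rw [hx, hy, con_lie] at h2
    exact con_inj hp hp3 h2
  have htop := joint_diag_top (cbr.domRestrict F) (fun s u => LinearMap.ext fun g => by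
      have := cbr_jac s.1 u.1 g
      rw [hcm _ s.2 _ u.2, map_zero, LinearMap.zero_apply, zero_add] at this
      exact this) (fun s => (hpss _ s.2).isSemisimple)
  have hQ : Module.finrank k (Option (Fin (2*r+1)) → k) = 2*r+2 := by simp
  have key := lagrangian cbr (fun f => cbr_self f) (fun f g h => cbr_jac f g h)
    (eps hp.ne_zero).toLinearMap (kJ hp) (kJ_surj hp) ?_ F hcm (fun f hf => (hpss f hf).isSemisimple)
    ⊥ ?_
  · have h1 : Module.finrank k t = Module.finrank k IT :=
      (Submodule.equivMapOfInjective (ι : L →ₗ[k] WittAlg p k (2*r+1)) hinj t.toSubmodule).finrank_eq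
    have h2 : Module.finrank k IT + Module.finrank k (LinearMap.ker (conL (p := p) (k := k) (r := r)))
        = Module.finrank k F := by
      refine rank_nullity_der (k := k) (A := TruncPoly p k (2*r+1)) conL IT ?_
      rintro _ ⟨x, hx, rfl⟩
      obtain ⟨f, hf⟩ := hran x
      exact ⟨f, hf.symm⟩
    rw [finrank_bot] at key
    omega
  · intro f
    constructor
    · intro h g
      change eps hp.ne_zero (cbr f g) = 0
      have h0 := congrFun h none
      have hz := congrFun h (some (Fin.last (2*r)))
      rw [kJ_none] at h0
      rw [kJ_some] at hz
      have hE : eps hp.ne_zero (tor (kw k r) f) = 0 := by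
        rw [Eu_apply, map_sum]
        refine Finset.sum_eq_zero fun i _ => ?_
        rw [map_add, map_mul, map_mul, eps_X, eps_X, zero_mul, zero_mul, add_zero]
      have hh : eps hp.ne_zero (ham (hk r) f g) = 0 := by
        rw [ham, pb_apply, map_sum]
        apply Finset.sum_eq_zero
        intro i _
        have h1 := congrFun h (some (qi (hk r) i))
        have h2 := congrFun h (some (si (hk r) i))
        rw [kJ_some] at h1 h2
        rw [map_sub, map_mul, map_mul, h1, h2]; simp
      rw [cbr_con, con_apply]
      simp only [map_sub, map_add, map_mul, h0, hz, hE, hh]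
      simp
    · intro h
      have hz : eps hp.ne_zero (truncPD p k _ (Fin.last (2*r)) f) = 0 := by
        have := h 1
        change eps hp.ne_zero (cbr f 1) = 0 at this
        rw [cbr_con, Derivation.map_one_eq_zero, mul_one, zero_sub, map_neg, map_mul, map_ofNat, neg_eq_zero] at this
        exact (mul_eq_zero.1 this).resolve_left (ne_two hp hp3)
      have hc : ∀ g, eps hp.ne_zero (con f g) = 0 := by
        intro g
        have := h g
        change eps hp.ne_zero (cbr f g) = 0 at this
        rwa [cbr_con, map_sub, map_mul, map_mul, hz, zero_mul, mul_zero, sub_zero] at this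
      funext c
      cases c with
      | none =>
        have := congrArg (eps hp.ne_zero) (con_inv f)
        rw [map_mul, map_add, hc, map_sum, Finset.sum_eq_zero, zero_add, map_ofNat] at this
        · exact (mul_eq_zero.1 this).resolve_left (ne_two hp hp3)
        · intro i _
          rw [map_sub, map_mul, map_mul, eps_X, eps_X, zero_mul, zero_mul, sub_zero]
      | some c =>
        rw [kJ_some]
        rcases kcases c with ⟨j, rfl⟩ | ⟨j, rfl⟩ | rfl
        · have := hc (truncX p k _ (si (hk r) j))
          rwa [con_s, map_add, map_mul, hz, zero_mul, add_zero] at this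
        · have := hc (truncX p k _ (qi (hk r) j))
          rwa [con_q, map_add, map_mul, hz, zero_mul, add_zero, map_neg, neg_eq_zero] at this
        · exact hz
  · intro f hf h
    obtain ⟨y, hy, b, hb⟩ := exists_basis_of_span (kJ (k := k) (n := 2*r+1) hp) (kJ_surj hp) htop
      (ι := Option (Fin (2*r+1))) (by simp)
    choose χ hχ using hy
    have h0 : ∀ j, cbr f (y j) = 0 := by
      intro j
      have h1 : cbr f (y j) = χ j ⟨f, hf⟩ • y j := hχ j ⟨f, hf⟩
      have h2 := h (y j)
      rw [h1, map_smul, ← hb] at h2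
      rw [h1, (smul_eq_zero.1 h2).resolve_right (b.ne_zero j), zero_smul]
    have h3 := matrix_kill hp (fun j l => l.elim (y j) (fun i => truncPD p k (2*r+1) i (y j))) b ?_
      (fun l => l.elim (- (2 * truncPD p k _ (Fin.last (2*r)) f)) (fun i => con f (truncX p k _ i))) ?_
    · change f = 0
      apply con_inj hp hp3
      apply der_ext
      intro i
      exact h3 (some i)
    · intro j
      rw [hb]
      funext l
      cases l with
      | none => rfl
      | some i => rfl
    · intro j
      rw [Fintype.sum_option]
      change - (2 * truncPD p k _ (Fin.last (2*r)) f) * y j + ∑ i, con f (truncX p k _ i) * truncPD p k (2*r+1) i (y j) = 0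
      rw [← der_apply, ← h0 j, cbr_con]
      ring

theorem main_K [IsAlgClosed k] [FiniteDimensional k L] (hp : p.Prime) (hp3 : 3 < p)
    (hs : LieAlgebra.IsSimple k L) (hop : IsPMap p k op)
    {V : Type*} [AddCommGroup V] [Module k V] [LieRingModule L V] [LieModule k L V]
    [FiniteDimensional k V] (hV : IsRestrictedModule p k op V)
    (hdim : Module.finrank k V < p ^ (mu k op) - 1) (hn : 1 ≤ r) (e : L ≃ₗ⁅k⁆ contactAlg p k r) :
    LieModule.IsTrivial L V :=
  finish hp hdim (upper_K hp hp3 hop (subIota e) (subIota_inj e)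
    (iota_op hp hop (subIota e) (cent_K hp hp3 e))
    (fun x => conAlg_range (subIota_mem e x)))
    (fun hnt => lower_K hp hp3 hs hop hV hnt hn e)
end K3

section Mel
variable {k : Type*} [Field k] {A : Type*} [CommRing A] [Algebra k A]
variable {L : Type*} [LieRing L] [LieAlgebra k L]

/-- coordinates on a Melikian algebra -/
structure MelData (k A L : Type*) [Field k] [CommRing A] [Algebra k A] [LieRing L] [LieAlgebra k L] where
  P : Derivation k A A
  Q : Derivation k A A
  ε : A →ₐ[k] k
  d1 : L →ₗ[k] A
  d2 : L →ₗ[k] A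
  f : L →ₗ[k] A
  e1 : L →ₗ[k] A
  e2 : L →ₗ[k] A
  ext : ∀ z, d1 z = 0 → d2 z = 0 → f z = 0 → e1 z = 0 → e2 z = 0 → z = 0
  hv : ∀ a b : k, ∃ z, ε (d1 z) = a ∧ ε (d2 z) = b
  b1 : ∀ s z, d1 ⁅s, z⁆ = (d1 s * P (d1 z) + d2 s * Q (d1 z)) - (d1 z * P (d1 s) + d2 z * Q (d1 s))
    + f s * e1 z - f z * e1 s
  b2 : ∀ s z, d2 ⁅s, z⁆ = (d1 s * P (d2 z) + d2 s * Q (d2 z)) - (d1 z * P (d2 s) + d2 z * Q (d2 s))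
    + f s * e2 z - f z * e2 s
  bf : ∀ s z, f ⁅s, z⁆ = (d1 s * P (f z) + d2 s * Q (f z)) - (d1 z * P (f s) + d2 z * Q (f s))
    - 2 * (P (d1 s) + Q (d2 s)) * f z + 2 * (P (d1 z) + Q (d2 z)) * f s + (e1 s * e2 z - e2 s * e1 z)
  be1 : ∀ s z, e1 ⁅s, z⁆ = (d1 s * P (e1 z) + d2 s * Q (e1 z)) - (e1 z * P (d1 s) + e2 z * Q (d1 s))
    + 2 * (P (d1 s) + Q (d2 s)) * e1 z
    - ((d1 z * P (e1 s) + d2 z * Q (e1 s)) - (e1 s * P (d1 z) + e2 s * Q (d1 z)))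
    - 2 * (P (d1 z) + Q (d2 z)) * e1 s + 2 * (f z * Q (f s) - f s * Q (f z))
  be2 : ∀ s z, e2 ⁅s, z⁆ = (d1 s * P (e2 z) + d2 s * Q (e2 z)) - (e1 z * P (d2 s) + e2 z * Q (d2 s))
    + 2 * (P (d1 s) + Q (d2 s)) * e2 z
    - ((d1 z * P (e2 s) + d2 z * Q (e2 s)) - (e1 s * P (d2 z) + e2 s * Q (d2 z)))
    - 2 * (P (d1 z) + Q (d2 z)) * e2 s + 2 * (f s * P (f z) - f z * P (f s))
  x : A
  y : A
  Px : P x = 1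
  Qx : Q x = 0
  Py : P y = 0
  Qy : Q y = 1
  xp : x ^ 5 = 0
  yp : y ^ 5 = 0
  ex : ε x = 0
  ey : ε y = 0
  unit : ∀ a, ε a ≠ 0 → IsUnit a
  finA : Module.finrank k A = 25
  quox : ∀ g, ∃ (c : Fin 5 → k) (h : A), g = ∑ j, c j • y ^ j.1 + x * h
  quoy : ∀ g, ∃ (c : Fin 5 → k) (h : A), g = ∑ j, c j • x ^ j.1 + y * h

/-- the symmetry exchanging the two coordinates -/
def MelData.swap (M : MelData k A L) : MelData k A L where
  P := M.Q
  Q := M.P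
  ε := M.ε
  d1 := M.d2
  d2 := M.d1
  f := -M.f
  e1 := -M.e2
  e2 := -M.e1
  ext z h1 h2 h3 h4 h5 := M.ext z h2 h1 (neg_eq_zero.1 h3) (neg_eq_zero.1 h5) (neg_eq_zero.1 h4)
  hv a b := let ⟨z, h1, h2⟩ := M.hv b a; ⟨z, h2, h1⟩
  b1 s z := by simp only [LinearMap.neg_apply, M.b2]; ring
  b2 s z := by simp only [LinearMap.neg_apply, M.b1]; ring
  bf s z := by simp only [LinearMap.neg_apply, M.bf, map_neg]; ring
  be1 s z := by simp only [LinearMap.neg_apply, M.be2, map_neg]; ring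
  be2 s z := by simp only [LinearMap.neg_apply, M.be1, map_neg]; ring
  x := M.y
  y := M.x
  Px := M.Qy
  Qx := M.Py
  Py := M.Qx
  Qy := M.Px
  xp := M.yp
  yp := M.xp
  ex := M.ey
  ey := M.ex
  unit := M.unit
  finA := M.finA
  quox := M.quoy
  quoy := M.quox

variable (M : MelData k A L)

theorem mel_order (I : ℕ → Ideal A) (N : ℕ) (hN : I N = ⊥) (hP : ∀ d g, g ∈ I (d+1) → M.P g ∈ I d)
    (hQ : ∀ d g, g ∈ I (d+1) → M.Q g ∈ I d) (hle : ∀ d, I (d+1) ≤ I d) (S : Set L)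
    (hstep : ∀ d g, 1 ≤ d → g ∈ I d → (∀ s ∈ S, M.d1 s * M.P g + M.d2 s * M.Q g ∈ I d) → g ∈ I (d+1))
    (z : L) (h1 : M.d1 z ∈ I 1) (h2 : M.d2 z ∈ I 1) (h3 : M.f z ∈ I 1) (h4 : M.e1 z ∈ I 1) (h5 : M.e2 z ∈ I 1)
    (hc : ∀ s ∈ S, ⁅s, z⁆ = 0) : z = 0 := by
  have key : ∀ d, M.d1 z ∈ I (d+1) ∧ M.d2 z ∈ I (d+1) ∧ M.f z ∈ I (d+1) ∧ M.e1 z ∈ I (d+1) ∧ M.e2 z ∈ I (d+1) := by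
    intro d
    induction d with
    | zero => exact ⟨h1, h2, h3, h4, h5⟩
    | succ d ih =>
      obtain ⟨i1, i2, i3, i4, i5⟩ := ih
      have q1 := Ideal.Quotient.eq_zero_iff_mem.2 i1
      have q2 := Ideal.Quotient.eq_zero_iff_mem.2 i2
      have q3 := Ideal.Quotient.eq_zero_iff_mem.2 i3
      have q4 := Ideal.Quotient.eq_zero_iff_mem.2 i4
      have q5 := Ideal.Quotient.eq_zero_iff_mem.2 i5
      have j1 : M.d1 z ∈ I (d+1+1) := hstep _ _ (by omega) i1 fun s hs => by
        have h := M.b1 s z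
        rw [hc s hs, map_zero] at h
        have h' := congrArg (Ideal.Quotient.mk (I (d+1))) h
        rw [← Ideal.Quotient.eq_zero_iff_mem]
        simp only [map_add, map_sub, map_mul, map_zero, q1, q2, q3, q4, q5] at h' ⊢
        linear_combination -h'
      have j2 : M.d2 z ∈ I (d+1+1) := hstep _ _ (by omega) i2 fun s hs => by
        have h := M.b2 s z
        rw [hc s hs, map_zero] at h
        have h' := congrArg (Ideal.Quotient.mk (I (d+1))) h
        rw [← Ideal.Quotient.eq_zero_iff_mem]
        simp only [map_add, map_sub, map_mul, map_zero, q1, q2, q3, q4, q5] at h' ⊢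
        linear_combination -h'
      have p1 := Ideal.Quotient.eq_zero_iff_mem.2 (hP _ _ j1)
      have p2 := Ideal.Quotient.eq_zero_iff_mem.2 (hQ _ _ j2)
      have p3 := Ideal.Quotient.eq_zero_iff_mem.2 (hQ _ _ j1)
      have p4 := Ideal.Quotient.eq_zero_iff_mem.2 (hP _ _ j2)
      have j3 : M.f z ∈ I (d+1+1) := hstep _ _ (by omega) i3 fun s hs => by
        have h := M.bf s z
        rw [hc s hs, map_zero] at h
        have h' := congrArg (Ideal.Quotient.mk (I (d+1))) h
        rw [← Ideal.Quotient.eq_zero_iff_mem]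
        simp only [map_add, map_sub, map_mul, map_zero, q1, q2, q3, q4, q5, p1, p2] at h' ⊢
        linear_combination -h'
      have p5 := Ideal.Quotient.eq_zero_iff_mem.2 (hP _ _ j3)
      have p6 := Ideal.Quotient.eq_zero_iff_mem.2 (hQ _ _ j3)
      refine ⟨j1, j2, j3, hstep _ _ (by omega) i4 fun s hs => ?_, hstep _ _ (by omega) i5 fun s hs => ?_⟩
      · have h := M.be1 s z
        rw [hc s hs, map_zero] at h
        have h' := congrArg (Ideal.Quotient.mk (I (d+1))) h
        rw [← Ideal.Quotient.eq_zero_iff_mem]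
        simp only [map_add, map_sub, map_mul, map_zero, q1, q2, q3, q4, q5, p1, p2, p3, p4, p5, p6] at h' ⊢
        linear_combination -h'
      · have h := M.be2 s z
        rw [hc s hs, map_zero] at h
        have h' := congrArg (Ideal.Quotient.mk (I (d+1))) h
        rw [← Ideal.Quotient.eq_zero_iff_mem]
        simp only [map_add, map_sub, map_mul, map_zero, q1, q2, q3, q4, q5, p1, p2, p3, p4, p5, p6] at h' ⊢
        linear_combination -h'
  obtain ⟨i1, i2, i3, i4, i5⟩ := key N
  have hb : ∀ a, a ∈ I (N + 1) → a = 0 := fun a ha => by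
    have := hle N ha
    rwa [hN] at this
  exact M.ext z (hb _ i1) (hb _ i2) (hb _ i3) (hb _ i4) (hb _ i5)

/-- one step of the chain -/
def mst (I : Ideal A) : Ideal A where
  carrier := {g | g ∈ I ∧ M.ε g = 0 ∧ M.P g ∈ I ∧ M.Q g ∈ I}
  add_mem' := fun ⟨a1, a2, a3, a4⟩ ⟨b1, b2, b3, b4⟩ => ⟨add_mem a1 b1, by rw [map_add, a2, b2, add_zero],
    by rw [map_add]; exact add_mem a3 b3, by rw [map_add]; exact add_mem a4 b4⟩
  zero_mem' := ⟨zero_mem _, map_zero _, by rw [map_zero]; exact zero_mem _, by rw [map_zero]; exact zero_mem _⟩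
  smul_mem' := fun c g ⟨a1, a2, a3, a4⟩ => ⟨Ideal.mul_mem_left _ _ a1, by rw [smul_eq_mul, map_mul, a2, mul_zero],
    by rw [smul_eq_mul, Derivation.leibniz]; exact add_mem (Ideal.mul_mem_left _ _ a3) (Ideal.mul_mem_right _ _ a1),
    by rw [smul_eq_mul, Derivation.leibniz]; exact add_mem (Ideal.mul_mem_left _ _ a4) (Ideal.mul_mem_right _ _ a1)⟩

/-- chain of ideals -/
def mch : ℕ → Ideal A
  | 0 => ⊤
  | d + 1 => mst M (mch d)

theorem mem_mch_succ {d : ℕ} {g : A} : g ∈ mch M (d+1) ↔ g ∈ mch M d ∧ M.ε g = 0 ∧ M.P g ∈ mch M d ∧ M.Q g ∈ mch M d :=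
  Iff.rfl

theorem mch_one {g : A} : g ∈ mch M 1 ↔ M.ε g = 0 := by
  rw [mem_mch_succ]
  simp [mch]

/-- two transversal elements and an element of nonnegative order -/
theorem mel_two {N : ℕ} (hN : mch M N = ⊥) (z1 z2 : L)
    (hd : M.ε (M.d1 z1) * M.ε (M.d2 z2) - M.ε (M.d2 z1) * M.ε (M.d1 z2) ≠ 0)
    (z : L) (h1 : M.ε (M.d1 z) = 0) (h2 : M.ε (M.d2 z) = 0) (h3 : M.ε (M.f z) = 0)
    (h4 : M.ε (M.e1 z) = 0) (h5 : M.ε (M.e2 z) = 0) (hc1 : ⁅z1, z⁆ = 0) (hc2 : ⁅z2, z⁆ = 0) : z = 0 := by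
  refine mel_order M (mch M) N hN (fun d g h => ((mem_mch_succ M).1 h).2.2.1)
    (fun d g h => ((mem_mch_succ M).1 h).2.2.2) (fun d g h => ((mem_mch_succ M).1 h).1) {z1, z2} ?_ z
    ((mch_one M).2 h1) ((mch_one M).2 h2) ((mch_one M).2 h3) ((mch_one M).2 h4) ((mch_one M).2 h5) ?_
  · intro d g hd1 hg h
    have g1 := h z1 (by simp)
    have g2 := h z2 (by simp)
    have hu : IsUnit (M.d1 z1 * M.d2 z2 - M.d2 z1 * M.d1 z2) := M.unit _ (by simpa using hd)
    have e1 : (M.d1 z1 * M.d2 z2 - M.d2 z1 * M.d1 z2) * M.P g ∈ mch M d := by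
      have : (M.d1 z1 * M.d2 z2 - M.d2 z1 * M.d1 z2) * M.P g = M.d2 z2 * (M.d1 z1 * M.P g + M.d2 z1 * M.Q g)
        - M.d2 z1 * (M.d1 z2 * M.P g + M.d2 z2 * M.Q g) := by ring
      rw [this]
      exact sub_mem (Ideal.mul_mem_left _ _ g1) (Ideal.mul_mem_left _ _ g2)
    have e2 : (M.d1 z1 * M.d2 z2 - M.d2 z1 * M.d1 z2) * M.Q g ∈ mch M d := by
      have : (M.d1 z1 * M.d2 z2 - M.d2 z1 * M.d1 z2) * M.Q g = M.d1 z1 * (M.d1 z2 * M.P g + M.d2 z2 * M.Q g)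
        - M.d1 z2 * (M.d1 z1 * M.P g + M.d2 z1 * M.Q g) := by ring
      rw [this]
      exact sub_mem (Ideal.mul_mem_left _ _ g2) (Ideal.mul_mem_left _ _ g1)
    obtain ⟨d, rfl⟩ : ∃ d', d = d' + 1 := ⟨d - 1, by omega⟩
    exact (mem_mch_succ M).2 ⟨hg, ((mem_mch_succ M).1 hg).2.1, (Ideal.unit_mul_mem_iff_mem _ hu).1 e1, (Ideal.unit_mul_mem_iff_mem _ hu).1 e2⟩
  · intro s hs
    rcases hs with rfl | rfl
    · exact hc1
    · exact hc2

/-- centralizer -/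
def centr (t : L) : Submodule k L := LinearMap.ker (LieAlgebra.ad k L t)

theorem mem_centr {t z : L} : z ∈ centr (k := k) t ↔ ⁅t, z⁆ = 0 := Iff.rfl

theorem mel_one [CharP k 5] (t : L) (ht : M.ε (M.d1 t) ≠ 0) (z : L) (hz : ⁅t, z⁆ = 0)
    (h1 : M.d1 z ∈ Ideal.span {M.x}) (h2 : M.d2 z ∈ Ideal.span {M.x}) (h3 : M.f z ∈ Ideal.span {M.x})
    (h4 : M.e1 z ∈ Ideal.span {M.x}) (h5 : M.e2 z ∈ Ideal.span {M.x}) : z = 0 := by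
  have hder : ∀ (D : Derivation k A A) d g, g ∈ Ideal.span {M.x ^ (d+1)} → D g ∈ Ideal.span {M.x ^ d} := by
    intro D d g hg
    rw [Ideal.mem_span_singleton] at hg ⊢
    obtain ⟨h, rfl⟩ := hg
    rw [Derivation.leibniz, Derivation.leibniz_pow]
    simp only [smul_eq_mul, nsmul_eq_mul, Nat.add_sub_cancel]
    exact ⟨M.x * D h + h * (((d + 1 : ℕ) : A) * D M.x), by ring⟩
  refine mel_order M (fun d => Ideal.span {M.x ^ d}) 5 (by simp [M.xp]) (hder _) (hder _) ?_ {t} ?_ z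
    (by simpa using h1) (by simpa using h2) (by simpa using h3) (by simpa using h4) (by simpa using h5)
    (by rintro s rfl; exact hz)
  · intro d
    rw [Ideal.span_singleton_le_span_singleton]
    exact pow_dvd_pow _ (by omega)
  · intro d g hd hg hs
    have h := hs t rfl
    simp only [Ideal.mem_span_singleton] at hg h ⊢
    obtain ⟨g, rfl⟩ := hg
    by_cases hd5 : 5 ≤ d
    · rw [pow_eq_zero_of_le hd5 M.xp, zero_mul]; exact dvd_zero _
    obtain ⟨d, rfl⟩ : ∃ d', d = d' + 1 := ⟨d - 1, by omega⟩
    have hu : IsUnit (((d + 1 : ℕ) : A) * M.d1 t) := by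
      refine M.unit _ ?_
      rw [map_mul, map_natCast]
      refine mul_ne_zero ?_ ht
      rw [Ne, CharP.cast_eq_zero_iff k 5]
      intro h
      have := Nat.le_of_dvd (by omega) h
      omega
    have h2 : M.x ^ (d+1) ∣ (((d + 1 : ℕ) : A) * M.d1 t) * (M.x ^ d * g) := by
      rw [Derivation.leibniz, Derivation.leibniz_pow, Derivation.leibniz, Derivation.leibniz_pow, M.Px, M.Qx] at h
      simp only [smul_eq_mul, nsmul_eq_mul, Nat.add_sub_cancel, mul_zero, add_zero] at h
      have := dvd_sub h (Dvd.intro (M.d1 t * M.P g + M.d2 t * M.Q g) rfl)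
      convert this using 1
      ring
    have h3 : M.x ^ (d+1) ∣ M.x ^ d * g := (hu.dvd_mul_left).1 h2
    have := mul_dvd_mul_left M.x h3
    rw [← pow_succ', ← mul_assoc, ← pow_succ'] at this
    exact this

theorem finrank_quo : Module.finrank k (A ⧸ Ideal.span {M.x}) ≤ 5 ∧ Module.Finite k (A ⧸ Ideal.span {M.x}) := by
  set φ : (Fin 5 → k) →ₗ[k] A ⧸ Ideal.span {M.x} :=
    Fintype.linearCombination k (fun j : Fin 5 => Ideal.Quotient.mk (Ideal.span {M.x}) (M.y ^ j.1)) with hφ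
  have hs : Function.Surjective φ := by
    intro b
    obtain ⟨g, rfl⟩ := Ideal.Quotient.mk_surjective b
    obtain ⟨c, h, hg⟩ := M.quox g
    refine ⟨c, ?_⟩
    rw [hφ, Fintype.linearCombination_apply, hg, map_add, map_sum, map_mul,
      Ideal.Quotient.eq_zero_iff_mem.2 (Ideal.mem_span_singleton_self M.x), zero_mul, add_zero]
    rfl
  refine ⟨?_, Module.Finite.of_surjective φ hs⟩
  have := LinearMap.finrank_le_finrank_of_surjective (f := φ) hs
  simpa using this

theorem centr_le [CharP k 5] [FiniteDimensional k L] (t : L) (ht : M.ε (M.d1 t) ≠ 0) : Module.finrank k (centr (k := k) t) ≤ 25 := by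
  obtain ⟨hB, hfin⟩ := finrank_quo M
  set q : A →ₗ[k] A ⧸ Ideal.span {M.x} := (Ideal.Quotient.mkₐ k (Ideal.span {M.x})).toLinearMap with hq
  have hq0 : ∀ a, q a = 0 → a ∈ Ideal.span {M.x} := fun a h => Ideal.Quotient.eq_zero_iff_mem.1 h
  set φ : centr (k := k) t →ₗ[k] (Fin 5 → A ⧸ Ideal.span {M.x}) :=
    (LinearMap.pi ![q ∘ₗ M.d1, q ∘ₗ M.d2, q ∘ₗ M.f, q ∘ₗ M.e1, q ∘ₗ M.e2]).domRestrict _ with hφ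
  have hinj : Function.Injective φ := by
    rw [← LinearMap.ker_eq_bot, LinearMap.ker_eq_bot']
    rintro ⟨z, hz⟩ h
    have := mel_one M t ht z hz (hq0 _ (congrFun h 0)) (hq0 _ (congrFun h 1)) (hq0 _ (congrFun h 2)) (hq0 _ (congrFun h 3))
      (hq0 _ (congrFun h 4))
    exact Subtype.ext this
  have := LinearMap.finrank_le_finrank_of_injective hinj
  rw [Module.finrank_pi_fintype] at this
  simp at this
  omega

theorem centr_le' [CharP k 5] [FiniteDimensional k L] (t : L) (ht : ¬ (M.ε (M.d1 t) = 0 ∧ M.ε (M.d2 t) = 0)) :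
    Module.finrank k (centr (k := k) t) ≤ 25 := by
  by_cases h : M.ε (M.d1 t) = 0
  · exact centr_le M.swap t (fun h' => ht ⟨h, h'⟩)
  · exact centr_le M t h

end Mel

section Mel2
variable {k : Type*} [Field k] {A : Type*} [CommRing A] [Algebra k A]
variable {L : Type*} [LieRing L] [LieAlgebra k L]
variable (M : MelData k A L)

theorem two_ne5 [CharP k 5] : (2 : k) ≠ 0 := by
  have : ((2 : ℕ) : k) ≠ 0 := by rw [Ne, CharP.cast_eq_zero_iff k 5]; omega
  exact_mod_cast this
theorem three_ne5 [CharP k 5] : (3 : k) ≠ 0 := by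
  have : ((3 : ℕ) : k) ≠ 0 := by rw [Ne, CharP.cast_eq_zero_iff k 5]; omega
  exact_mod_cast this
theorem five_eq5 [CharP k 5] : (5 : k) = 0 := by
  have : ((5 : ℕ) : k) = 0 := CharP.cast_eq_zero k 5
  exact_mod_cast this

theorem le74 (M : MelData k A L) [FiniteDimensional k L] (C : Submodule k L) (a b c : L →ₗ[k] A)
    (hinj : ∀ z ∈ C, a z = 0 → b z = 0 → c z = 0 → z = 0) (w : Fin 3 → A)
    (hw : ∀ z ∈ C, a z = w 0 → b z = w 1 → c z = w 2 → False) : Module.finrank k C ≤ 74 := by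
  have : FiniteDimensional k A := Module.finite_of_finrank_pos (by rw [M.finA]; norm_num)
  set φ : C →ₗ[k] (Fin 3 → A) := (LinearMap.pi ![a, b, c]).domRestrict C with hφ
  have hi : Function.Injective φ := by
    rw [← LinearMap.ker_eq_bot, LinearMap.ker_eq_bot']
    rintro ⟨z, hz⟩ h
    exact Subtype.ext (hinj z hz (congrFun h 0) (congrFun h 1) (congrFun h 2))
  have h75 : Module.finrank k (Fin 3 → A) = 75 := by
    rw [Module.finrank_pi_fintype]; simp [M.finA]
  have hle := LinearMap.finrank_le_finrank_of_injective hi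
  by_contra hlt
  have heq : Module.finrank k C = Module.finrank k (Fin 3 → A) := by omega
  obtain ⟨⟨z, hz⟩, h⟩ := (LinearMap.injective_iff_surjective_of_finrank_eq_finrank heq).1 hi w
  exact hw z hz (congrFun h 0) (congrFun h 1) (congrFun h 2)

theorem centr74f [CharP k 5] [FiniteDimensional k L] (t : L) (h1 : M.ε (M.d1 t) = 0) (h2 : M.ε (M.d2 t) = 0)
    (hf : M.ε (M.f t) ≠ 0) : Module.finrank k (centr (k := k) t) ≤ 74 := by
  have hu := M.unit _ hf
  refine le74 M _ M.d1 M.d2 M.f ?_ ![M.x, 0, 0] ?_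
  · intro z hz a b c
    rw [mem_centr] at hz
    have g1 := M.b1 t z
    have g2 := M.b2 t z
    rw [hz, a, b, c] at g1 g2
    refine M.ext z a b c (hu.mul_right_eq_zero.1 ?_) (hu.mul_right_eq_zero.1 ?_)
    · simpa using g1.symm
    · simpa using g2.symm
  · intro z hz a b c
    rw [mem_centr] at hz
    change M.d1 z = M.x at a
    change M.d2 z = 0 at b
    change M.f z = 0 at c
    have g1 := congrArg M.ε (M.b1 t z)
    have g2 := congrArg M.ε (M.b2 t z)
    have g3 := congrArg M.ε (M.bf t z)
    simp only [hz, a, b, c, map_add, map_sub, map_mul, map_zero, M.ex, h1, h2, M.Px, map_one, map_ofNat] at g1 g2 g3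
    have i1 : M.ε (M.e1 z) = 0 := by
      refine (mul_eq_zero.1 (?_ : M.ε (M.f t) * _ = 0)).resolve_left hf
      linear_combination -g1
    have i2 : M.ε (M.e2 z) = 0 := by
      refine (mul_eq_zero.1 (?_ : M.ε (M.f t) * _ = 0)).resolve_left hf
      linear_combination -g2
    rw [i1, i2] at g3
    refine mul_ne_zero two_ne5 hf ?_
    linear_combination -g3

theorem centr74e [CharP k 5] [FiniteDimensional k L] (t : L) (h1 : M.ε (M.d1 t) = 0) (h2 : M.ε (M.d2 t) = 0)
    (hf : M.ε (M.f t) = 0) (he : M.ε (M.e1 t) ≠ 0) : Module.finrank k (centr (k := k) t) ≤ 74 := by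
  have hu := M.unit _ he
  refine le74 M _ M.d1 M.d2 M.e1 ?_ ![M.x, M.y, 0] ?_
  · intro z hz a b c
    rw [mem_centr] at hz
    have g1 := M.b1 t z
    rw [hz, a, b, c] at g1
    have hfz : M.f z = 0 := by
      refine (hu.mul_left_eq_zero).1 ?_
      simpa using g1.symm
    have g2 := M.bf t z
    rw [hz, a, b, c, hfz] at g2
    refine M.ext z a b hfz c (hu.mul_right_eq_zero.1 ?_)
    simpa using g2.symm
  · intro z hz a b c
    rw [mem_centr] at hz
    change M.d1 z = M.x at a
    change M.d2 z = M.y at b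
    change M.e1 z = 0 at c
    have g1 := congrArg M.ε (M.b1 t z)
    have g3 := congrArg M.ε (M.bf t z)
    have g4 := congrArg M.ε (M.be1 t z)
    simp only [hz, a, b, c, map_add, map_sub, map_mul, map_zero, M.ex, M.ey, h1, h2, hf, M.Px, M.Py, M.Qx, M.Qy,
      map_one, map_ofNat] at g1 g3 g4
    have i1 : M.ε (M.f z) = 0 := by
      refine (mul_eq_zero.1 (?_ : M.ε (M.e1 t) * _ = 0)).resolve_left he
      linear_combination g1
    rw [i1] at g3 g4
    have i2 : M.ε (M.e2 z) = 0 := by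
      refine (mul_eq_zero.1 (?_ : M.ε (M.e1 t) * _ = 0)).resolve_left he
      linear_combination -g3
    rw [i2] at g4
    refine mul_ne_zero three_ne5 he ?_
    linear_combination g4

theorem centr74 [CharP k 5] [FiniteDimensional k L] (t : L) (h1 : M.ε (M.d1 t) = 0) (h2 : M.ε (M.d2 t) = 0)
    (h : ¬ (M.ε (M.f t) = 0 ∧ M.ε (M.e1 t) = 0 ∧ M.ε (M.e2 t) = 0)) : Module.finrank k (centr (k := k) t) ≤ 74 := by
  by_cases hf : M.ε (M.f t) = 0
  · by_cases he : M.ε (M.e1 t) = 0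
    · refine centr74e M.swap t h2 h1 ?_ ?_
      · change M.ε (-M.f t) = 0
        rw [map_neg, hf, neg_zero]
      · change M.ε (-M.e2 t) ≠ 0
        rw [map_neg, neg_ne_zero]
        exact fun h' => h ⟨hf, he, h'⟩
    · exact centr74e M t h1 h2 hf he
  · exact centr74f M t h1 h2 hf

/-- the value at zero -/
def MZero (z : L) : Prop := M.ε (M.d1 z) = 0 ∧ M.ε (M.d2 z) = 0 ∧ M.ε (M.f z) = 0 ∧ M.ε (M.e1 z) = 0 ∧ M.ε (M.e2 z) = 0

/-- commuting elements of order -2 -/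
theorem mel_comm2 {s t : L} (hst : ⁅s, t⁆ = 0) (s1 : M.ε (M.d1 s) = 0) (s2 : M.ε (M.d2 s) = 0)
    (t1 : M.ε (M.d1 t) = 0) (t2 : M.ε (M.d2 t) = 0) :
    M.ε (M.f s) * M.ε (M.e1 t) = M.ε (M.f t) * M.ε (M.e1 s) ∧ M.ε (M.f s) * M.ε (M.e2 t) = M.ε (M.f t) * M.ε (M.e2 s) ∧
    (M.ε (M.f s) = 0 → M.ε (M.f t) = 0 → M.ε (M.e1 s) * M.ε (M.e2 t) = M.ε (M.e2 s) * M.ε (M.e1 t)) := by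
  have g1 := congrArg M.ε (M.b1 s t)
  have g2 := congrArg M.ε (M.b2 s t)
  have g3 := congrArg M.ε (M.bf s t)
  simp only [hst, map_add, map_sub, map_mul, map_zero, s1, s2, t1, t2] at g1 g2 g3
  refine ⟨by linear_combination -g1, by linear_combination -g2, fun a b => ?_⟩
  rw [a, b] at g3
  linear_combination -g3

/-- the order -2 part of a torus is at most one-dimensional -/
theorem mel_rank1 (W : Submodule k L) (hab : ∀ s ∈ W, ∀ t ∈ W, ⁅s, t⁆ = 0)
    (h1 : ∀ s ∈ W, M.ε (M.d1 s) = 0) (h2 : ∀ s ∈ W, M.ε (M.d2 s) = 0) (h0 : ∀ s ∈ W, MZero M s → s = 0) :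
    ∃ t ∈ W, ∀ s ∈ W, ∃ c : k, s = c • t := by
  by_cases hf : ∃ t ∈ W, M.ε (M.f t) ≠ 0
  · obtain ⟨t, ht, htf⟩ := hf
    refine ⟨t, ht, fun s hs => ⟨M.ε (M.f s) / M.ε (M.f t), ?_⟩⟩
    rw [← sub_eq_zero]
    obtain ⟨a, b, -⟩ := mel_comm2 M (hab t ht s hs) (h1 t ht) (h2 t ht) (h1 s hs) (h2 s hs)
    refine h0 _ (sub_mem hs (W.smul_mem _ ht)) ⟨?_, ?_, ?_, ?_, ?_⟩
    · simp [h1 s hs, h1 t ht]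
    · simp [h2 s hs, h2 t ht]
    · simp only [map_sub, map_smul, smul_eq_mul]; field_simp; ring
    · simp only [map_sub, map_smul, smul_eq_mul]; field_simp; linear_combination a
    · simp only [map_sub, map_smul, smul_eq_mul]; field_simp; linear_combination b
  push Not at hf
  by_cases he : ∃ t ∈ W, M.ε (M.e1 t) ≠ 0
  · obtain ⟨t, ht, hte⟩ := he
    refine ⟨t, ht, fun s hs => ⟨M.ε (M.e1 s) / M.ε (M.e1 t), ?_⟩⟩
    rw [← sub_eq_zero]
    obtain ⟨-, -, c⟩ := mel_comm2 M (hab t ht s hs) (h1 t ht) (h2 t ht) (h1 s hs) (h2 s hs)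
    have c := c (hf t ht) (hf s hs)
    refine h0 _ (sub_mem hs (W.smul_mem _ ht)) ⟨?_, ?_, ?_, ?_, ?_⟩
    · simp [h1 s hs, h1 t ht]
    · simp [h2 s hs, h2 t ht]
    · simp [hf s hs, hf t ht]
    · simp only [map_sub, map_smul, smul_eq_mul]; field_simp; ring
    · simp only [map_sub, map_smul, smul_eq_mul]; field_simp; linear_combination c
  push Not at he
  by_cases he2 : ∃ t ∈ W, M.ε (M.e2 t) ≠ 0
  · obtain ⟨t, ht, hte⟩ := he2
    refine ⟨t, ht, fun s hs => ⟨M.ε (M.e2 s) / M.ε (M.e2 t), ?_⟩⟩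
    rw [← sub_eq_zero]
    refine h0 _ (sub_mem hs (W.smul_mem _ ht)) ⟨?_, ?_, ?_, ?_, ?_⟩
    · simp [h1 s hs, h1 t ht]
    · simp [h2 s hs, h2 t ht]
    · simp [hf s hs, hf t ht]
    · simp [he s hs, he t ht]
    · simp only [map_sub, map_smul, smul_eq_mul]; field_simp; ring
  push Not at he2
  exact ⟨0, W.zero_mem, fun s hs => ⟨0, by rw [smul_zero]; exact h0 s hs ⟨h1 s hs, h2 s hs, hf s hs, he s hs, he2 s hs⟩⟩⟩

end Mel2

section Mel3
variable {k : Type*} [Field k] {A : Type*} [CommRing A] [Algebra k A]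
variable {L : Type*} [LieRing L] [LieAlgebra k L]
variable (M : MelData k A L)

theorem eig2 {a b m p q r s u v w z x y : k} (hd : u * z - v * w ≠ 0)
    (F1 : p * u + q * v = a * u) (F2 : r * u + s * v = a * v)
    (G1 : p * w + q * z = b * w) (G2 : r * w + s * z = b * z)
    (E1 : p * x + q * y = m * x) (E2 : r * x + s * y = m * y) :
    (a - m) * (x * z - y * w) = 0 ∧ (b - m) * (u * y - v * x) = 0 := by
  constructor
  · refine (mul_eq_zero.1 (?_ : (u * z - v * w) * _ = 0)).resolve_left hd
    linear_combination (u * z - v * w) * (z * E1 - w * E2) - (x * z - y * w) * (z * F1 - w * F2)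
      - (u * y - v * x) * (z * G1 - w * G2)
  · refine (mul_eq_zero.1 (?_ : (u * z - v * w) * _ = 0)).resolve_left hd
    linear_combination (u * z - v * w) * (u * E2 - v * E1) - (x * z - y * w) * (u * F2 - v * F1)
      - (u * y - v * x) * (u * G2 - v * G1)

theorem tr2 {a b p q r s u v w z : k} (hd : u * z - v * w ≠ 0)
    (F1 : p * u + q * v = a * u) (F2 : r * u + s * v = a * v)
    (G1 : p * w + q * z = b * w) (G2 : r * w + s * z = b * z) : p + s = a + b := by
  rw [← sub_eq_zero]
  refine (mul_eq_zero.1 (?_ : (u * z - v * w) * _ = 0)).resolve_left hd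
  linear_combination z * F1 - w * F2 + u * G2 - v * G1

theorem zero2 {u v w z x y : k} (hd : u * z - v * w ≠ 0) (h1 : x * z - y * w = 0) (h2 : u * y - v * x = 0) :
    x = 0 ∧ y = 0 := by
  constructor
  · refine (mul_eq_zero.1 (?_ : (u * z - v * w) * _ = 0)).resolve_left hd
    linear_combination u * h1 + w * h2
  · refine (mul_eq_zero.1 (?_ : (u * z - v * w) * _ = 0)).resolve_left hd
    linear_combination v * h1 + z * h2

theorem mel_eig {t z : L} (ht : MZero M t) {c : k} (h : ⁅t, z⁆ = c • z) :
    M.ε (M.P (M.d1 t)) * M.ε (M.d1 z) + M.ε (M.Q (M.d1 t)) * M.ε (M.d2 z) = -c * M.ε (M.d1 z) ∧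
    M.ε (M.P (M.d2 t)) * M.ε (M.d1 z) + M.ε (M.Q (M.d2 t)) * M.ε (M.d2 z) = -c * M.ε (M.d2 z) := by
  obtain ⟨h1, h2, h3, h4, h5⟩ := ht
  have g1 := congrArg M.ε (M.b1 t z)
  have g2 := congrArg M.ε (M.b2 t z)
  simp only [h, map_smul, smul_eq_mul, map_add, map_sub, map_mul, map_zero, h1, h2, h3, h4, h5] at g1 g2
  exact ⟨by linear_combination g1, by linear_combination g2⟩

theorem mel_comm {t z : L} (ht : MZero M t) (h : ⁅t, z⁆ = 0) (z1 : M.ε (M.d1 z) = 0) (z2 : M.ε (M.d2 z) = 0) :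
    2 * (M.ε (M.P (M.d1 t)) + M.ε (M.Q (M.d2 t))) * M.ε (M.f z) = 0 ∧
    (M.ε (M.f z) = 0 →
      M.ε (M.P (M.d1 t)) * M.ε (M.e1 z) + M.ε (M.Q (M.d1 t)) * M.ε (M.e2 z)
        = 2 * (M.ε (M.P (M.d1 t)) + M.ε (M.Q (M.d2 t))) * M.ε (M.e1 z) ∧
      M.ε (M.P (M.d2 t)) * M.ε (M.e1 z) + M.ε (M.Q (M.d2 t)) * M.ε (M.e2 z)
        = 2 * (M.ε (M.P (M.d1 t)) + M.ε (M.Q (M.d2 t))) * M.ε (M.e2 z)) := by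
  obtain ⟨h1, h2, h3, h4, h5⟩ := ht
  have g1 := congrArg M.ε (M.bf t z)
  have g2 := congrArg M.ε (M.be1 t z)
  have g3 := congrArg M.ε (M.be2 t z)
  simp only [h, z1, z2, map_add, map_sub, map_mul, map_zero, map_ofNat, h1, h2, h3, h4, h5] at g1 g2 g3
  refine ⟨by linear_combination g1, fun hf => ?_⟩
  rw [hf] at g2 g3
  exact ⟨by linear_combination g2, by linear_combination g3⟩

/-- the torus bound when the isotropy part is nonzero -/
theorem mel_upA [CharP k 5] [FiniteDimensional k L] {N : ℕ} (hN : mch M N = ⊥)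
    (T : Submodule k L) (hab : ∀ s ∈ T, ∀ t ∈ T, ⁅s, t⁆ = 0) (z1 z2 : L)
    (hd : M.ε (M.d1 z1) * M.ε (M.d2 z2) - M.ε (M.d2 z1) * M.ε (M.d1 z2) ≠ 0)
    (χ1 χ2 : T →ₗ[k] k) (h1 : ∀ t : T, ⁅(t : L), z1⁆ = χ1 t • z1) (h2 : ∀ t : T, ⁅(t : L), z2⁆ = χ2 t • z2)
    (hne : ∃ t : T, t ≠ 0 ∧ MZero M t) : Module.finrank k T ≤ 2 := by
  set e := M.ε.toLinearMap with he
  set D1 : T →ₗ[k] k := e ∘ₗ M.d1 ∘ₗ T.subtype with hD1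
  set D2 : T →ₗ[k] k := e ∘ₗ M.d2 ∘ₗ T.subtype with hD2
  set F : T →ₗ[k] k := e ∘ₗ M.f ∘ₗ T.subtype with hF
  set G1 : T →ₗ[k] k := e ∘ₗ M.e1 ∘ₗ T.subtype with hG1
  set G2 : T →ₗ[k] k := e ∘ₗ M.e2 ∘ₗ T.subtype with hG2
  set u := M.ε (M.d1 z1)
  set v := M.ε (M.d2 z1)
  set w := M.ε (M.d1 z2)
  set z := M.ε (M.d2 z2)
  set C1 : T →ₗ[k] k := z • D1 - w • D2 with hC1
  set C2 : T →ₗ[k] k := u • D2 - v • D1 with hC2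
  set B1 : T →ₗ[k] k := z • G1 - w • G2 with hB1
  set B2 : T →ₗ[k] k := u • G2 - v • G1 with hB2
  have two0 : (2 : k) ≠ 0 := two_ne5
  have three0 : (3 : k) ≠ 0 := three_ne5
  have zv : ∀ s : T, C1 s = 0 → C2 s = 0 → D1 s = 0 ∧ D2 s = 0 := fun s a b => by
    refine zero2 hd ?_ ?_
    · simpa [hC1, mul_comm] using a
    · simpa [hC2, mul_comm] using b
  have mz : ∀ s : T, C1 s = 0 → C2 s = 0 → F s = 0 → B1 s = 0 → B2 s = 0 → MZero M s := by
    intro s c1 c2 f b1 b2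
    obtain ⟨a, b⟩ := zv s c1 c2
    have : G1 s = 0 ∧ G2 s = 0 := by
      refine zero2 hd ?_ ?_
      · simpa [hB1, mul_comm] using b1
      · simpa [hB2, mul_comm] using b2
    exact ⟨a, b, f, this.1, this.2⟩
  have sep : ∀ s : T, MZero M s → χ1 s = 0 → χ2 s = 0 → s = 0 := by
    intro s ⟨a1, a2, a3, a4, a5⟩ c1 c2
    refine Subtype.ext (mel_two M hN z1 z2 hd s a1 a2 a3 a4 a5 ?_ ?_)
    · rw [← lie_skew, h1, c1, zero_smul, neg_zero]
    · rw [← lie_skew, h2, c2, zero_smul, neg_zero]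
  have main : ∀ t s : T, MZero M t → χ1 t * C1 s = 0 ∧ χ2 t * C2 s = 0 ∧
      (C1 s = 0 → C2 s = 0 → (χ1 t + χ2 t) * F s = 0 ∧
        (F s = 0 → (χ1 t + 2 * χ2 t) * B1 s = 0 ∧ (2 * χ1 t + χ2 t) * B2 s = 0)) := by
    intro t s ht
    have hc : ⁅(t : L), (s : L)⁆ = 0 := hab _ t.2 _ s.2
    obtain ⟨f1, f2⟩ := mel_eig M ht (h1 t)
    obtain ⟨g1, g2⟩ := mel_eig M ht (h2 t)
    obtain ⟨e1, e2⟩ := mel_eig M ht (c := 0) (z := s) (by rw [hc, zero_smul])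
    obtain ⟨i1, i2⟩ := eig2 hd f1 f2 g1 g2 e1 e2
    have htr := tr2 hd f1 f2 g1 g2
    refine ⟨?_, ?_, fun c1 c2 => ?_⟩
    · change χ1 t * (z * M.ε (M.d1 s) - w * M.ε (M.d2 s)) = 0
      linear_combination -i1
    · change χ2 t * (u * M.ε (M.d2 s) - v * M.ε (M.d1 s)) = 0
      linear_combination -i2
    · obtain ⟨a, b⟩ := zv s c1 c2
      obtain ⟨j1, j2⟩ := mel_comm M ht hc a b
      rw [htr] at j1 j2
      refine ⟨?_, fun hf => ?_⟩
      · refine (mul_eq_zero.1 (?_ : (2 : k) * _ = 0)).resolve_left two0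
        change 2 * ((χ1 t + χ2 t) * M.ε (M.f s)) = 0
        linear_combination -j1
      · obtain ⟨j3, j4⟩ := j2 hf
        obtain ⟨l1, l2⟩ := eig2 hd f1 f2 g1 g2 j3 j4
        constructor
        · change (χ1 t + 2 * χ2 t) * (z * M.ε (M.e1 s) - w * M.ε (M.e2 s)) = 0
          linear_combination l1
        · change (2 * χ1 t + χ2 t) * (u * M.ε (M.e2 s) - v * M.ε (M.e1 s)) = 0
          linear_combination l2
  have fin2 : ∀ φ ψ : T →ₗ[k] k, (∀ s, φ s = 0 → ψ s = 0 → s = 0) → Module.finrank k T ≤ 2 := by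
    intro φ ψ h
    have := finrank_le_of_sep ![φ, ψ] (fun s hs => h s (hs 0) (hs 1))
    simpa using this
  by_cases hbig : ∃ t : T, MZero M t ∧ χ1 t = 1 ∧ χ2 t = 1
  · obtain ⟨t, ht, c1, c2⟩ := hbig
    refine fin2 χ1 χ2 fun s a b => sep s ?_ a b
    obtain ⟨m1, m2, m3⟩ := main t s ht
    rw [c1, one_mul] at m1
    rw [c2, one_mul] at m2
    obtain ⟨m4, m5⟩ := m3 m1 m2
    rw [c1, c2] at m4 m5
    have hf : F s = 0 := (mul_eq_zero.1 m4).resolve_left (by norm_num; exact two0)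
    obtain ⟨m6, m7⟩ := m5 hf
    exact mz s m1 m2 hf ((mul_eq_zero.1 m6).resolve_left (by norm_num; exact three0))
      ((mul_eq_zero.1 m7).resolve_left (by norm_num; exact three0))
  obtain ⟨t, t0, ht⟩ := hne
  -- the isotropy part is a line
  have mzs : ∀ (c : k) (s : T), MZero M s → MZero M (c • s : T) := by
    intro c s ⟨a1, a2, a3, a4, a5⟩
    refine ⟨?_, ?_, ?_, ?_, ?_⟩ <;> simp [a1, a2, a3, a4, a5]
  have mza : ∀ (s s' : T), MZero M s → MZero M s' → MZero M (s + s' : T) := by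
    intro s s' ⟨a1, a2, a3, a4, a5⟩ ⟨b1, b2, b3, b4, b5⟩
    refine ⟨?_, ?_, ?_, ?_, ?_⟩ <;> simp [a1, a2, a3, a4, a5, b1, b2, b3, b4, b5]
  have line : ∀ s : T, MZero M s → χ1 t * χ2 s - χ2 t * χ1 s = 0 := by
    intro s hs
    by_contra hdet
    apply hbig
    set d := χ1 t * χ2 s - χ2 t * χ1 s
    refine ⟨(d⁻¹ * (χ2 s - χ1 s)) • t + (d⁻¹ * (χ1 t - χ2 t)) • s, mza _ _ (mzs _ _ ht) (mzs _ _ hs), ?_, ?_⟩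
    · simp only [map_add, map_smul, smul_eq_mul]
      have : d⁻¹ * d = 1 := inv_mul_cancel₀ hdet
      linear_combination this
    · simp only [map_add, map_smul, smul_eq_mul]
      have : d⁻¹ * d = 1 := inv_mul_cancel₀ hdet
      linear_combination this
  have hψ : ∃ ψ : T →ₗ[k] k, ∀ s : T, MZero M s → ψ s = 0 → s = 0 := by
    by_cases c1 : χ1 t = 0
    · have c2 : χ2 t ≠ 0 := fun c2 => t0 (sep t ht c1 c2)
      refine ⟨χ2, fun s hs h => sep s hs ?_ h⟩
      have := line s hs
      rw [c1] at this
      refine (mul_eq_zero.1 (?_ : χ2 t * _ = 0)).resolve_left c2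
      linear_combination -this
    · refine ⟨χ1, fun s hs h => sep s hs h ?_⟩
      have := line s hs
      rw [h] at this
      refine (mul_eq_zero.1 (?_ : χ1 t * _ = 0)).resolve_left c1
      linear_combination this
  obtain ⟨ψ, hψ⟩ := hψ
  have hφ : ∃ φ : T →ₗ[k] k, ∀ s : T, φ s = 0 → MZero M s := by
    have nz : ¬ (χ1 t = 0 ∧ χ2 t = 0) := fun h => t0 (sep t ht h.1 h.2)
    have M0 : ∀ {a b : k}, a * b = 0 → a ≠ 0 → b = 0 := fun h h' => (mul_eq_zero.1 h).resolve_left h'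
    by_cases c1 : χ1 t = 0
    · have c2 : χ2 t ≠ 0 := fun h => nz ⟨c1, h⟩
      refine ⟨C1, fun s hs => ?_⟩
      obtain ⟨-, m2, m3⟩ := main t s ht
      have i2 := M0 m2 c2
      obtain ⟨m4, m5⟩ := m3 hs i2
      rw [c1, zero_add] at m4
      rw [c1] at m5
      have hf := M0 m4 c2
      obtain ⟨m6, m7⟩ := m5 hf
      exact mz s hs i2 hf (M0 m6 (by rw [zero_add]; exact mul_ne_zero two0 c2))
        (M0 m7 (by rw [mul_zero, zero_add]; exact c2))
    by_cases c2 : χ2 t = 0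
    · refine ⟨C2, fun s hs => ?_⟩
      obtain ⟨m1, -, m3⟩ := main t s ht
      have i1 := M0 m1 c1
      obtain ⟨m4, m5⟩ := m3 i1 hs
      rw [c2, add_zero] at m4
      rw [c2] at m5
      have hf := M0 m4 c1
      obtain ⟨m6, m7⟩ := m5 hf
      exact mz s i1 hs hf (M0 m6 (by rw [mul_zero, add_zero]; exact c1))
        (M0 m7 (by rw [add_zero]; exact mul_ne_zero two0 c1))
    have i1 : ∀ s, C1 s = 0 := fun s => M0 (main t s ht).1 c1
    have i2 : ∀ s, C2 s = 0 := fun s => M0 (main t s ht).2.1 c2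
    by_cases c3 : χ1 t + χ2 t = 0
    · refine ⟨F, fun s hs => ?_⟩
      obtain ⟨m6, m7⟩ := ((main t s ht).2.2 (i1 s) (i2 s)).2 hs
      refine mz s (i1 s) (i2 s) hs (M0 m6 fun h => c2 ?_) (M0 m7 fun h => c1 ?_)
      · linear_combination h - c3
      · linear_combination h - c3
    have i3 : ∀ s, F s = 0 := fun s => M0 ((main t s ht).2.2 (i1 s) (i2 s)).1 c3
    have i4 := fun s => ((main t s ht).2.2 (i1 s) (i2 s)).2 (i3 s)
    by_cases c4 : χ1 t + 2 * χ2 t = 0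
    · refine ⟨B1, fun s hs => mz s (i1 s) (i2 s) (i3 s) hs (M0 (i4 s).2 fun h => ?_)⟩
      refine mul_ne_zero three0 c2 ?_
      linear_combination 2 * c4 - h
    · exact ⟨B2, fun s hs => mz s (i1 s) (i2 s) (i3 s) (M0 (i4 s).1 c4) hs⟩
  obtain ⟨φ, hφ⟩ := hφ
  exact fin2 φ ψ fun s a b => hψ s (hφ s a) b

end Mel3

instance fact5 : Fact (Nat.Prime 5) := ⟨by norm_num⟩

/-- pairing of vectors over the prime field -/
def dot5 (a n : Fin 3 → ZMod 5) : ZMod 5 := ∑ j, n j * a j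

theorem ker5 (a : Fin 3 → ZMod 5) : 25 ≤ (Finset.univ.filter fun n => dot5 a n = 0).card := by
  set φ : (Fin 3 → ZMod 5) →ₗ[ZMod 5] ZMod 5 :=
    ∑ j, a j • LinearMap.proj j with hφ
  have h1 := LinearMap.finrank_range_add_finrank_ker φ
  have h2 : Module.finrank (ZMod 5) (LinearMap.range φ) ≤ 1 := by
    have := Submodule.finrank_le (LinearMap.range φ)
    simpa using this
  have h3 : 2 ≤ Module.finrank (ZMod 5) (LinearMap.ker φ) := by
    simp at h1; omega
  have h4 : Nat.card (LinearMap.ker φ) = 5 ^ Module.finrank (ZMod 5) (LinearMap.ker φ) := by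
    rw [Module.natCard_eq_pow_finrank (K := ZMod 5)]; simp
  have h5 : (Finset.univ.filter fun n => dot5 a n = 0).card = Nat.card (LinearMap.ker φ) := by
    refine (Nat.subtype_card _ fun n => ?_).symm
    rw [Finset.mem_filter, LinearMap.mem_ker]
    have : φ n = dot5 a n := by
      simp [hφ, dot5, mul_comm]
    rw [this]
    simp
  rw [h5, h4]
  calc 25 = 5 ^ 2 := by norm_num
    _ ≤ _ := Nat.pow_le_pow_right (by norm_num) h3

theorem count5 (a : Fin 125 → Fin 3 → ZMod 5) (h0 : 3 ≤ (Finset.univ.filter fun i => a i = 0).card)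
    (B : Finset (Fin 3 → ZMod 5)) (hB : B.card ≤ 4) (hB0 : 0 ∉ B)
    (h74 : ∀ n ∈ B, (Finset.univ.filter fun i => dot5 (a i) n = 0).card ≤ 74)
    (h25 : ∀ n, n ∉ B → n ≠ 0 → (Finset.univ.filter fun i => dot5 (a i) n = 0).card ≤ 25) : False := by
  set g : (Fin 3 → ZMod 5) → ℕ := fun n => (Finset.univ.filter fun i => dot5 (a i) n = 0).card with hg
  have e1 : ∑ n, g n = ∑ i, (Finset.univ.filter fun n => dot5 (a i) n = 0).card := by
    simp only [hg, Finset.card_filter]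
    rw [Finset.sum_comm]
  have low : 3425 ≤ ∑ i, (Finset.univ.filter fun n => dot5 (a i) n = 0).card := by
    have : ∀ i, 25 + (if a i = 0 then 100 else 0) ≤ (Finset.univ.filter fun n => dot5 (a i) n = 0).card := by
      intro i
      split_ifs with h
      · have : (Finset.univ.filter fun n => dot5 (a i) n = 0) = Finset.univ := by
          rw [Finset.filter_true_of_mem]
          intro n _
          simp [dot5, h]
        rw [this, Finset.card_univ]
        simp
      · exact ker5 _
    refine le_trans ?_ (Finset.sum_le_sum fun i _ => this i)
    rw [Finset.sum_add_distrib, ← Finset.sum_filter]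
    simp only [Finset.sum_const, smul_eq_mul, Finset.card_univ, Fintype.card_fin]
    omega
  have up : ∑ n, g n ≤ 3421 := by
    have : ∀ n, g n ≤ 25 + (if n ∈ B then 49 else 0) + (if n = 0 then 100 else 0) := by
      intro n
      by_cases h : n = 0
      · subst h
        rw [if_neg hB0, if_pos rfl]
        refine le_trans (Finset.card_le_univ _) ?_
        simp
      · by_cases hn : n ∈ B
        · rw [if_pos hn, if_neg h]; exact h74 n hn
        · rw [if_neg hn, if_neg h]; exact h25 n hn h
    refine le_trans (Finset.sum_le_sum fun i _ => this i) ?_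
    rw [Finset.sum_add_distrib, Finset.sum_add_distrib, ← Finset.sum_filter, ← Finset.sum_filter]
    have hc : Fintype.card (Fin 3 → ZMod 5) = 125 := by simp
    have hb : (Finset.univ.filter fun n => n ∈ B).card = B.card := by
      rw [Finset.filter_mem_eq_inter, Finset.univ_inter]
    have hz : (Finset.univ.filter fun n : Fin 3 → ZMod 5 => n = 0).card = 1 := by
      rw [Finset.filter_eq']; simp
    simp only [Finset.sum_const, smul_eq_mul, Finset.card_univ, hc, hb, hz]
    omega
  omega

section Wt
variable {k : Type*} [Field k] {L : Type*} [LieRing L] [LieAlgebra k L] [FiniteDimensional k L]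

theorem wt_card {ι : Type*} [Fintype ι] (b : Module.Basis ι k L) (c : ι → k) (t : L)
    (h : ∀ i, ⁅t, b i⁆ = c i • b i) (S : Finset ι) (hS : ∀ i ∈ S, c i = 0) :
    S.card ≤ Module.finrank k (centr (k := k) t) := by
  have hli : LinearIndependent k (fun i : S => b i) := b.linearIndependent.comp _ Subtype.val_injective
  set v : S → centr (k := k) t := fun i => ⟨b i, mem_centr.2 (by rw [h, hS i i.2, zero_smul])⟩ with hv
  have hv' : LinearIndependent k v := by
    refine LinearIndependent.of_comp (centr (k := k) t).subtype ?_
    exact hli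
  have := hv'.fintype_card_le_finrank
  simpa using this

theorem zero_wt_card {ι : Type*} [Fintype ι] (b : Module.Basis ι k L) (T : Submodule k L)
    (hab : ∀ s ∈ T, ∀ t ∈ T, ⁅s, t⁆ = 0) (χ : ι → T →ₗ[k] k)
    (h : ∀ i (t : T), ⁅(t : L), b i⁆ = χ i t • b i) (S : Finset ι) (hS : ∀ i, χ i = 0 → i ∈ S) :
    Module.finrank k T ≤ S.card := by
  have key : ∀ s ∈ T, ∀ i, i ∉ S → b.repr s i = 0 := by
    intro s hs i hi
    have hi' : χ i ≠ 0 := fun h => hi (hS i h)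
    obtain ⟨t, ht⟩ : ∃ t, χ i t ≠ 0 := by
      by_contra hc
      push Not at hc
      exact hi' (LinearMap.ext hc)
    have h1 : ⁅(t : L), s⁆ = ∑ j, (b.repr s j * χ j t) • b j := by
      conv_lhs => rw [← b.sum_repr s]
      rw [lie_sum]
      refine Finset.sum_congr rfl fun j _ => ?_
      rw [lie_smul, h, smul_smul]
    rw [hab _ t.2 _ hs] at h1
    have := Fintype.linearIndependent_iff.1 b.linearIndependent _ h1.symm i
    exact (mul_eq_zero.1 this).resolve_right ht
  have : ∀ s : T, (∀ i : S, (b.coord i ∘ₗ T.subtype) s = 0) → s = 0 := by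
    intro s hs
    refine Subtype.ext (b.ext_elem fun i => ?_)
    rw [ZeroMemClass.coe_zero, map_zero, Finsupp.zero_apply]
    by_cases hi : i ∈ S
    · exact hs ⟨i, hi⟩
    · exact key s s.2 i hi
  have := finrank_le_of_sep (fun i : S => b.coord i ∘ₗ T.subtype) this
  simpa using this

theorem pow5_mem [CharP k 5] (x : k) (h : x ^ 5 = x) : ∃ n : ZMod 5, ZMod.castHom (dvd_refl 5) k n = x := by
  set φ := ZMod.castHom (dvd_refl 5) k with hφ
  have hinj : Function.Injective φ := φ.injective
  by_contra hc
  push Not at hc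
  have h0 : x ≠ 0 := fun h => hc 0 (by rw [map_zero, h])
  have key : x * (x - 1) * (x - 2) * (x - 3) * (x - 4) = 0 := by
    have five : (5 : k) = 0 := five_eq5
    linear_combination h + (-2 * x ^ 4 + 7 * x ^ 3 - 10 * x ^ 2 + 5 * x) * five
  simp only [mul_eq_zero, sub_eq_zero] at key
  rcases key with (((h | h) | h) | h) | h
  · exact h0 h
  · exact hc 1 (by rw [map_one, h])
  · exact hc 2 (by rw [map_ofNat, h])
  · exact hc 3 (by rw [map_ofNat, h])
  · exact hc 4 (by rw [map_ofNat, h])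

end Wt

section Mel4
variable {k : Type*} [Field k] {A : Type*} [CommRing A] [Algebra k A]
variable {L : Type*} [LieRing L] [LieAlgebra k L]
variable (M : MelData k A L)

theorem mel_le3 [CharP k 5] [FiniteDimensional k L] (T : Submodule k L) (hab : ∀ s ∈ T, ∀ t ∈ T, ⁅s, t⁆ = 0)
    (h0 : ∀ s ∈ T, MZero M s → s = 0) :
    Module.finrank k T ≤ 3 ∧ ∃ t ∈ T, ∀ s ∈ T, M.ε (M.d1 s) = 0 → M.ε (M.d2 s) = 0 → ∃ c : k, s = c • t := by
  set D1 : T →ₗ[k] k := M.ε.toLinearMap ∘ₗ M.d1 ∘ₗ T.subtype with hD1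
  set D2 : T →ₗ[k] k := M.ε.toLinearMap ∘ₗ M.d2 ∘ₗ T.subtype with hD2
  set W : Submodule k L := (LinearMap.ker D1 ⊓ LinearMap.ker D2).map T.subtype with hW
  have hWT : ∀ s ∈ W, s ∈ T := by
    rintro _ ⟨s, -, rfl⟩; exact s.2
  obtain ⟨t, ht, hs⟩ := mel_rank1 M W (fun s hs t ht => hab s (hWT s hs) t (hWT t ht))
    (by rintro _ ⟨s, hs, rfl⟩; exact hs.1) (by rintro _ ⟨s, hs, rfl⟩; exact hs.2)
    (fun s hs => h0 s (hWT s hs))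
  have hs' : ∀ s ∈ T, M.ε (M.d1 s) = 0 → M.ε (M.d2 s) = 0 → ∃ c : k, s = c • t := by
    intro s hsT a b
    exact hs s ⟨⟨s, hsT⟩, ⟨a, b⟩, rfl⟩
  refine ⟨?_, t, hWT t ht, hs'⟩
  obtain ⟨ψ, hψ⟩ : ∃ ψ : L →ₗ[k] k, t ≠ 0 → ψ t ≠ 0 := by
    by_cases h : t = 0
    · exact ⟨0, fun h' => absurd h h'⟩
    · by_contra hc
      push Not at hc
      exact h ((Module.forall_dual_apply_eq_zero_iff k t).1 fun ψ => (hc ψ).2)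
  have := finrank_le_of_sep ![D1, D2, ψ ∘ₗ T.subtype] fun s h => by
    obtain ⟨c, hc⟩ := hs' s s.2 (h 0) (h 1)
    have h2 : ψ s = 0 := h 2
    rw [hc, map_smul, smul_eq_mul, mul_eq_zero] at h2
    refine Subtype.ext ?_
    rw [ZeroMemClass.coe_zero, hc]
    rcases h2 with h2 | h2
    · rw [h2, zero_smul]
    · by_cases h : t = 0
      · rw [h, smul_zero]
      · exact absurd h2 (hψ h)
  simpa using this

theorem mel_upB [CharP k 5] [FiniteDimensional k L] {op : L → L} (hop : IsPMap 5 k op)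
    (hcent : ∀ x : L, (∀ y : L, ⁅x, y⁆ = 0) → x = 0)
    (T : Submodule k L) (hab : ∀ s ∈ T, ∀ t ∈ T, ⁅s, t⁆ = 0) (hT : ∀ s ∈ T, op s ∈ T)
    (h0 : ∀ s ∈ T, MZero M s → s = 0) (b : Module.Basis (Fin 125) k L) (χ : Fin 125 → T →ₗ[k] k)
    (hχ : ∀ i (t : T), ⁅(t : L), b i⁆ = χ i t • b i) : Module.finrank k T ≤ 2 := by
  classical
  obtain ⟨h3, t0, ht0, hline⟩ := mel_le3 M T hab h0
  by_contra hgt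
  have h3 : Module.finrank k T = 3 := by omega
  have sep : ∀ s : T, (∀ i, χ i s = 0) → s = 0 := by
    intro s hs
    refine Subtype.ext (hcent _ fun y => ?_)
    rw [← b.sum_repr y, lie_sum]
    refine Finset.sum_eq_zero fun i _ => ?_
    rw [lie_smul, hχ, hs, zero_smul, smul_zero]
  have hχop : ∀ i (s : T), χ i ⟨op s, hT s s.2⟩ = χ i s ^ 5 := by
    intro i s
    have h1 := hχ i ⟨op s, hT s s.2⟩
    have h2 : ⁅op (s : L), b i⁆ = χ i s ^ 5 • b i := by
      have : ∀ n : ℕ, ((LieAlgebra.ad k L (s : L)) ^ n) (b i) = χ i s ^ n • b i := by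
        intro n
        induction n with
        | zero => simp
        | succ n ih =>
          rw [pow_succ', Module.End.mul_apply, ih, map_smul, LieAlgebra.ad_apply, hχ, smul_smul, pow_succ]
      rw [← this, ← hop.ad_op, LieAlgebra.ad_apply]
    have h3 : (χ i ⟨op s, hT s s.2⟩ - χ i s ^ 5) • b i = 0 := by
      rw [sub_smul, ← h2, ← h1, sub_self]
    rw [← sub_eq_zero]
    exact (smul_eq_zero.1 h3).resolve_right (b.ne_zero i)
  -- three independent weights and the dual basis
  obtain ⟨ix, hix⟩ : ∃ ix : Fin 3 → Fin 125, ∀ s : T, (∀ j, χ (ix j) s = 0) → s = 0 := by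
    have hspan : Submodule.span k (Set.range χ) = ⊤ := by
      have h1 := Subspace.finrank_add_finrank_dualCoannihilator_eq (Submodule.span k (Set.range χ))
      have h2 : (Submodule.span k (Set.range χ)).dualCoannihilator = ⊥ := by
        rw [eq_bot_iff]
        intro s hs
        rw [Submodule.mem_dualCoannihilator] at hs
        exact sep s fun i => hs _ (Submodule.subset_span ⟨i, rfl⟩)
      rw [h2, finrank_bot, add_zero] at h1
      refine Submodule.eq_top_of_finrank_eq ?_
      rw [h1, Subspace.dual_finrank_eq]
    obtain ⟨y, hy, bb, hbb⟩ := exists_basis_of_span (LinearMap.id (M := Module.Dual k T)) Function.surjective_id hspan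
      (ι := Fin 3) (by rw [Subspace.dual_finrank_eq, h3]; simp)
    choose ix hix using hy
    refine ⟨ix, fun s hs => sep s fun i => ?_⟩
    have h : ∀ φ : Module.Dual k T, φ s = 0 := by
      intro φ
      rw [← bb.sum_repr φ, LinearMap.sum_apply]
      refine Finset.sum_eq_zero fun j _ => ?_
      rw [LinearMap.smul_apply, hbb, LinearMap.id_apply, ← hix, hs, smul_zero]
    exact h _
  have hinj : Function.Injective (LinearMap.pi fun j => χ (ix j)) := by
    rw [injective_iff_map_eq_zero]
    exact fun s hs => hix s fun j => congrFun hs j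
  have hsurj : Function.Surjective (LinearMap.pi fun j => χ (ix j)) :=
    (LinearMap.injective_iff_surjective_of_finrank_eq_finrank (by rw [h3]; simp)).1 hinj
  have hu : ∀ l : Fin 3, ∃ u : T, ∀ j, χ (ix j) u = if j = l then 1 else 0 := by
    intro l
    obtain ⟨u, hu⟩ := hsurj fun j => if j = l then 1 else 0
    exact ⟨u, fun j => congrFun hu j⟩
  choose u hu using hu
  have hopu : ∀ l, (⟨op (u l), hT _ (u l).2⟩ : T) = u l := by
    intro l
    rw [← sub_eq_zero]
    refine hix _ fun j => ?_
    rw [map_sub, hχop, hu]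
    split_ifs <;> simp
  set φ := ZMod.castHom (dvd_refl 5) k with hφ
  have hφi : Function.Injective φ := φ.injective
  have ha : ∀ i l, ∃ n : ZMod 5, φ n = χ i (u l) := fun i l => by
    refine pow5_mem _ ?_
    rw [← hχop, hopu]
  choose a ha using ha
  set tn : (Fin 3 → ZMod 5) → T := fun n => ∑ l, φ (n l) • u l with htn
  have hχt : ∀ i n, χ i (tn n) = φ (dot5 (a i) n) := by
    intro i n
    simp only [htn, map_sum, map_smul, dot5, map_mul, ha, smul_eq_mul]
  have hcoord : ∀ n j, χ (ix j) (tn n) = φ (n j) := by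
    intro n j
    simp only [htn, map_sum, map_smul, hu, smul_eq_mul, mul_ite, mul_one, mul_zero, Finset.sum_ite_eq,
      Finset.mem_univ, if_true]
  have htn0 : ∀ n, tn n = 0 → n = 0 := by
    intro n hn
    funext j
    apply hφi
    rw [← hcoord, hn, map_zero, Pi.zero_apply, map_zero]
  have hcount : ∀ n, (Finset.univ.filter fun i => dot5 (a i) n = 0).card
      ≤ Module.finrank k (centr (k := k) (tn n : L)) := by
    intro n
    refine wt_card b (fun i => χ i (tn n)) _ (fun i => hχ i _) _ fun i hi => ?_
    rw [hχt, (Finset.mem_filter.1 hi).2, map_zero]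
  set B : Finset (Fin 3 → ZMod 5) := Finset.univ.filter fun n => n ≠ 0 ∧ M.ε (M.d1 (tn n)) = 0 ∧ M.ε (M.d2 (tn n)) = 0 with hB
  have memB : ∀ n, n ∈ B ↔ n ≠ 0 ∧ M.ε (M.d1 (tn n)) = 0 ∧ M.ε (M.d2 (tn n)) = 0 := fun n => by simp [hB]
  refine count5 a ?_ B ?_ ?_ ?_ ?_
  · refine h3.symm.le.trans ?_
    refine zero_wt_card b T hab χ hχ _ fun i hi => ?_
    rw [Finset.mem_filter]
    refine ⟨Finset.mem_univ _, funext fun l => hφi ?_⟩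
    rw [ha, hi, LinearMap.zero_apply, Pi.zero_apply, map_zero]
  · by_cases hemp : B = ∅
    · rw [hemp]; simp
    obtain ⟨m, hm⟩ := Finset.nonempty_iff_ne_empty.2 hemp
    obtain ⟨m0, m1, m2⟩ := (memB m).1 hm
    obtain ⟨j, hj⟩ : ∃ j, m j ≠ 0 := by
      by_contra hc
      push Not at hc
      exact m0 (funext hc)
    obtain ⟨c, hc⟩ := hline _ (tn m).2 m1 m2
    -- the coordinate on the line
    have h0t : (⟨t0, ht0⟩ : T) ≠ 0 := by
      intro h
      apply m0
      apply htn0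
      refine Subtype.ext ?_
      rw [hc, show t0 = 0 from congrArg Subtype.val h, smul_zero]; rfl
    have hcm : tn m = c • (⟨t0, ht0⟩ : T) := Subtype.ext hc
    have hjt : χ (ix j) ⟨t0, ht0⟩ ≠ 0 := by
      intro h
      apply hj
      apply hφi
      rw [← hcoord, hcm, map_smul, h, smul_zero, map_zero]
    have himg : B.image (fun n => n j) ⊆ Finset.univ.erase 0 := by
      intro y hy
      obtain ⟨n, hn, rfl⟩ := Finset.mem_image.1 hy
      obtain ⟨n0, n1, n2⟩ := (memB n).1 hn
      obtain ⟨d, hd⟩ := hline _ (tn n).2 n1 n2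
      have hd' : tn n = d • (⟨t0, ht0⟩ : T) := Subtype.ext hd
      refine Finset.mem_erase.2 ⟨fun h => n0 (htn0 n ?_), Finset.mem_univ _⟩
      have := hcoord n j
      rw [h, map_zero, hd', map_smul, smul_eq_mul] at this
      rw [hd', (mul_eq_zero.1 this).resolve_right hjt, zero_smul]
    have hcard : (B.image (fun n => n j)).card = B.card := by
      refine Finset.card_image_of_injOn fun n hn n' hn' h => ?_
      obtain ⟨n0, n1, n2⟩ := (memB n).1 hn
      obtain ⟨n0', n1', n2'⟩ := (memB n').1 hn'
      obtain ⟨d, hd⟩ := hline _ (tn n).2 n1 n2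
      obtain ⟨d', hd'⟩ := hline _ (tn n').2 n1' n2'
      have e : tn n = d • (⟨t0, ht0⟩ : T) := Subtype.ext hd
      have e' : tn n' = d' • (⟨t0, ht0⟩ : T) := Subtype.ext hd'
      have hh := hcoord n j
      have hh' := hcoord n' j
      rw [e, map_smul, smul_eq_mul] at hh
      rw [e', map_smul, smul_eq_mul] at hh'
      have h' : n j = n' j := h
      rw [h', ← hh'] at hh
      have hdd := mul_right_cancel₀ hjt hh
      funext l
      apply hφi
      rw [← hcoord, ← hcoord, e, e', hdd]
    have := Finset.card_le_card himg
    rw [hcard, Finset.card_erase_of_mem (Finset.mem_univ _), Finset.card_univ, ZMod.card] at this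
    exact this
  · intro h
    exact ((memB 0).1 h).1 rfl
  · intro n hn
    obtain ⟨n0, n1, n2⟩ := (memB n).1 hn
    refine (hcount n).trans (centr74 M _ n1 n2 fun h => n0 (htn0 n ?_))
    exact Subtype.ext (h0 _ (tn n).2 ⟨n1, n2, h⟩)
  · intro n hn n0
    exact (hcount n).trans (centr_le' M _ fun h => hn ((memB n).2 ⟨n0, h⟩))

theorem upper_M [CharP k 5] [IsAlgClosed k] [FiniteDimensional k L] {N : ℕ} (hN : mch M N = ⊥)
    (hL : Module.finrank k L = 125) {op : L → L} (hop : IsPMap 5 k op)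
    (hcent : ∀ x : L, (∀ y : L, ⁅x, y⁆ = 0) → x = 0)
    (t : LieSubalgebra k L) (ht : IsTorus k op t) : Module.finrank k t ≤ 2 := by
  set T := t.toSubmodule with hT
  have hab : ∀ s ∈ T, ∀ u ∈ T, ⁅s, u⁆ = 0 := fun s hs u hu =>
    torus_abelian (p := 5) (by norm_num) hop ht hs hu
  have htop := joint_diag_top ((LieAlgebra.ad k L : L →ₗ[k] Module.End k L).domRestrict T)
    (fun s u => LinearMap.ext fun g => by
      change ⁅(s : L), ⁅(u : L), g⁆⁆ = ⁅(u : L), ⁅(s : L), g⁆⁆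
      rw [leibniz_lie (s : L) (u : L) g, hab _ s.2 _ u.2, zero_lie, zero_add])
    (fun s => (pss_ad hop (ht.2 _ s.2)).isSemisimple)
  change Module.finrank k T ≤ 2
  by_cases hz : ∃ s : T, s ≠ 0 ∧ MZero M s
  · set J : L →ₗ[k] (Fin 2 → k) := LinearMap.pi ![M.ε.toLinearMap ∘ₗ M.d1, M.ε.toLinearMap ∘ₗ M.d2] with hJ
    obtain ⟨y, hy, bb, hbb⟩ := exists_basis_of_span J (fun v => by
      obtain ⟨z, h1, h2⟩ := M.hv (v 0) (v 1)
      refine ⟨z, funext fun i => ?_⟩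
      fin_cases i
      · exact h1
      · exact h2) htop (ι := Fin 2) (by simp)
    obtain ⟨χ1, h1⟩ := hy 0
    obtain ⟨χ2, h2⟩ := hy 1
    refine mel_upA M hN T hab (y 0) (y 1) ?_ χ1 χ2 h1 h2 hz
    have hdet : ((Pi.basisFun k (Fin 2)).toMatrix bb).det ≠ 0 := by
      have := (Pi.basisFun k (Fin 2)).isUnit_det bb
      rw [Module.Basis.det_apply] at this
      exact this.ne_zero
    rw [Matrix.det_fin_two] at hdet
    simp only [Module.Basis.toMatrix_apply, Pi.basisFun_repr, hbb] at hdet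
    intro h
    apply hdet
    change M.ε (M.d1 (y 0)) * M.ε (M.d2 (y 1)) - M.ε (M.d1 (y 1)) * M.ε (M.d2 (y 0)) = 0
    linear_combination h
  · push Not at hz
    obtain ⟨y, hy, bb, hbb⟩ := exists_basis_of_span (LinearMap.id (R := k) (M := L)) Function.surjective_id htop
      (ι := Fin 125) (by rw [hL]; simp)
    choose χ hχ using hy
    refine mel_upB M hop hcent T hab ht.1 ?_ bb χ ?_
    · intro s hs hm
      by_contra hs0
      exact hz ⟨s, hs⟩ (fun h => hs0 (congrArg Subtype.val h)) hm
    · intro i s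
      rw [hbb]
      exact hχ i s

end Mel4

section Mel5
variable {k : Type*} [Field k] {A : Type*} [CommRing A] [Algebra k A]
variable {L : Type*} [LieRing L] [LieAlgebra k L]

/-- abstract form of the Melikian bracket -/
def abr (P Q : Derivation k A A) (x y : A) (s z : Derivation k A A × A × Derivation k A A) :
    Derivation k A A × A × Derivation k A A :=
  (⁅s.1, z.1⁆ + s.2.1 • z.2.2 - z.2.1 • s.2.2,
   s.1 (z.2.1) - z.1 (s.2.1)
     - (2 : A) * (P (s.1 x) + Q (s.1 y)) * z.2.1
     + (2 : A) * (P (z.1 x) + Q (z.1 y)) * s.2.1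
     + (s.2.2 x * z.2.2 y - s.2.2 y * z.2.2 x),
   ⁅s.1, z.2.2⁆ + ((2 : A) * (P (s.1 x) + Q (s.1 y))) • z.2.2
     - ⁅z.1, s.2.2⁆ - ((2 : A) * (P (z.1 x) + Q (z.1 y))) • s.2.2
     + ((2 : A) * (z.2.1 * Q s.2.1 - s.2.1 * Q z.2.1)) • P
     + ((2 : A) * (s.2.1 * P z.2.1 - z.2.1 * P s.2.1)) • Q)

/-- evaluation of derivations -/
def evd (x : A) : Derivation k A A →ₗ[k] A where
  toFun D := D x
  map_add' _ _ := rfl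
  map_smul' _ _ := rfl

theorem evd_apply (x : A) (D : Derivation k A A) : evd x D = D x := rfl

/-- coordinates from an isomorphism -/
def melMk (P Q : Derivation k A A) (ε : A →ₐ[k] k) (x y : A)
    (Px : P x = 1) (Qx : Q x = 0) (Py : P y = 0) (Qy : Q y = 1) (xp : x ^ 5 = 0) (yp : y ^ 5 = 0)
    (unit : ∀ a, ε a ≠ 0 → IsUnit a) (finA : Module.finrank k A = 25)
    (quox : ∀ g, ∃ (c : Fin 5 → k) (h : A), g = ∑ j, c j • y ^ j.1 + x * h)
    (quoy : ∀ g, ∃ (c : Fin 5 → k) (h : A), g = ∑ j, c j • x ^ j.1 + y * h)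
    (hD : ∀ (D : Derivation k A A) g, D g = D x * P g + D y * Q g)
    (e : L ≃ₗ[k] (Derivation k A A × A × Derivation k A A)) (he : ∀ s z, e ⁅s, z⁆ = abr P Q x y (e s) (e z)) :
    MelData k A L where
  P := P
  Q := Q
  ε := ε
  d1 := evd x ∘ₗ LinearMap.fst k _ _ ∘ₗ e.toLinearMap
  d2 := evd y ∘ₗ LinearMap.fst k _ _ ∘ₗ e.toLinearMap
  f := LinearMap.fst k _ _ ∘ₗ LinearMap.snd k _ _ ∘ₗ e.toLinearMap
  e1 := evd x ∘ₗ LinearMap.snd k _ _ ∘ₗ LinearMap.snd k _ _ ∘ₗ e.toLinearMap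
  e2 := evd y ∘ₗ LinearMap.snd k _ _ ∘ₗ LinearMap.snd k _ _ ∘ₗ e.toLinearMap
  ext z h1 h2 h3 h4 h5 := by
    change (e z).1 x = 0 at h1
    change (e z).1 y = 0 at h2
    change (e z).2.1 = 0 at h3
    change (e z).2.2 x = 0 at h4
    change (e z).2.2 y = 0 at h5
    refine e.map_eq_zero_iff.1 (Prod.ext (Derivation.ext fun g => ?_) (Prod.ext h3 (Derivation.ext fun g => ?_)))
    · rw [hD, h1, h2, zero_mul, zero_mul, add_zero]; rfl
    · rw [hD, h4, h5, zero_mul, zero_mul, add_zero]; rfl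
  hv a b := by
    refine ⟨e.symm (a • P + b • Q, 0, 0), ?_, ?_⟩
    · change ε ((e (e.symm _)).1 x) = a
      rw [e.apply_symm_apply]
      change ε (a • P x + b • Q x) = a
      rw [Px, Qx]; simp
    · change ε ((e (e.symm _)).1 y) = b
      rw [e.apply_symm_apply]
      change ε (a • P y + b • Q y) = b
      rw [Py, Qy]; simp
  b1 s z := by
    change (e ⁅s, z⁆).1 x = ((e s).1 x * P ((e z).1 x) + (e s).1 y * Q ((e z).1 x))
      - ((e z).1 x * P ((e s).1 x) + (e z).1 y * Q ((e s).1 x)) + (e s).2.1 * (e z).2.2 x - (e z).2.1 * (e s).2.2 x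
    rw [he, ← hD, ← hD]; rfl
  b2 s z := by
    change (e ⁅s, z⁆).1 y = ((e s).1 x * P ((e z).1 y) + (e s).1 y * Q ((e z).1 y))
      - ((e z).1 x * P ((e s).1 y) + (e z).1 y * Q ((e s).1 y)) + (e s).2.1 * (e z).2.2 y - (e z).2.1 * (e s).2.2 y
    rw [he, ← hD, ← hD]; rfl
  bf s z := by
    change (e ⁅s, z⁆).2.1 = ((e s).1 x * P (e z).2.1 + (e s).1 y * Q (e z).2.1)
      - ((e z).1 x * P (e s).2.1 + (e z).1 y * Q (e s).2.1)
      - 2 * (P ((e s).1 x) + Q ((e s).1 y)) * (e z).2.1 + 2 * (P ((e z).1 x) + Q ((e z).1 y)) * (e s).2.1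
      + ((e s).2.2 x * (e z).2.2 y - (e s).2.2 y * (e z).2.2 x)
    rw [he, ← hD, ← hD]; rfl
  be1 s z := by
    change (e ⁅s, z⁆).2.2 x = ((e s).1 x * P ((e z).2.2 x) + (e s).1 y * Q ((e z).2.2 x))
      - ((e z).2.2 x * P ((e s).1 x) + (e z).2.2 y * Q ((e s).1 x))
      + 2 * (P ((e s).1 x) + Q ((e s).1 y)) * (e z).2.2 x
      - (((e z).1 x * P ((e s).2.2 x) + (e z).1 y * Q ((e s).2.2 x))
        - ((e s).2.2 x * P ((e z).1 x) + (e s).2.2 y * Q ((e z).1 x)))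
      - 2 * (P ((e z).1 x) + Q ((e z).1 y)) * (e s).2.2 x
      + 2 * ((e z).2.1 * Q (e s).2.1 - (e s).2.1 * Q (e z).2.1)
    rw [he, ← hD, ← hD, ← hD, ← hD]
    simp only [abr, Derivation.add_apply, Derivation.sub_apply, Derivation.smul_apply, Derivation.commutator_apply,
      smul_eq_mul, Px, Qx]
    ring
  be2 s z := by
    change (e ⁅s, z⁆).2.2 y = ((e s).1 x * P ((e z).2.2 y) + (e s).1 y * Q ((e z).2.2 y))
      - ((e z).2.2 x * P ((e s).1 y) + (e z).2.2 y * Q ((e s).1 y))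
      + 2 * (P ((e s).1 x) + Q ((e s).1 y)) * (e z).2.2 y
      - (((e z).1 x * P ((e s).2.2 y) + (e z).1 y * Q ((e s).2.2 y))
        - ((e s).2.2 x * P ((e z).1 y) + (e s).2.2 y * Q ((e z).1 y)))
      - 2 * (P ((e z).1 x) + Q ((e z).1 y)) * (e s).2.2 y
      + 2 * ((e s).2.1 * P (e z).2.1 - (e z).2.1 * P (e s).2.1)
    rw [he, ← hD, ← hD, ← hD, ← hD]
    simp only [abr, Derivation.add_apply, Derivation.sub_apply, Derivation.smul_apply, Derivation.commutator_apply,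
      smul_eq_mul, Py, Qy]
    ring
  x := x
  y := y
  Px := Px
  Qx := Qx
  Py := Py
  Qy := Qy
  xp := xp
  yp := yp
  ex := pow_eq_zero_iff (n := 5) (by norm_num) |>.1 (by rw [← map_pow, xp, map_zero])
  ey := pow_eq_zero_iff (n := 5) (by norm_num) |>.1 (by rw [← map_pow, yp, map_zero])
  unit := unit
  finA := finA
  quox := quox
  quoy := quoy

/-- the Witt part has trivial centralizer -/
theorem mel_cent [CharP k 5] (M : MelData k A L) (j : Derivation k A A → L)
    (j1 : ∀ D, M.d1 (j D) = D M.x) (j2 : ∀ D, M.d2 (j D) = D M.y) (jf : ∀ D, M.f (j D) = 0)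
    (je1 : ∀ D, M.e1 (j D) = 0) (je2 : ∀ D, M.e2 (j D) = 0) (E : L) (h : ∀ D, ⁅E, j D⁆ = 0) : E = 0 := by
  have fiveA : (5 : A) = 0 := by
    rw [← map_ofNat (algebraMap k A) 5, five_eq5 (k := k), map_zero]
  have g1 := fun D => M.b1 E (j D)
  have g2 := fun D => M.b2 E (j D)
  have g3 := fun D => M.bf E (j D)
  have g4 := fun D => M.be1 E (j D)
  have g5 := fun D => M.be2 E (j D)
  simp only [h, j1, j2, jf, je1, je2, map_zero] at g1 g2 g3 g4 g5
  have p1 := g1 M.P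
  have p2 := g2 M.P
  have p3 := g3 M.P
  have p4 := g4 M.P
  have p5 := g5 M.P
  have q1 := g1 M.Q
  have q2 := g2 M.Q
  have q3 := g3 M.Q
  have q4 := g4 M.Q
  have q5 := g5 M.Q
  have x1 := g1 (M.x • M.P)
  have x3 := g3 (M.x • M.P)
  have x4 := g4 (M.x • M.P)
  have y2 := g2 (M.y • M.Q)
  have y5 := g5 (M.y • M.Q)
  simp only [Derivation.smul_apply, smul_eq_mul, M.Px, M.Qx, M.Py, M.Qy, Derivation.map_one_eq_zero, map_zero, mul_zero,
    mul_one, one_mul, zero_mul, add_zero, zero_add, sub_zero, zero_sub] at p1 p2 p3 p4 p5 q1 q2 q3 q4 q5 x1 x3 x4 y2 y5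
  have r1 : M.P (M.d1 E) = 0 := by linear_combination p1
  have r2 : M.P (M.d2 E) = 0 := by linear_combination p2
  have r3 : M.P (M.f E) = 0 := by linear_combination p3
  have r4 : M.P (M.e1 E) = 0 := by linear_combination p4
  have s1 : M.Q (M.d1 E) = 0 := by linear_combination q1
  have s2 : M.Q (M.d2 E) = 0 := by linear_combination q2
  have s5 : M.Q (M.e2 E) = 0 := by linear_combination q5
  simp only [r1, r2, r3, r4, s1, s2, s5, M.Px, M.Qx, M.Py, M.Qy, mul_zero, mul_one, zero_mul, add_zero, zero_add, sub_zero, zero_sub, neg_zero] at x1 x3 x4 y2 y5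
  refine M.ext E ?_ ?_ ?_ ?_ ?_
  · linear_combination -x1
  · linear_combination -y2
  · linear_combination -3 * x3 - M.f E * fiveA
  · linear_combination x4
  · linear_combination y5

end Mel5

section LowerSub
variable {p : ℕ} {k : Type*} [Field k] [CharP k p] {L : Type*} [LieRing L] [LieAlgebra k L]
  {op : L → L} {n : ℕ}

theorem sub_op (hp : p.Prime) (hop : IsPMap p k op) (j : WittAlg p k n →ₗ⁅k⁆ L)
    (hcent : ∀ E : L, (∀ G, ⁅E, j G⁆ = 0) → E = 0) (D : WittAlg p k n) :
    op (j D) = j (derPow hp D) := by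
  rw [← sub_eq_zero]
  apply hcent
  intro G
  rw [sub_lie, ← LieHom.map_lie, lie_derPow, ← LieAlgebra.ad_apply k L (op (j D)) (j G), hop.ad_op,
    Module.End.pow_apply, sub_eq_zero]
  have key : ∀ i : ℕ, (⇑((LieAlgebra.ad k L) (j D)))^[i] (j G) = j ((fun z => ⁅D, z⁆)^[i] G) := ?_
  · exact key p
  intro i
  induction i with
  | zero => rfl
  | succ i ih => rw [Function.iterate_succ_apply', Function.iterate_succ_apply', LieAlgebra.ad_apply,
      LieHom.map_lie, ih]

theorem lower_sub (hp : p.Prime) [IsAlgClosed k] (hs : LieAlgebra.IsSimple k L)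
    (hop : IsPMap p k op)
    {V : Type*} [AddCommGroup V] [Module k V] [LieRingModule L V] [LieModule k L V]
    [FiniteDimensional k V] (hV : IsRestrictedModule p k op V)
    (hnt : ¬ LieModule.IsTrivial L V) (hn : 1 ≤ n)
    (j : WittAlg p k n →ₗ⁅k⁆ L) (hinj : Function.Injective j)
    (hcent : ∀ E : L, (∀ G, ⁅E, j G⁆ = 0) → E = 0) :
    p ^ n - 1 ≤ Module.finrank k V := by
  have hit : ∀ i D, op^[i] (j D) = j ((derPow hp)^[i] D) := by
    intro i D
    induction i with
    | zero => rfl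
    | succ i ih => rw [Function.iterate_succ_apply', Function.iterate_succ_apply', ih, sub_op hp hop j hcent]
  set a : WittAlg p k n := ∑ i : Fin n, odoT p (nX p k n) i • truncPD p k n i with ha'
  set b : WittAlg p k n := odoT p (nX p k n) n • truncPD p k n ⟨0, by omega⟩ with hb'
  have ha : ∀ i < n, a (nX p k n i) = odoT p (nX p k n) i := by
    intro i hi
    rw [nX_of_lt hi, der_sum_X]
  have hb0 : b (nX p k n 0) = odoT p (nX p k n) n := by
    rw [nX_of_lt (by omega : 0 < n), Derivation.smul_apply, pd_X]; simp
  have hb : ∀ i, 1 ≤ i → b (nX p k n i) = 0 := by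
    intro i hi
    by_cases h : i < n
    · rw [nX_of_lt h, Derivation.smul_apply, pd_X, if_neg]
      · simp
      · intro h; have := congrArg Fin.val h; simp at this; omega
    · rw [nX, dif_neg h, map_zero]
  clear_value a b
  obtain ⟨c, hc, h⟩ := odometer hp (nX p k n) n hn nX_pow a b ha hb0 hb
  refine pencil_bound hp hs hop hV hnt n 0 (j a) (j b) c hc ?_ ?_
  · intro l
    have e1 : (derPow hp)^[n] (a + l • b) - (c * l) • (a + l • b) = 0 := by
      apply der_ext
      intro i
      have := h l i i.2
      rw [nX_of_lt i.2] at this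
      exact this
    have e2 : j a + l • j b = j (a + l • b) := by rw [map_add, map_smul]
    rw [e2, pow_zero, pow_one, ← ad_iter hop, hit, ← map_smul, ← map_sub, ← map_smul, ← map_sub, e1, map_zero, map_zero]
  · rintro ⟨N, hN⟩
    have h0 : op^[N] (j a + j b) = 0 := by
      apply ad_inj_of_simple' (k := k) hs
      rw [ad_iter hop]
      exact pow_eq_zero_of_le (Nat.lt_pow_self hp.one_lt).le hN
    refine odo_nonnil hp n hn (nX p k n) nX_pow a b ha hb0 hc h N (hinj ?_)
    rw [← hit, map_add, h0, map_zero]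

end LowerSub

section MelMain

theorem quo_step {k A : Type*} [Field k] [CommRing A] [Algebra k A] {x y g : A} (yp : y ^ 5 = 0)
    (h : ∃ (c : Fin 5 → k) (h : A), g = ∑ j, c j • y ^ j.1 + x * h) :
    ∃ (c : Fin 5 → k) (h : A), g * y = ∑ j, c j • y ^ j.1 + x * h := by
  obtain ⟨c, h, rfl⟩ := h
  refine ⟨![0, c 0, c 1, c 2, c 3], h * y, ?_⟩
  simp [Fin.sum_univ_five, Algebra.smul_def]
  linear_combination (algebraMap k A (c 4)) * yp

variable {k : Type*} [Field k] [CharP k 5]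

local notation "A2" => TruncPoly 5 k 2

theorem quo_tp (i j : Fin 2) (hij : ∀ l, l = i ∨ l = j) (g : A2) :
    ∃ (c : Fin 5 → k) (h : A2), g = ∑ l, c l • truncX 5 k 2 j ^ l.1 + truncX 5 k 2 i * h := by
  induction g using tp_induction with
  | hC c => exact ⟨![c, 0, 0, 0, 0], 0, by simp [Fin.sum_univ_five, Algebra.smul_def]⟩
  | hadd f g hf hg =>
    obtain ⟨c, h, e1⟩ := hf
    obtain ⟨c', h', e2⟩ := hg
    refine ⟨c + c', h + h', ?_⟩
    simp only [Pi.add_apply, add_smul, Finset.sum_add_distrib]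
    linear_combination e1 + e2
  | hX f l hf =>
    rcases hij l with rfl | rfl
    · exact ⟨0, f, by simp [mul_comm]⟩
    · exact quo_step (truncX_pow _) hf

theorem hD_tp (D : WittAlg 5 k 2) (g : A2) : D g = D (truncX 5 k 2 0) * truncPD 5 k 2 0 g + D (truncX 5 k 2 1) * truncPD 5 k 2 1 g := by
  rw [der_apply, Fin.sum_univ_two]

theorem mb_abr (s z : MelikianCarrier 5 k) : melikianBracket 5 k s z =
    abr (truncPD 5 k 2 0) (truncPD 5 k 2 1) (truncX 5 k 2 0) (truncX 5 k 2 1) s z := by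
  unfold melikianBracket abr divergence
  rw [Fin.sum_univ_two, Fin.sum_univ_two]

variable {L : Type*} [LieRing L] [LieAlgebra k L]

/-- the coordinates of the Melikian algebra -/
noncomputable def MM (e : L ≃ₗ[k] MelikianCarrier 5 k)
    (he : ∀ x y : L, e ⁅x, y⁆ = melikianBracket 5 k (e x) (e y)) : MelData k A2 L :=
  melMk (truncPD 5 k 2 0) (truncPD 5 k 2 1) (eps (by norm_num)) (truncX 5 k 2 0) (truncX 5 k 2 1)
    (by rw [pd_X]; rfl) (by rw [pd_X]; rfl) (by rw [pd_X]; rfl) (by rw [pd_X]; rfl)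
    (truncX_pow _) (truncX_pow _) (fun a ha => isUnit_of_eps (by norm_num) ha) (by rw [finrank_tp]; norm_num)
    (quo_tp 0 1 (by decide)) (quo_tp 1 0 (by decide)) hD_tp e (fun s z => (he s z).trans (mb_abr _ _))

theorem MM_cf (e : L ≃ₗ[k] MelikianCarrier 5 k)
    (he : ∀ x y : L, e ⁅x, y⁆ = melikianBracket 5 k (e x) (e y)) (d : ℕ) :
    ∀ (g : A2), g ∈ mch (MM e he) d → ∀ a ha, a 0 + a 1 < d → cf a ha g = 0 := by
  induction d with
  | zero => intro g hg a ha h; omega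
  | succ d ih =>
    intro g hg a ha h
    rw [mem_mch_succ] at hg
    obtain ⟨h1, h2, h3, h4⟩ := hg
    by_cases h0 : a 0 = 0
    · by_cases h1' : a 1 = 0
      · have : a = 0 := by
          ext i; fin_cases i
          · exact h0
          · exact h1'
        subst this
        rw [← eps_eq_cf (by norm_num)]
        exact h2
      · apply cf_of_pd a ha 1 h1'
        apply ih _ h4
        simp; omega
    · apply cf_of_pd a ha 0 h0
      apply ih _ h3
      simp; omega

theorem MM_bot (e : L ≃ₗ[k] MelikianCarrier 5 k)
    (he : ∀ x y : L, e ⁅x, y⁆ = melikianBracket 5 k (e x) (e y)) : mch (MM e he) 9 = ⊥ := by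
  rw [eq_bot_iff]
  intro g hg
  refine tp_ext fun a ha => MM_cf e he 9 g hg a ha ?_
  have := ha 0
  have := ha 1
  omega

/-- derivations are pairs of functions -/
noncomputable def wEq : WittAlg 5 k 2 ≃ₗ[k] (A2 × A2) where
  toFun D := (D (truncX 5 k 2 0), D (truncX 5 k 2 1))
  map_add' _ _ := rfl
  map_smul' _ _ := rfl
  invFun z := z.1 • truncPD 5 k 2 0 + z.2 • truncPD 5 k 2 1
  left_inv D := by
    refine Derivation.ext fun g => ?_
    rw [hD_tp D g]; rfl
  right_inv z := by
    refine Prod.ext ?_ ?_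
    · change z.1 * truncPD 5 k 2 0 (truncX 5 k 2 0) + z.2 * truncPD 5 k 2 1 (truncX 5 k 2 0) = z.1
      rw [pd_X, pd_X]; simp
    · change z.1 * truncPD 5 k 2 0 (truncX 5 k 2 1) + z.2 * truncPD 5 k 2 1 (truncX 5 k 2 1) = z.2
      rw [pd_X, pd_X]; simp

theorem finrank_mel (e : L ≃ₗ[k] MelikianCarrier 5 k) : Module.finrank k L = 125 := by
  rw [(e.trans (wEq.prodCongr ((LinearEquiv.refl k A2).prodCongr wEq))).finrank_eq]
  simp only [Module.finrank_prod, finrank_tp]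
  norm_num

/-- the subalgebra `W(2)` -/
noncomputable def melJ (e : L ≃ₗ[k] MelikianCarrier 5 k)
    (he : ∀ x y : L, e ⁅x, y⁆ = melikianBracket 5 k (e x) (e y)) : WittAlg 5 k 2 →ₗ⁅k⁆ L where
  toFun D := e.symm (D, 0, 0)
  map_add' D G := by rw [← map_add]; simp
  map_smul' c D := by rw [RingHom.id_apply, ← map_smul]; simp
  map_lie' := by
    intro D G
    rw [LinearEquiv.symm_apply_eq, he, mb_abr, e.apply_symm_apply, e.apply_symm_apply]
    simp [abr]

theorem melJ_cent (e : L ≃ₗ[k] MelikianCarrier 5 k)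
    (he : ∀ x y : L, e ⁅x, y⁆ = melikianBracket 5 k (e x) (e y)) (E : L)
    (h : ∀ G, ⁅E, melJ e he G⁆ = 0) : E = 0 := by
  have hj : ∀ D, e (melJ e he D) = (D, 0, 0) := fun D => e.apply_symm_apply _
  refine mel_cent (MM e he) (melJ e he) ?_ ?_ ?_ ?_ ?_ E h
  · intro D; change (e (melJ e he D)).1 (truncX 5 k 2 0) = _; rw [hj]; rfl
  · intro D; change (e (melJ e he D)).1 (truncX 5 k 2 1) = _; rw [hj]; rfl
  · intro D; change (e (melJ e he D)).2.1 = _; rw [hj]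
  · intro D; change (e (melJ e he D)).2.2 (truncX 5 k 2 0) = _; rw [hj]; rfl
  · intro D; change (e (melJ e he D)).2.2 (truncX 5 k 2 1) = _; rw [hj]; rfl

theorem main_M [IsAlgClosed k] [FiniteDimensional k L] {op : L → L}
    (hs : LieAlgebra.IsSimple k L) (hop : IsPMap 5 k op)
    {V : Type*} [AddCommGroup V] [Module k V] [LieRingModule L V] [LieModule k L V]
    [FiniteDimensional k V] (hV : IsRestrictedModule 5 k op V)
    (hdim : Module.finrank k V < 5 ^ (mu k op) - 1) (e : L ≃ₗ[k] MelikianCarrier 5 k)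
    (he : ∀ x y : L, e ⁅x, y⁆ = melikianBracket 5 k (e x) (e y)) :
    LieModule.IsTrivial L V :=
  finish (m := 2) (by norm_num) hdim
    (fun t ht => upper_M (MM e he) (MM_bot e he) (finrank_mel e) hop (fun x hx => ad_inj_of_simple hs hx) t ht)
    (fun hnt => lower_sub (by norm_num) hs hop hV hnt (by norm_num) (melJ e he)
      (fun D G h => by
        have := e.symm.injective h
        exact congrArg Prod.fst this) (melJ_cent e he))

end MelMain

/-- Corollary 2.8.  Suppose `p > 3`.  Let `L` be a non-classical
finite-dimensional restricted simple Lie algebra over `k` (i.e. of Cartan type or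
Melikian) and let `V` be a restricted `L`-module with `dim V < p^{μ(L)} − 1`.  Then `V`
is a trivial `L`-module. -/
theorem nonclassical_simple_small_module_isTrivial
    (p : ℕ) (hp : p.Prime) (hp3 : 3 < p)
    (k : Type*) [Field k] [IsAlgClosed k] [CharP k p]
    {L : Type*} [LieRing L] [LieAlgebra k L] [FiniteDimensional k L]
    (hsimple : LieAlgebra.IsSimple k L)
    (op : L → L) (hop : IsPMap p k op)
    (hnc : IsNonClassicalRestrictedSimple p k L)
    (V : Type*) [AddCommGroup V] [Module k V] [LieRingModule L V] [LieModule k L V]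
    [FiniteDimensional k V] (hV : IsRestrictedModule p k op V)
    (hdim : Module.finrank k V < p ^ (mu k op) - 1) :
    LieModule.IsTrivial L V := by
  rcases hnc with (⟨n, hn, ⟨e⟩⟩ | ⟨n, hn, ⟨e⟩⟩ | ⟨n, hn, ⟨e⟩⟩ | ⟨n, hn, ⟨e⟩⟩) | ⟨h5, e, he⟩
  · exact main_W hp hsimple hop hV hdim hn e
  · exact main_S hp hsimple hop hV hdim hn e
  · exact main_H hp hp3 hsimple hop hV hdim hn e
  · exact main_K hp hp3 hsimple hop hV hdim hn e
  · subst h5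
    exact main_M hsimple hop hV hdim e he
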